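/- For each cluster quiver Q of simply-laced finite type, there exists an embedding of Q in the plane such that all vertices of Q belong to the closure of the unique unbounded connected component of the complement of the embedded quiver (a 'nice embedding'). -/

import Mathlib

noncomputable section

/-- Fomin–Zelevinsky mutation of an exchange matrix in direction `k`. -/
def clusterMutate {n : ℕ} (B : Matrix (Fin n) (Fin n) ℤ) (k : Fin n) :
    Matrix (Fin n) (Fin n) ℤ :=
  Matrix.of fun i j =>
    if i = k ∨ j = k then -B i j
    else B i j + (|B i k| * B k j + B i k * |B k j|) / 2

/-- Mutation equivalence of exchange matrices. -/
def MutationEquiv {n : ℕ} (B B' : Matrix (Fin n) (Fin n) ℤ) : Prop :=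
  Relation.ReflTransGen (fun X Y => ∃ k, Y = clusterMutate X k) B B'

/-- Adjacency in the Dynkin diagram `A_n`. -/
def adjA (n : ℕ) (i j : Fin n) : Prop := (i : ℕ) + 1 = j ∨ (j : ℕ) + 1 = i

/-- Adjacency in the Dynkin diagram `D_n`. -/
def adjD (n : ℕ) (i j : Fin n) : Prop :=
  ((i : ℕ) + 1 = j ∧ (j : ℕ) ≤ n - 2) ∨ ((j : ℕ) + 1 = i ∧ (i : ℕ) ≤ n - 2) ∨
    ((i : ℕ) = n - 3 ∧ (j : ℕ) = n - 1) ∨ ((j : ℕ) = n - 3 ∧ (i : ℕ) = n - 1)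

/-- Adjacency in the Dynkin diagram `E_n` (`n ∈ {6,7,8}`). -/
def adjE (n : ℕ) (i j : Fin n) : Prop :=
  ((i : ℕ) + 1 = j ∧ (j : ℕ) ≤ n - 2) ∨ ((j : ℕ) + 1 = i ∧ (i : ℕ) ≤ n - 2) ∨
    ((i : ℕ) = 2 ∧ (j : ℕ) = n - 1) ∨ ((j : ℕ) = 2 ∧ (i : ℕ) = n - 1)

/-- `B` is the skew-symmetric exchange matrix of an orientation of the graph `adj`. -/
def IsOrientationOf {n : ℕ} (B : Matrix (Fin n) (Fin n) ℤ)
    (adj : Fin n → Fin n → Prop) : Prop :=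
  (∀ i j, B j i = -B i j) ∧ (∀ i j, |B i j| ≤ 1) ∧ ∀ i j, B i j ≠ 0 ↔ adj i j

/-- `B` is an orientation of a simply laced Dynkin diagram (type `A`, `D` or `E`). -/
def IsDynkinADEOrientation {n : ℕ} (B : Matrix (Fin n) (Fin n) ℤ) : Prop :=
  IsOrientationOf B (adjA n) ∨ (4 ≤ n ∧ IsOrientationOf B (adjD n)) ∨
    ((n = 6 ∨ n = 7 ∨ n = 8) ∧ IsOrientationOf B (adjE n))

/-- A cluster quiver (exchange matrix) of simply laced finite type: one which is
mutation equivalent to an orientation of a Dynkin diagram of type `A`, `D` or `E`.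
There is an arrow `i → j` of the quiver precisely when `B i j > 0`. -/
def IsFiniteTypeClusterMatrix {n : ℕ} (B : Matrix (Fin n) (Fin n) ℤ) : Prop :=
  ∃ B₀, IsDynkinADEOrientation B₀ ∧ MutationEquiv B₀ B

/-- An embedding of the quiver on `Fin n` with arrow relation `arr` in the plane:
vertices are distinct points, each arrow is drawn as an injective continuous curve
from its source to its target, the open arcs of different arrows are disjoint from
each other and from all other arrow curves, and avoid the vertices. -/
structure PlaneEmb {n : ℕ} (arr : Fin n → Fin n → Prop) where
  vtx : Fin n → ℝ × ℝ
  vtx_inj : Function.Injective vtx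
  edge : ∀ i j : Fin n, arr i j → ℝ → ℝ × ℝ
  edge_cont : ∀ i j h, ContinuousOn (edge i j h) (Set.Icc 0 1)
  edge_src : ∀ i j h, edge i j h 0 = vtx i
  edge_tgt : ∀ i j h, edge i j h 1 = vtx j
  edge_inj : ∀ i j h, Set.InjOn (edge i j h) (Set.Icc 0 1)
  edge_disj : ∀ i j h i' j' h', (i, j) ≠ (i', j') →
    (edge i j h '' Set.Ioo 0 1) ∩ (edge i' j' h' '' Set.Icc 0 1) = ∅
  edge_vtx : ∀ i j h v, vtx v ∉ edge i j h '' Set.Ioo 0 1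

/-- The image of a plane embedding of a quiver: the union of the vertex points and of
the arrow curves. -/
def PlaneEmb.image {n : ℕ} {arr : Fin n → Fin n → Prop} (E : PlaneEmb arr) :
    Set (ℝ × ℝ) :=
  Set.range E.vtx ∪ ⋃ (i) (j) (h : arr i j), E.edge i j h '' Set.Icc 0 1

/-- The union of the unbounded connected components of the complement of `S`. -/
def unboundedPart (S : Set (ℝ × ℝ)) : Set (ℝ × ℝ) :=
  {x | x ∉ S ∧ ¬Bornology.IsBounded (connectedComponentIn Sᶜ x)}

/-- A plane embedding of a quiver is nice if the complement of its image has a unique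
unbounded connected component (i.e. the union of the unbounded components is
connected) and every vertex belongs to the closure of that component. -/
def PlaneEmb.Nice {n : ℕ} {arr : Fin n → Fin n → Prop} (E : PlaneEmb arr) : Prop :=
  IsPreconnected (unboundedPart E.image) ∧
    ∀ v, E.vtx v ∈ closure (unboundedPart E.image)


/-! ### Connectedness of the unbounded part -/

theorem isPreconnected_compl_square (R : ℝ) :
    IsPreconnected {z : ℝ × ℝ | R < z.1 ∨ R < z.2 ∨ z.1 < -R ∨ z.2 < -R} := by
  have h1 : IsPreconnected {z : ℝ × ℝ | R < z.1} :=
    (convex_halfSpace_gt (IsLinearMap.mk (fun _ _ => rfl) (fun _ _ => rfl)) R).isPreconnected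
  have h2 : IsPreconnected {z : ℝ × ℝ | R < z.2} :=
    (convex_halfSpace_gt (IsLinearMap.mk (fun _ _ => rfl) (fun _ _ => rfl)) R).isPreconnected
  have h3 : IsPreconnected {z : ℝ × ℝ | z.1 < -R} :=
    (convex_halfSpace_lt (IsLinearMap.mk (fun _ _ => rfl) (fun _ _ => rfl)) (-R)).isPreconnected
  have h4 : IsPreconnected {z : ℝ × ℝ | z.2 < -R} :=
    (convex_halfSpace_lt (IsLinearMap.mk (fun _ _ => rfl) (fun _ _ => rfl)) (-R)).isPreconnected
  have h12 := h1.union (R + 1, R + 1) (by simp) (by simp) h2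
  have h34 := h3.union (-R - 1, -R - 1) (by simp) (by simp) h4
  have h := h12.union (R + 1, -R - 1) (Or.inl (by simp)) (Or.inr (by simp)) h34
  convert h using 1
  ext z
  simp [or_assoc]

theorem isPreconnected_unboundedPart {S : Set (ℝ × ℝ)} (hS : Bornology.IsBounded S) :
    IsPreconnected (unboundedPart S) := by
  obtain ⟨R, hR⟩ := hS.subset_closedBall 0
  have hmem : ∀ z : ℝ × ℝ, z ∈ Metric.closedBall (0 : ℝ × ℝ) R ↔ |z.1| ≤ R ∧ |z.2| ≤ R := by
    intro z
    simp [Prod.norm_def]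
  set V : Set (ℝ × ℝ) := {z | R < z.1 ∨ R < z.2 ∨ z.1 < -R ∨ z.2 < -R} with hV
  have hVc : ∀ z, z ∉ V → z ∈ Metric.closedBall (0 : ℝ × ℝ) R := by
    intro z hz
    simp only [hV, Set.mem_ofPred_eq, not_or, not_lt] at hz
    rw [hmem, abs_le, abs_le]
    exact ⟨⟨hz.2.2.1, hz.1⟩, hz.2.2.2, hz.2.1⟩
  have hVS : V ⊆ Sᶜ := by
    intro z hz hzS
    have h := (hmem z).1 (hR hzS)
    rw [abs_le, abs_le] at h
    simp only [hV, Set.mem_ofPred_eq] at hz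
    rcases hz with hz | hz | hz | hz <;> linarith [h.1.1, h.1.2, h.2.1, h.2.2]
  have hz₀ : ((R + 1, 0) : ℝ × ℝ) ∈ V := Or.inl (by simp)
  have hsub : V ⊆ connectedComponentIn Sᶜ (R + 1, 0) :=
    (isPreconnected_compl_square R).subset_connectedComponentIn hz₀ hVS
  have hunb : ¬ Bornology.IsBounded (connectedComponentIn Sᶜ ((R + 1, 0) : ℝ × ℝ)) := by
    intro hb
    obtain ⟨C, hC⟩ := (hb.subset hsub).subset_closedBall 0
    have hv : ((|R| + |C| + 1, 0) : ℝ × ℝ) ∈ V :=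
      Or.inl (by simp; linarith [le_abs_self R, abs_nonneg C])
    have := hC hv
    simp only [Metric.mem_closedBall, dist_zero_right, Prod.norm_def, Real.norm_eq_abs,
      sup_le_iff] at this
    linarith [this.1, le_abs_self (|R| + |C| + 1), le_abs_self C, abs_nonneg R]
  suffices unboundedPart S = connectedComponentIn Sᶜ ((R + 1, 0) : ℝ × ℝ) by
    rw [this]
    exact isPreconnected_connectedComponentIn
  ext x
  constructor
  · rintro ⟨hxS, hx⟩
    have : ∃ z ∈ connectedComponentIn Sᶜ x, z ∈ V := by
      by_contra! hcon
      exact hx (Metric.isBounded_closedBall.subset fun z hz => hVc z (hcon z hz))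
    obtain ⟨z, hzx, hzV⟩ := this
    rw [connectedComponentIn_eq (hsub hzV), ← connectedComponentIn_eq hzx]
    exact mem_connectedComponentIn hxS
  · intro hx
    refine ⟨connectedComponentIn_subset _ _ hx, ?_⟩
    rwa [← connectedComponentIn_eq hx]

/-! ### Noncrossing orders and drawings by chords of a parabola -/

/-- No two entries of the support of `B` cross with respect to the height function `p`. -/
def Noncrossing {α β : Type*} [LT β] (p : α → β) (B : α → α → ℤ) : Prop :=
  ∀ a b c d, p a < p b → p b < p c → p c < p d → B a c ≠ 0 → B b d ≠ 0 → False

theorem chord_gap (a b t : ℝ) :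
    ((1 - t) * a ^ 2 + t * b ^ 2) - ((1 - t) * a + t * b) ^ 2 = t * (1 - t) * (b - a) ^ 2 := by
  ring

theorem isPreconnected_below_parabola : IsPreconnected {z : ℝ × ℝ | z.2 < z.1 ^ 2} := by
  have h : IsPreconnected {z : ℝ × ℝ | z.2 < 0} :=
    (convex_halfSpace_lt (IsLinearMap.mk (fun _ _ => rfl) (fun _ _ => rfl)) 0).isPreconnected
  have h' := h.image (fun z : ℝ × ℝ => (z.1, z.2 + z.1 ^ 2)) (by fun_prop)
  convert h' using 1
  ext ⟨x, y⟩
  simp only [Set.mem_ofPred_eq, Set.mem_image, Prod.mk.injEq, Prod.exists]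
  constructor
  · intro hxy
    exact ⟨x, y - x ^ 2, by linarith, rfl, by ring⟩
  · rintro ⟨u, v, hv, rfl, rfl⟩
    linarith

/-- Points of two chords of the parabola which do not cross and are different. -/
theorem chord_ne {a b c d x : ℝ} (hax : a < x) (hxb : x < b) (hcx : c ≤ x) (hxd : x ≤ d)
    (hne : a ≠ c ∨ b ≠ d) (h1 : ¬ (a < c ∧ b < d)) (h2 : ¬ (c < a ∧ d < b)) :
    (x - a) * (b - x) ≠ (x - c) * (d - x) := by
  intro heq
  have hpos : 0 < (x - a) * (b - x) := mul_pos (by linarith) (by linarith)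
  have hcx' : c < x := by
    refine lt_of_le_of_ne hcx fun h => hpos.ne' ?_
    rw [heq, h, sub_self, zero_mul]
  have hxd' : x < d := by
    refine lt_of_le_of_ne hxd fun h => hpos.ne' ?_
    rw [heq, h, sub_self, mul_zero]
  rcases lt_trichotomy a c with hac | hac | hac
  · have hbd : d ≤ b := by
      by_contra! hbd
      exact h1 ⟨hac, hbd⟩
    nlinarith [mul_pos (sub_pos.2 hac) (sub_pos.2 hxb), mul_nonneg (sub_nonneg.2 hcx)
      (sub_nonneg.2 hbd)]
  · subst hac
    have hbd : b ≠ d := hne.resolve_left (by simp)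
    have : b - x = d - x := mul_left_cancel₀ (by linarith : x - a ≠ 0) heq
    exact hbd (by linarith)
  · have hbd : b ≤ d := by
      by_contra! hbd
      exact h2 ⟨hac, hbd⟩
    nlinarith [mul_pos (sub_pos.2 hac) (sub_pos.2 hxd'), mul_nonneg (sub_nonneg.2 hax.le)
      (sub_nonneg.2 hbd)]

section Drawing

variable {n : ℕ} {B : Matrix (Fin n) (Fin n) ℤ} {p : Fin n → ℝ}

/-- The straight segment joining two points of the parabola `y = x ^ 2`. -/
def parabolaChord (a b t : ℝ) : ℝ × ℝ :=
  ((1 - t) * a + t * b, (1 - t) * a ^ 2 + t * b ^ 2)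

theorem parabolaChord_gap (a b t : ℝ) :
    (parabolaChord a b t).2 - (parabolaChord a b t).1 ^ 2 = t * (1 - t) * (b - a) ^ 2 :=
  chord_gap a b t

theorem parabolaChord_injective {a b : ℝ} (hab : a ≠ b) :
    Function.Injective (parabolaChord a b) := by
  intro s t hst
  have h := congrArg Prod.fst hst
  simp only [parabolaChord] at h
  have h' : (s - t) * (b - a) = 0 := by linarith
  rcases mul_eq_zero.1 h' with h' | h'
  · linarith
  · exact absurd (by linarith) hab

theorem parabolaChord_symm (a b t : ℝ) : parabolaChord a b t = parabolaChord b a (1 - t) := by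
  simp only [parabolaChord, Prod.mk.injEq]
  constructor <;> ring

theorem parabolaChord_ne_of_lt {a b c d s t : ℝ} (hab : a < b) (hcd : c < d)
    (hs : s ∈ Set.Ioo (0 : ℝ) 1) (ht : t ∈ Set.Icc (0 : ℝ) 1) (hne : a ≠ c ∨ b ≠ d)
    (h1 : ¬ (a < c ∧ c < b ∧ b < d)) (h2 : ¬ (c < a ∧ a < d ∧ d < b)) :
    parabolaChord a b s ≠ parabolaChord c d t := by
  intro heq
  obtain ⟨hs0, hs1⟩ := hs
  obtain ⟨ht0, ht1⟩ := ht
  have e1 := congrArg Prod.fst heq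
  have e2 := congrArg Prod.snd heq
  simp only [parabolaChord] at e1 e2
  have f1 : a < (1 - s) * a + s * b := by nlinarith
  have f2 : (1 - s) * a + s * b < b := by nlinarith
  have f3 : c ≤ (1 - s) * a + s * b := by rw [e1]; nlinarith
  have f4 : (1 - s) * a + s * b ≤ d := by rw [e1]; nlinarith
  refine chord_ne f1 f2 f3 f4 hne (fun h => h1 ⟨h.1, by linarith, h.2⟩)
    (fun h => h2 ⟨h.1, by linarith, h.2⟩) ?_
  have g1 := chord_gap a b s
  have g2 := chord_gap c d t
  rw [← e1, ← e2, g1] at g2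
  calc _ = s * (1 - s) * (b - a) ^ 2 := by ring
    _ = t * (1 - t) * (d - c) ^ 2 := g2
    _ = _ := by rw [e1]; ring

theorem parabolaChord_ne {a b c d s t : ℝ} (hab : a ≠ b) (hcd : c ≠ d)
    (hs : s ∈ Set.Ioo (0 : ℝ) 1) (ht : t ∈ Set.Icc (0 : ℝ) 1)
    (hne : ¬ (a = c ∧ b = d)) (hne' : ¬ (a = d ∧ b = c))
    (h1 : ¬ (min a b < min c d ∧ min c d < max a b ∧ max a b < max c d))
    (h2 : ¬ (min c d < min a b ∧ min a b < max c d ∧ max c d < max a b)) :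
    parabolaChord a b s ≠ parabolaChord c d t := by
  have hs' : 1 - s ∈ Set.Ioo (0 : ℝ) 1 := ⟨by linarith [hs.2], by linarith [hs.1]⟩
  have ht' : 1 - t ∈ Set.Icc (0 : ℝ) 1 := ⟨by linarith [ht.2], by linarith [ht.1]⟩
  rcases lt_or_gt_of_ne hab with hab | hab <;> rcases lt_or_gt_of_ne hcd with hcd | hcd <;>
    simp only [min_eq_left hab.le, min_eq_left hcd.le, min_eq_right hab.le, min_eq_right hcd.le,
      max_eq_left hab.le, max_eq_left hcd.le, max_eq_right hab.le, max_eq_right hcd.le] at h1 h2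
  · exact parabolaChord_ne_of_lt hab hcd hs ht (by tauto) h1 h2
  · rw [parabolaChord_symm c d]
    exact parabolaChord_ne_of_lt hab hcd hs ht' (by tauto) h1 h2
  · rw [parabolaChord_symm a b]
    exact parabolaChord_ne_of_lt hab hcd hs' ht (by tauto) h1 h2
  · rw [parabolaChord_symm a b, parabolaChord_symm c d]
    exact parabolaChord_ne_of_lt hab hcd hs' ht' (by tauto) h1 h2

theorem Noncrossing.not_min_max {β : Type*} [LinearOrder β] {q : Fin n → β}
    (hp : Noncrossing q B) (hB : ∀ i j, B j i = -B i j)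
    {i j k l : Fin n} (hij : B i j ≠ 0) (hkl : B k l ≠ 0) :
    ¬ (min (q i) (q j) < min (q k) (q l) ∧ min (q k) (q l) < max (q i) (q j) ∧
      max (q i) (q j) < max (q k) (q l)) := by
  rintro ⟨h1, h2, h3⟩
  have hji : B j i ≠ 0 := by rw [hB]; exact neg_ne_zero.2 hij
  have hlk : B l k ≠ 0 := by rw [hB]; exact neg_ne_zero.2 hkl
  rcases le_total (q i) (q j) with hij' | hij' <;> rcases le_total (q k) (q l) with hkl' | hkl' <;>
    simp only [min_eq_left hij', min_eq_left hkl', min_eq_right hij', min_eq_right hkl',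
      max_eq_left hij', max_eq_left hkl', max_eq_right hij', max_eq_right hkl'] at h1 h2 h3
  · exact hp _ _ _ _ h1 h2 h3 hij hkl
  · exact hp _ _ _ _ h1 h2 h3 hij hlk
  · exact hp _ _ _ _ h1 h2 h3 hji hkl
  · exact hp _ _ _ _ h1 h2 h3 hji hlk

/-- The drawing of a quiver by chords of a parabola. -/
def chordDrawing (hB : ∀ i j, B j i = -B i j) (hpi : Function.Injective p)
    (hp : Noncrossing p B) : PlaneEmb (fun i j : Fin n => 0 < B i j) where
  vtx i := (p i, p i ^ 2)
  vtx_inj i j h := hpi (congrArg Prod.fst h)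
  edge i j _ := parabolaChord (p i) (p j)
  edge_cont i j h := by
    unfold parabolaChord
    fun_prop
  edge_src i j h := by simp [parabolaChord]
  edge_tgt i j h := by simp [parabolaChord]
  edge_inj i j h := by
    refine (parabolaChord_injective fun hp' => ?_).injOn
    obtain rfl := hpi hp'
    linarith [hB i i]
  edge_disj i j h i' j' h' hne := by
    have key : ∀ {a b}, 0 < B a b → p a ≠ p b := by
      intro a b hab hp'
      obtain rfl := hpi hp'
      linarith [hB a a]
    rw [← Set.disjoint_iff_inter_eq_empty, Set.disjoint_left]
    rintro _ ⟨s, hs, rfl⟩ ⟨t, ht, hst⟩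
    refine parabolaChord_ne (key h) (key h') hs ht ?_ ?_
      (hp.not_min_max hB h.ne' h'.ne') (hp.not_min_max hB h'.ne' h.ne') hst.symm
    · rintro ⟨h1, h2⟩
      exact hne (by rw [hpi h1, hpi h2])
    · rintro ⟨h1, h2⟩
      obtain rfl := hpi h1
      obtain rfl := hpi h2
      linarith [hB i j]
  edge_vtx i j h v := by
    rintro ⟨t, ⟨ht0, ht1⟩, hv⟩
    have hij : p j - p i ≠ 0 := by
      intro h0
      obtain rfl := hpi (sub_eq_zero.1 h0)
      linarith [hB j j]
    have hgap := parabolaChord_gap (p i) (p j) t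
    rw [hv, sub_self] at hgap
    have : 0 < t * (1 - t) * (p j - p i) ^ 2 :=
      mul_pos (mul_pos ht0 (by linarith)) (by positivity)
    linarith

theorem chordDrawing_nice (hB : ∀ i j, B j i = -B i j) (hpi : Function.Injective p)
    (hp : Noncrossing p B) : (chordDrawing hB hpi hp).Nice := by
  set E := chordDrawing hB hpi hp with hE
  have hbdd : Bornology.IsBounded E.image := by
    refine (Set.finite_range _).isBounded.union ?_
    refine Bornology.isBounded_iUnion.2 fun i => Bornology.isBounded_iUnion.2 fun j => ?_
    by_cases h : 0 < B i j
    swap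
    · simp [h]
    simp only [h, Set.iUnion_true]
    exact (isCompact_Icc.image_of_continuousOn (E.edge_cont i j h)).isBounded
  have hdisj : {z : ℝ × ℝ | z.2 < z.1 ^ 2} ⊆ E.imageᶜ := by
    rintro z hz (⟨i, rfl⟩ | hzE)
    · simp [hE, chordDrawing] at hz
    · simp only [Set.mem_iUnion] at hzE
      obtain ⟨i, j, h, t, ⟨ht0, ht1⟩, rfl⟩ := hzE
      have hgap := parabolaChord_gap (p i) (p j) t
      have : 0 ≤ t * (1 - t) * (p j - p i) ^ 2 :=
        mul_nonneg (mul_nonneg ht0 (by linarith)) (by positivity)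
      have hz' : (parabolaChord (p i) (p j) t).2 < (parabolaChord (p i) (p j) t).1 ^ 2 := hz
      linarith
  have hsub : {z : ℝ × ℝ | z.2 < z.1 ^ 2} ⊆ unboundedPart E.image := by
    intro z hz
    refine ⟨hdisj hz, fun hb => ?_⟩
    obtain ⟨C, hC⟩ := (hb.subset (isPreconnected_below_parabola.subset_connectedComponentIn hz
      hdisj)).subset_closedBall 0
    have : ((0, -|C| - 1) : ℝ × ℝ) ∈ {z : ℝ × ℝ | z.2 < z.1 ^ 2} := by
      simp only [Set.mem_ofPred_eq]
      nlinarith [abs_nonneg C]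
    have := hC this
    simp only [Metric.mem_closedBall, dist_zero_right, Prod.norm_def, Real.norm_eq_abs,
      sup_le_iff] at this
    linarith [this.2, neg_abs_le (-|C| - 1), le_abs_self C]
  refine ⟨isPreconnected_unboundedPart hbdd, fun v => closure_mono hsub ?_⟩
  have hlim : Filter.Tendsto (fun m : ℕ => ((p v, p v ^ 2 - 1 / ((m : ℝ) + 1)) : ℝ × ℝ))
      Filter.atTop (nhds (p v, p v ^ 2 - 0)) :=
    tendsto_const_nhds.prodMk_nhds
      (tendsto_const_nhds.sub tendsto_one_div_add_atTop_nhds_zero_nat)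
  rw [sub_zero] at hlim
  refine mem_closure_of_tendsto hlim (Filter.Eventually.of_forall fun m => ?_)
  have : (0 : ℝ) < 1 / ((m : ℝ) + 1) := by positivity
  simp only [Set.mem_ofPred_eq]
  linarith

end Drawing

theorem exists_nice_of_noncrossing {n : ℕ} {B : Matrix (Fin n) (Fin n) ℤ}
    (hB : ∀ i j, B j i = -B i j) {q : Fin n → ℕ} (hqi : Function.Injective q)
    (hq : Noncrossing q B) : ∃ E : PlaneEmb (fun i j : Fin n => 0 < B i j), E.Nice := by
  refine ⟨chordDrawing (p := fun i => (q i : ℝ)) hB (Nat.cast_injective.comp hqi) ?_,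
    chordDrawing_nice _ _ _⟩
  intro a b c d h1 h2 h3
  exact hq a b c d (Nat.cast_lt.1 h1) (Nat.cast_lt.1 h2) (Nat.cast_lt.1 h3)

/-! ### Mutation: skew-symmetry, restriction, and a formula for split rows -/

theorem clusterMutate_apply {n : ℕ} (B : Matrix (Fin n) (Fin n) ℤ) (k i j : Fin n) :
    clusterMutate B k i j = if i = k ∨ j = k then -B i j
      else B i j + (|B i k| * B k j + B i k * |B k j|) / 2 := rfl

theorem clusterMutate_skew {n : ℕ} {B : Matrix (Fin n) (Fin n) ℤ}
    (hB : ∀ i j, B j i = -B i j) (k i j : Fin n) :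
    clusterMutate B k j i = -clusterMutate B k i j := by
  rw [clusterMutate_apply, clusterMutate_apply]
  by_cases h : i = k ∨ j = k
  · rw [if_pos h, if_pos h.symm, hB i j]
  · rw [if_neg h, if_neg (fun h' => h h'.symm), hB i j, hB i k, hB k j, abs_neg, abs_neg]
    have : |B k j| * -B i k + -B k j * |B i k| = -(|B i k| * B k j + B i k * |B k j|) := by ring
    rw [this, Int.neg_ediv_of_dvd, neg_add]
    rcases abs_choice (B i k) with h1 | h1 <;> rcases abs_choice (B k j) with h2 | h2 <;>
      rw [h1, h2]
    · exact ⟨B i k * B k j, by ring⟩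
    · exact ⟨0, by ring⟩
    · exact ⟨0, by ring⟩
    · exact ⟨-(B i k * B k j), by ring⟩

theorem clusterMutate_neg {n : ℕ} {B : Matrix (Fin n) (Fin n) ℤ}
    (k i j : Fin n) :
    clusterMutate (-B) k i j = -clusterMutate B k i j := by
  rw [clusterMutate_apply, clusterMutate_apply]
  split_ifs
  · rfl
  · simp only [Matrix.neg_apply, abs_neg]
    have : |B i k| * -B k j + -B i k * |B k j| = -(|B i k| * B k j + B i k * |B k j|) := by ring
    rw [this, Int.neg_ediv_of_dvd, neg_add]
    rcases abs_choice (B i k) with h1 | h1 <;> rcases abs_choice (B k j) with h2 | h2 <;>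
      rw [h1, h2]
    · exact ⟨B i k * B k j, by ring⟩
    · exact ⟨0, by ring⟩
    · exact ⟨0, by ring⟩
    · exact ⟨-(B i k * B k j), by ring⟩

theorem clusterMutate_submatrix {m n : ℕ} {f : Fin m → Fin n} (hf : Function.Injective f)
    (B : Matrix (Fin n) (Fin n) ℤ) (k : Fin m) :
    clusterMutate (B.submatrix f f) k = (clusterMutate B (f k)).submatrix f f := by
  ext i j
  simp only [clusterMutate_apply, Matrix.submatrix_apply, hf.eq_iff]

theorem clusterMutate_eq_self {n : ℕ} {B : Matrix (Fin n) (Fin n) ℤ} {k : Fin n}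
    (hr : ∀ j, B k j = 0) (hc : ∀ i, B i k = 0) : clusterMutate B k = B := by
  ext i j
  rw [clusterMutate_apply]
  split_ifs with h
  · rcases h with rfl | rfl
    · rw [hr, neg_zero]
    · rw [hc, neg_zero]
  · simp [hr, hc]

theorem MutationEquiv.skew {n : ℕ} {B B' : Matrix (Fin n) (Fin n) ℤ} (h : MutationEquiv B B')
    (hB : ∀ i j, B j i = -B i j) : ∀ i j, B' j i = -B' i j := by
  induction h with
  | refl => exact hB
  | tail _ h ih =>
    obtain ⟨k, rfl⟩ := h
    exact fun i j => clusterMutate_skew ih k i j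

theorem MutationEquiv.exists_submatrix {m n : ℕ} {f : Fin m → Fin n}
    (hf : Function.Injective f) {C : Matrix (Fin n) (Fin n) ℤ} {B : Matrix (Fin m) (Fin m) ℤ}
    (h : MutationEquiv (C.submatrix f f) B) :
    ∃ C', MutationEquiv C C' ∧ B = C'.submatrix f f := by
  induction h with
  | refl => exact ⟨C, Relation.ReflTransGen.refl, rfl⟩
  | tail _ h ih =>
    obtain ⟨k, rfl⟩ := h
    obtain ⟨C', hC, rfl⟩ := ih
    exact ⟨clusterMutate C' (f k), hC.tail ⟨f k, rfl⟩, clusterMutate_submatrix hf C' k⟩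

/-- An orientation of an induced subgraph extends to an orientation of the graph. -/
theorem IsOrientationOf.exists_extend {m n : ℕ} {f : Fin m → Fin n} (hf : Function.Injective f)
    {adj : Fin m → Fin m → Prop} {adj' : Fin n → Fin n → Prop}
    (hsymm : ∀ i j, adj' i j → adj' j i) (hirr : ∀ i, ¬ adj' i i)
    (hadj : ∀ i j, adj' (f i) (f j) ↔ adj i j) {B : Matrix (Fin m) (Fin m) ℤ}
    (hB : IsOrientationOf B adj) :
    ∃ C, IsOrientationOf C adj' ∧ B = C.submatrix f f := by
  classical
  obtain ⟨h1, h2, h3⟩ := hB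
  have key : ∀ x y, ∃ c : ℤ, (∀ i j, x = f i → y = f j → c = B i j) ∧
      ((¬ ∃ i j, x = f i ∧ y = f j) →
        c = if adj' x y then (if x < y then 1 else -1) else 0) := by
    intro x y
    by_cases h : ∃ i j, x = f i ∧ y = f j
    · obtain ⟨i, j, rfl, rfl⟩ := h
      refine ⟨B i j, fun i' j' hi hj => by rw [hf hi, hf hj], fun h => (h ⟨i, j, rfl, rfl⟩).elim⟩
    · exact ⟨_, fun i j hi hj => (h ⟨i, j, hi, hj⟩).elim, fun _ => rfl⟩
  choose C hC hC' using key
  have hCf : ∀ i j, C (f i) (f j) = B i j := fun i j => hC _ _ i j rfl rfl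
  refine ⟨C, ?_, ?_⟩
  · have all : ∀ x y, C y x = -C x y ∧ |C x y| ≤ 1 ∧ (C x y ≠ 0 ↔ adj' x y) := by
      intro x y
      by_cases h : ∃ i j, x = f i ∧ y = f j
      · obtain ⟨i, j, rfl, rfl⟩ := h
        rw [hCf, hCf, hadj]
        exact ⟨h1 i j, h2 i j, h3 i j⟩
      · have h' : ¬ ∃ i j, y = f i ∧ x = f j := fun ⟨i, j, hi, hj⟩ => h ⟨j, i, hj, hi⟩
        rw [hC' x y h, hC' y x h']
        by_cases ha : adj' x y
        · rw [if_pos ha, if_pos (hsymm _ _ ha)]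
          have hxy : x ≠ y := by
            rintro rfl
            exact hirr _ ha
          rcases lt_or_gt_of_ne hxy with hlt | hlt
          · simp [hlt, hlt.not_gt, ha]
          · simp [hlt, hlt.not_gt, ha]
        · rw [if_neg ha, if_neg fun h => ha (hsymm _ _ h)]
          simp [ha]
    exact ⟨fun x y => (all x y).1, fun x y => (all x y).2.1, fun x y => (all x y).2.2⟩
  · ext i j
    exact (hCf i j).symm

theorem Noncrossing.submatrix {m n : ℕ} {f : Fin m → Fin n} {B : Matrix (Fin n) (Fin n) ℤ}
    {q : Fin n → ℕ} (h : Noncrossing q B) : Noncrossing (q ∘ f) (B.submatrix f f) :=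
  fun _ _ _ _ h1 h2 h3 => h _ _ _ _ h1 h2 h3

/-- Mutation at `k` in terms of the positive part `P` and the negative part `Q` of row `k`. -/
theorem clusterMutate_of_row {n : ℕ} {B B' : Matrix (Fin n) (Fin n) ℤ} {k : Fin n}
    {P Q : Fin n → ℤ} (hB : ∀ i j, B j i = -B i j) (hrow : ∀ j, B k j = P j - Q j)
    (hP : ∀ i, 0 ≤ P i) (hQ : ∀ i, 0 ≤ Q i) (hPQ : ∀ i, P i * Q i = 0)
    (hB' : ∀ i j, B' j i = -B' i j) (hrow' : ∀ j, B' k j = -(P j - Q j))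
    (hoff : ∀ i j, i ≠ k → j ≠ k → B' i j = B i j + (Q i * P j - P i * Q j)) :
    clusterMutate B k = B' := by
  ext i j
  rw [clusterMutate_apply]
  split_ifs with h
  · rcases h with rfl | rfl
    · rw [hrow, hrow']
    · rw [hB j i, hB' j i, hrow, hrow']
  · push Not at h
    rw [hoff i j h.1 h.2, hB k i, hrow, hrow]
    congr 1
    rcases mul_eq_zero.1 (hPQ i) with h1 | h1 <;> rcases mul_eq_zero.1 (hPQ j) with h2 | h2 <;>
      simp only [h1, h2, zero_sub, sub_zero, neg_neg, abs_neg, abs_of_nonneg (hP i),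
        abs_of_nonneg (hP j), abs_of_nonneg (hQ i), abs_of_nonneg (hQ j)]
    · rw [Int.ediv_eq_of_eq_mul_left two_ne_zero]; ring
    · rw [Int.ediv_eq_of_eq_mul_left two_ne_zero]; ring
    · rw [Int.ediv_eq_of_eq_mul_left two_ne_zero]; ring
    · rw [Int.ediv_eq_of_eq_mul_left two_ne_zero]; ring

/-! ### Quivers glued from oriented triangles -/

/-- The indicator vector of an optional vertex. -/
def optInd {n : ℕ} (o : Option (Fin n)) (i : Fin n) : ℤ := if o = some i then 1 else 0

/-- The exchange matrix of a single arrow between optional vertices. -/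
def arrowMat {n : ℕ} (x y : Option (Fin n)) : Matrix (Fin n) (Fin n) ℤ :=
  Matrix.of fun i j => optInd x i * optInd y j - optInd x j * optInd y i

/-- The exchange matrix of the oriented triangle `x → y → z → x`, some of whose vertices may be
absent. -/
def triMat {n : ℕ} (x y z : Option (Fin n)) : Matrix (Fin n) (Fin n) ℤ :=
  arrowMat x y + arrowMat y z + arrowMat z x

/-- Two optional vertices are not equal to the same vertex. -/
def OptDisjoint {n : ℕ} (x y : Option (Fin n)) : Prop := ∀ i, x = some i → y = some i → False

section Gluing

variable {n : ℕ}

theorem arrowMat_apply (x y : Option (Fin n)) (i j : Fin n) :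
    arrowMat x y i j = optInd x i * optInd y j - optInd x j * optInd y i := rfl

theorem arrowMat_skew (x y : Option (Fin n)) (i j : Fin n) :
    arrowMat x y j i = -arrowMat x y i j := by
  simp only [arrowMat_apply]; ring

theorem triMat_apply (x y z : Option (Fin n)) (i j : Fin n) :
    triMat x y z i j = arrowMat x y i j + arrowMat y z i j + arrowMat z x i j := rfl

theorem triMat_skew (x y z : Option (Fin n)) (i j : Fin n) :
    triMat x y z j i = -triMat x y z i j := by
  simp only [triMat_apply, arrowMat_apply]; ring

theorem triMat_rotate (x y z : Option (Fin n)) : triMat x y z = triMat y z x := by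
  unfold triMat; abel

theorem optInd_nonneg (x : Option (Fin n)) (i : Fin n) : 0 ≤ optInd x i := by
  unfold optInd; split_ifs <;> norm_num

theorem OptDisjoint.symm {x y : Option (Fin n)} (h : OptDisjoint x y) : OptDisjoint y x :=
  fun i hy hx => h i hx hy

theorem OptDisjoint.mul_eq_zero {x y : Option (Fin n)} (h : OptDisjoint x y) (i : Fin n) :
    optInd x i * optInd y i = 0 := by
  unfold optInd
  split_ifs with h1 h2
  · exact (h i h1 h2).elim
  all_goals simp

theorem optInd_eq_zero {x : Option (Fin n)} {i : Fin n} (h : x ≠ some i) : optInd x i = 0 :=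
  if_neg h

theorem optInd_self (i : Fin n) : optInd (some i) i = 1 := if_pos rfl

theorem optInd_some_of_ne {i k : Fin n} (h : i ≠ k) : optInd (some k) i = 0 :=
  if_neg fun h' => h (Option.some.inj h').symm

theorem triMat_ne_zero {x y z : Option (Fin n)} {i j : Fin n} (h : triMat x y z i j ≠ 0) :
    (x = some i ∨ y = some i ∨ z = some i) ∧ (x = some j ∨ y = some j ∨ z = some j) := by
  by_contra hcon
  apply h
  simp only [triMat_apply, arrowMat_apply]
  rw [not_and_or] at hcon
  rcases hcon with hcon | hcon <;> push Not at hcon <;>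
    simp [optInd_eq_zero hcon.1, optInd_eq_zero hcon.2.1, optInd_eq_zero hcon.2.2]

theorem arrowMat_ne_zero {x y : Option (Fin n)} {i j : Fin n} (h : arrowMat x y i j ≠ 0) :
    (x = some i ∨ y = some i) ∧ (x = some j ∨ y = some j) := by
  by_contra hcon
  apply h
  simp only [arrowMat_apply]
  rw [not_and_or] at hcon
  rcases hcon with hcon | hcon <;> push Not at hcon <;>
    simp [optInd_eq_zero hcon.1, optInd_eq_zero hcon.2]

/-- Mutation at the common vertex of two oriented triangles: the flip of a quadrilateral. -/
theorem clusterMutate_flip {R : Matrix (Fin n) (Fin n) ℤ} {a b c d : Option (Fin n)} {k : Fin n}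
    (hR : ∀ i j, R j i = -R i j) (hRk : ∀ j, R k j = 0)
    (hak : a ≠ some k) (hbk : b ≠ some k) (hck : c ≠ some k) (hdk : d ≠ some k)
    (hab : OptDisjoint a b) (had : OptDisjoint a d) (hcb : OptDisjoint c b)
    (hcd : OptDisjoint c d) :
    clusterMutate (R + triMat a b (some k) + triMat (some k) c d) k =
      R + triMat b c (some k) + triMat (some k) d a := by
  refine clusterMutate_of_row (P := fun i => optInd a i + optInd c i)
    (Q := fun i => optInd b i + optInd d i) ?_ ?_ ?_ ?_ ?_ ?_ ?_ ?_
  · intro i j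
    simp only [Matrix.add_apply, hR i j, triMat_skew _ _ _ i j]; ring
  · intro j
    simp only [Matrix.add_apply, hRk, triMat_apply, arrowMat_apply, optInd_self,
      optInd_eq_zero hak, optInd_eq_zero hbk, optInd_eq_zero hck, optInd_eq_zero hdk]
    ring
  · exact fun i => add_nonneg (optInd_nonneg _ _) (optInd_nonneg _ _)
  · exact fun i => add_nonneg (optInd_nonneg _ _) (optInd_nonneg _ _)
  · intro i
    linear_combination hab.mul_eq_zero i + had.mul_eq_zero i + hcb.mul_eq_zero i +
      hcd.mul_eq_zero i
  · intro i j
    simp only [Matrix.add_apply, hR i j, triMat_skew _ _ _ i j]; ring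
  · intro j
    simp only [Matrix.add_apply, hRk, triMat_apply, arrowMat_apply, optInd_self,
      optInd_eq_zero hak, optInd_eq_zero hbk, optInd_eq_zero hck, optInd_eq_zero hdk]
    ring
  · intro i j hi hj
    simp only [Matrix.add_apply, triMat_apply, arrowMat_apply, optInd_some_of_ne hi,
      optInd_some_of_ne hj]
    ring

end Gluing

/-- Binary trees labelled by vertices: the dual trees of partial triangulations of a polygon. -/
inductive HalfTree (n : ℕ) : Type
  | nil : HalfTree n
  | node : Fin n → HalfTree n → HalfTree n → HalfTree n

namespace HalfTree

variable {n : ℕ}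

/-- The label of the root, if there is one. -/
def root : HalfTree n → Option (Fin n)
  | nil => none
  | node k _ _ => some k

/-- The labels in preorder. -/
def labels : HalfTree n → List (Fin n)
  | nil => []
  | node k l r => k :: (l.labels ++ r.labels)

/-- The exchange matrix of the quiver glued from one oriented triangle for each node. -/
def mat : HalfTree n → Matrix (Fin n) (Fin n) ℤ
  | nil => 0
  | node k l r => triMat (some k) l.root r.root + l.mat + r.mat

theorem root_node (k : Fin n) (l r : HalfTree n) : (node k l r).root = some k := rfl

theorem mat_node (k : Fin n) (l r : HalfTree n) :
    (node k l r).mat = triMat (some k) l.root r.root + l.mat + r.mat := rfl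

theorem mem_labels_of_root : ∀ {t : HalfTree n} {i : Fin n}, t.root = some i → i ∈ t.labels
  | nil, _, h => by simp [root] at h
  | node k l r, i, h => by
    simp only [root, Option.some.injEq] at h
    simp [labels, h]

theorem mat_skew : ∀ (t : HalfTree n) (i j : Fin n), t.mat j i = -t.mat i j
  | nil, i, j => by simp [mat]
  | node k l r, i, j => by
    simp only [mat, Matrix.add_apply, triMat_skew _ _ _ i j, mat_skew l i j, mat_skew r i j]
    ring

theorem mem_labels_of_mat_ne_zero : ∀ {t : HalfTree n} {i j : Fin n}, t.mat i j ≠ 0 →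
    i ∈ t.labels ∧ j ∈ t.labels
  | nil, i, j, h => by simp [mat] at h
  | node k l r, i, j, h => by
    have hl := @mem_labels_of_mat_ne_zero l i j
    have hr := @mem_labels_of_mat_ne_zero r i j
    have hl' := @mem_labels_of_root n l
    have hr' := @mem_labels_of_root n r
    by_cases h1 : l.mat i j = 0
    · by_cases h2 : r.mat i j = 0
      · have h3 : triMat (some k) l.root r.root i j ≠ 0 := by
          simpa [mat, h1, h2] using h
        have := triMat_ne_zero h3
        simp only [labels, List.mem_cons, List.mem_append, Option.some.injEq] at *
        grind
      · simp [labels, hr h2]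
    · simp [labels, hl h1]

theorem mat_eq_zero_of_notMem {t : HalfTree n} {k : Fin n} (h : k ∉ t.labels) (j : Fin n) :
    t.mat k j = 0 := by
  by_contra hcon
  exact h (mem_labels_of_mat_ne_zero hcon).1

theorem root_ne_some {t : HalfTree n} {k : Fin n} (h : k ∉ t.labels) : t.root ≠ some k :=
  fun h' => h (mem_labels_of_root h')

theorem optDisjoint_some_some {x y : Fin n} (h : x ≠ y) : OptDisjoint (some x) (some y) :=
  fun i hx hy => h (by rw [Option.some.inj hx, Option.some.inj hy])

theorem optDisjoint_some_root {t : HalfTree n} {x : Fin n} (h : x ∉ t.labels) :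
    OptDisjoint (some x) t.root :=
  fun i hx hi => h (by rw [Option.some.inj hx]; exact mem_labels_of_root hi)

theorem optDisjoint_root_root {s t : HalfTree n} (h : ∀ x ∈ s.labels, x ∉ t.labels) :
    OptDisjoint s.root t.root :=
  fun i hs ht => h i (mem_labels_of_root hs) (mem_labels_of_root ht)

/-- Mutation at a vertex of a tree other than the root is a tree rotation. -/
theorem exists_flip : ∀ (t : HalfTree n), t.labels.Nodup → ∀ k ∈ t.labels, t.root ≠ some k →
    ∃ t' : HalfTree n, t'.root = t.root ∧ t'.labels.Perm t.labels ∧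
      ∀ R : Matrix (Fin n) (Fin n) ℤ, (∀ i j, R j i = -R i j) → (∀ j, R k j = 0) →
        clusterMutate (R + t.mat) k = R + t'.mat
  | nil, _, k, hk, _ => by simp [labels] at hk
  | node u l r, hnd, k, hk, hroot => by
    have hnd' := hnd
    simp only [labels, List.nodup_cons, List.mem_append, not_or, List.nodup_append] at hnd'
    obtain ⟨⟨hul, hur⟩, hl, hr, hlr⟩ := hnd'
    have huk : k ≠ u := fun h => hroot (by rw [h]; rfl)
    have hk' : k ∈ l.labels ∨ k ∈ r.labels := by
      simpa [labels, huk] using hk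
    rcases hk' with hkl | hkr
    · have hkr : k ∉ r.labels := fun h => hlr k hkl k h rfl
      by_cases hlk : l.root = some k
      · cases l with
        | nil => simp [root] at hlk
        | node k' p q =>
          obtain rfl : k' = k := by simpa [root] using hlk
          simp only [labels, List.nodup_cons, List.mem_append, not_or, List.nodup_append,
            List.mem_cons] at hl hul hlr
          refine ⟨node u p (node k' q r), rfl, ?_, ?_⟩
          · rw [List.perm_iff_count]
            intro a
            simp only [labels, List.count_cons, List.count_append]
            omega
          · intro R hR hRk
            have := clusterMutate_flip (R := R + p.mat + q.mat + r.mat) (a := r.root)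
              (b := some u) (c := p.root) (d := q.root) (k := k')
              (by intro i j; simp only [Matrix.add_apply, hR i j, mat_skew _ i j]; ring)
              (by intro j; simp only [Matrix.add_apply, hRk, mat_eq_zero_of_notMem hkr,
                    mat_eq_zero_of_notMem hl.1.1, mat_eq_zero_of_notMem hl.1.2]; rfl)
              (root_ne_some hkr) (by simpa using huk.symm) (root_ne_some hl.1.1)
              (root_ne_some hl.1.2) (optDisjoint_some_root hur).symm
              (optDisjoint_root_root (by grind)) (optDisjoint_some_root (by grind)).symm
              (optDisjoint_root_root (by grind))
            simp only [mat_node, root_node]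
            convert this using 1
            · congr 1
              rw [← triMat_rotate r.root]; abel
            · abel
      · obtain ⟨l', h1, h2, h3⟩ := exists_flip l hl k hkl hlk
        refine ⟨node u l' r, rfl, ?_, ?_⟩
        · exact (h2.append_right _).cons u
        · intro R hR hRk
          have := h3 (R + triMat (some u) l.root r.root + r.mat)
            (by intro i j; simp only [Matrix.add_apply, hR i j, mat_skew _ i j,
                  triMat_skew _ _ _ i j]; ring)
            (by
              intro j
              have : triMat (some u) l.root r.root k j = 0 := by
                by_contra hcon
                have := (triMat_ne_zero hcon).1
                simp [huk.symm, hlk, root_ne_some hkr] at this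
              simp [hRk, mat_eq_zero_of_notMem hkr, this])
          simp only [mat_node, h1]
          convert this using 1
          · congr 1
            abel
          · abel
    · have hkl : k ∉ l.labels := fun h => hlr k h k hkr rfl
      by_cases hrk : r.root = some k
      · cases r with
        | nil => simp [root] at hrk
        | node k' p q =>
          obtain rfl : k' = k := by simpa [root] using hrk
          simp only [labels, List.nodup_cons, List.mem_append, not_or, List.nodup_append,
            List.mem_cons] at hr hur hlr
          refine ⟨node u (node k' l p) q, rfl, ?_, ?_⟩
          · rw [List.perm_iff_count]
            intro a
            simp only [labels, List.count_cons, List.count_append]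
            omega
          · intro R hR hRk
            have := clusterMutate_flip (R := R + p.mat + q.mat + l.mat) (a := some u)
              (b := l.root) (c := p.root) (d := q.root) (k := k')
              (by intro i j; simp only [Matrix.add_apply, hR i j, mat_skew _ i j]; ring)
              (by intro j; simp only [Matrix.add_apply, hRk, mat_eq_zero_of_notMem hkl,
                    mat_eq_zero_of_notMem hr.1.1, mat_eq_zero_of_notMem hr.1.2]; rfl)
              (by simpa using huk.symm) (root_ne_some hkl) (root_ne_some hr.1.1)
              (root_ne_some hr.1.2) (optDisjoint_some_root hul)
              (optDisjoint_some_root (by grind)) (optDisjoint_root_root (by grind))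
              (optDisjoint_root_root (by grind))
            simp only [mat_node, root_node]
            convert this using 1
            · congr 1
              abel
            · rw [triMat_rotate l.root, triMat_rotate p.root, triMat_rotate (some k') q.root,
                triMat_rotate q.root]
              abel
      · obtain ⟨r', h1, h2, h3⟩ := exists_flip r hr k hkr hrk
        refine ⟨node u l r', rfl, ?_, ?_⟩
        · exact (h2.append_left _).cons u
        · intro R hR hRk
          have := h3 (R + triMat (some u) l.root r.root + l.mat)
            (by intro i j; simp only [Matrix.add_apply, hR i j, mat_skew _ i j,
                  triMat_skew _ _ _ i j]; ring)
            (by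
              intro j
              have : triMat (some u) l.root r.root k j = 0 := by
                by_contra hcon
                have := (triMat_ne_zero hcon).1
                simp [huk.symm, hrk, root_ne_some hkl] at this
              simp [hRk, mat_eq_zero_of_notMem hkl, this])
          simp only [mat_node, h1]
          convert this using 1
          · congr 1
            abel
          · abel

theorem root_le {t : HalfTree n} {p : Fin n → ℕ}
    (hp : t.labels.Pairwise fun x y => p x < p y) {x y : Fin n} (hx : t.root = some x)
    (hy : y ∈ t.labels) : p x ≤ p y := by
  cases t with
  | nil => simp [root] at hx
  | node k l r =>
    obtain rfl : k = x := by simpa [root] using hx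
    simp only [labels, List.pairwise_cons] at hp
    simp only [labels, List.mem_cons] at hy
    rcases hy with rfl | hy
    · exact le_rfl
    · exact (hp.1 y hy).le

end HalfTree

theorem Noncrossing.add {n : ℕ} {p : Fin n → ℕ} {A B : Matrix (Fin n) (Fin n) ℤ}
    (hA : Noncrossing p A) (hB : Noncrossing p B)
    (h1 : ∀ a b c d, p a < p b → p b < p c → p c < p d → A a c ≠ 0 → B b d ≠ 0 → False)
    (h2 : ∀ a b c d, p a < p b → p b < p c → p c < p d → B a c ≠ 0 → A b d ≠ 0 → False) :
    Noncrossing p (A + B) := by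
  intro a b c d hab hbc hcd hac hbd
  have key : ∀ x y, (A + B) x y ≠ 0 → A x y ≠ 0 ∨ B x y ≠ 0 := by
    intro x y h
    by_contra! hcon
    exact h (by simp [hcon])
  rcases key _ _ hac with hac | hac <;> rcases key _ _ hbd with hbd | hbd
  · exact hA a b c d hab hbc hcd hac hbd
  · exact h1 a b c d hab hbc hcd hac hbd
  · exact h2 a b c d hab hbc hcd hac hbd
  · exact hB a b c d hab hbc hcd hac hbd

theorem noncrossing_triMat {n : ℕ} (p : Fin n → ℕ) (x y z : Option (Fin n)) :
    Noncrossing p (triMat x y z) := by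
  intro a b c d hab hbc hcd hac hbd
  have h1 := triMat_ne_zero hac
  have h2 := triMat_ne_zero hbd
  grind

namespace HalfTree

theorem noncrossing_mat {n : ℕ} {p : Fin n → ℕ} : ∀ (t : HalfTree n),
    (t.labels.Pairwise fun x y => p x < p y) → Noncrossing p t.mat
  | nil, _ => fun _ _ _ _ _ _ _ h => by simp [mat] at h
  | node u l r, hp => by
    simp only [labels, List.pairwise_cons, List.pairwise_append, List.mem_append] at hp
    obtain ⟨hu, hl, hr, hlr⟩ := hp
    have rl := fun x y => @root_le n l p hl x y
    have rr := fun x y => @root_le n r p hr x y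
    have ml := fun x => @mem_labels_of_root n l x
    have mr := fun x => @mem_labels_of_root n r x
    refine Noncrossing.add (Noncrossing.add (noncrossing_triMat _ _ _ _)
      (noncrossing_mat l hl) ?_ ?_) (noncrossing_mat r hr) ?_ ?_
    · intro a b c d hab hbc hcd hac hbd
      obtain ⟨ha, hc⟩ := triMat_ne_zero hac
      obtain ⟨hb, hd⟩ := mem_labels_of_mat_ne_zero hbd
      grind
    · intro a b c d hab hbc hcd hac hbd
      obtain ⟨ha, hc⟩ := mem_labels_of_mat_ne_zero hac
      obtain ⟨hb, hd⟩ := triMat_ne_zero hbd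
      grind
    · intro a b c d hab hbc hcd hac hbd
      obtain ⟨hb, hd⟩ := mem_labels_of_mat_ne_zero hbd
      have hac' : triMat (some u) l.root r.root a c ≠ 0 ∨ l.mat a c ≠ 0 := by
        by_contra! hcon
        exact hac (by simp [hcon])
      rcases hac' with hac | hac
      · obtain ⟨ha, hc⟩ := triMat_ne_zero hac
        grind
      · obtain ⟨ha, hc⟩ := mem_labels_of_mat_ne_zero hac
        grind
    · intro a b c d hab hbc hcd hac hbd
      obtain ⟨ha, hc⟩ := mem_labels_of_mat_ne_zero hac
      have hbd' : triMat (some u) l.root r.root b d ≠ 0 ∨ l.mat b d ≠ 0 := by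
        by_contra! hcon
        exact hbd (by simp [hcon])
      rcases hbd' with hbd | hbd
      · obtain ⟨hb, hd⟩ := triMat_ne_zero hbd
        grind
      · obtain ⟨hb, hd⟩ := mem_labels_of_mat_ne_zero hbd
        grind

end HalfTree

/-! ### Type D: once-punctured polygons -/

section TypeD

variable {n : ℕ}

/-- The first spoke of a list of spokes with attached trees, with a default. -/
def firstSpoke : List (Fin n × HalfTree n) → Fin n → Fin n
  | [], e => e
  | (x, _) :: _, _ => x

/-- The triangles between consecutive spokes, with trees attached on their outer sides; the last
triangle is closed by the spoke `e`. -/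
def spokeMat : List (Fin n × HalfTree n) → Fin n → Matrix (Fin n) (Fin n) ℤ
  | [], _ => 0
  | (x, H) :: L, e => triMat (some x) H.root (some (firstSpoke L e)) + H.mat + spokeMat L e

/-- The labels of a list of spokes with attached trees. -/
def spokeLabels : List (Fin n × HalfTree n) → List (Fin n)
  | [] => []
  | (x, H) :: L => x :: (H.labels ++ spokeLabels L)

/-- The quiver with two twin vertices `a` and `b` glued along a triangle to two trees. -/
def twinMat (a b : Fin n) (l r : HalfTree n) : Matrix (Fin n) (Fin n) ℤ :=
  triMat (some a) l.root r.root + arrowMat (some b) l.root + arrowMat r.root (some b) +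
    l.mat + r.mat

/-- Quivers of triangulations of a once-punctured polygon. -/
def IsPuncturedDisc (B : Matrix (Fin n) (Fin n) ℤ) : Prop :=
  (∃ x H L, L ≠ [] ∧ (spokeLabels ((x, H) :: L)).Nodup ∧ B = spokeMat ((x, H) :: L) x) ∨
    ∃ a b l r, (a :: (HalfTree.labels l ++ b :: HalfTree.labels r)).Nodup ∧ B = twinMat a b l r

theorem firstSpoke_nil (e : Fin n) : firstSpoke [] e = e := rfl

theorem firstSpoke_cons (x : Fin n) (H : HalfTree n) (L : List (Fin n × HalfTree n)) (e : Fin n) :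
    firstSpoke ((x, H) :: L) e = x := rfl

theorem spokeMat_nil (e : Fin n) : spokeMat [] e = 0 := rfl

theorem spokeMat_cons (x : Fin n) (H : HalfTree n) (L : List (Fin n × HalfTree n)) (e : Fin n) :
    spokeMat ((x, H) :: L) e =
      triMat (some x) H.root (some (firstSpoke L e)) + H.mat + spokeMat L e := rfl

theorem spokeLabels_append (L M : List (Fin n × HalfTree n)) :
    spokeLabels (L ++ M) = spokeLabels L ++ spokeLabels M := by
  induction L with
  | nil => rfl
  | cons a L ih => simp [spokeLabels, ih]

theorem firstSpoke_append (L M : List (Fin n × HalfTree n)) (e : Fin n) :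
    firstSpoke (L ++ M) e = firstSpoke L (firstSpoke M e) := by
  cases L <;> rfl

theorem spokeMat_append (L M : List (Fin n × HalfTree n)) (e : Fin n) :
    spokeMat (L ++ M) e = spokeMat L (firstSpoke M e) + spokeMat M e := by
  induction L with
  | nil => simp [spokeMat]
  | cons a L ih =>
    obtain ⟨x, H⟩ := a
    simp only [List.cons_append, spokeMat, firstSpoke_append, ih]
    abel

theorem spokeMat_rotate (w x : Fin n) (G H : HalfTree n) (L M : List (Fin n × HalfTree n)) :
    spokeMat ((w, G) :: L ++ (x, H) :: M) w = spokeMat ((x, H) :: M ++ (w, G) :: L) x := by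
  rw [spokeMat_append, spokeMat_append, add_comm]
  rfl

theorem spokeLabels_append_perm (L M : List (Fin n × HalfTree n)) :
    (spokeLabels (L ++ M)).Perm (spokeLabels (M ++ L)) := by
  rw [spokeLabels_append, spokeLabels_append]
  exact List.perm_append_comm

theorem firstSpoke_mem (L : List (Fin n × HalfTree n)) (e : Fin n) :
    firstSpoke L e = e ∨ firstSpoke L e ∈ spokeLabels L := by
  cases L with
  | nil => exact Or.inl rfl
  | cons a L => right; simp [firstSpoke, spokeLabels]

theorem firstSpoke_mem_of_ne_nil {L : List (Fin n × HalfTree n)} (hL : L ≠ []) (e : Fin n) :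
    firstSpoke L e ∈ spokeLabels L := by
  cases L with
  | nil => exact (hL rfl).elim
  | cons a L => simp [firstSpoke, spokeLabels]

theorem spokeMat_skew (L : List (Fin n × HalfTree n)) (e i j : Fin n) :
    spokeMat L e j i = -spokeMat L e i j := by
  induction L with
  | nil => simp [spokeMat]
  | cons a L ih =>
    obtain ⟨x, H⟩ := a
    simp only [spokeMat, Matrix.add_apply, triMat_skew _ _ _ i j, H.mat_skew i j, ih]
    ring

theorem mem_of_spokeMat_ne_zero {L : List (Fin n × HalfTree n)} {e i j : Fin n}
    (h : spokeMat L e i j ≠ 0) :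
    (i = e ∨ i ∈ spokeLabels L) ∧ (j = e ∨ j ∈ spokeLabels L) := by
  induction L with
  | nil => simp [spokeMat] at h
  | cons a L ih =>
    obtain ⟨x, H⟩ := a
    have hroot := @HalfTree.mem_labels_of_root n H
    by_cases h1 : H.mat i j = 0
    · by_cases h2 : spokeMat L e i j = 0
      · have h3 : triMat (some x) H.root (some (firstSpoke L e)) i j ≠ 0 := by
          simpa [spokeMat, h1, h2] using h
        have h4 := triMat_ne_zero h3
        have h5 := firstSpoke_mem L e
        simp only [spokeLabels, List.mem_cons, List.mem_append, Option.some.injEq] at *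
        grind
      · have := ih h2
        simp only [spokeLabels, List.mem_cons, List.mem_append]
        tauto
    · have := HalfTree.mem_labels_of_mat_ne_zero h1
      simp [spokeLabels, this]

theorem spokeMat_eq_zero_of_notMem {L : List (Fin n × HalfTree n)} {e k : Fin n} (hke : k ≠ e)
    (hk : k ∉ spokeLabels L) (j : Fin n) : spokeMat L e k j = 0 := by
  by_contra hcon
  rcases (mem_of_spokeMat_ne_zero hcon).1 with h | h
  · exact hke h
  · exact hk h

theorem twinMat_skew (a b : Fin n) (l r : HalfTree n) (i j : Fin n) :
    twinMat a b l r j i = -twinMat a b l r i j := by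
  simp only [twinMat, Matrix.add_apply, triMat_skew _ _ _ i j, arrowMat_skew _ _ i j,
    l.mat_skew i j, r.mat_skew i j]
  ring

theorem twinMat_comm (a b : Fin n) (l r : HalfTree n) : twinMat a b l r = twinMat b a l r := by
  ext i j
  simp only [twinMat, triMat, Matrix.add_apply]
  ring

theorem twinMat_ne_zero {a b : Fin n} {l r : HalfTree n} {i j : Fin n}
    (h : twinMat a b l r i j ≠ 0) :
    triMat (some a) l.root r.root i j ≠ 0 ∨ arrowMat (some b) l.root i j ≠ 0 ∨
      arrowMat r.root (some b) i j ≠ 0 ∨ l.mat i j ≠ 0 ∨ r.mat i j ≠ 0 := by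
  by_contra! hcon
  exact h (by simp [twinMat, hcon])

theorem mem_of_twinMat_ne_zero {a b : Fin n} {l r : HalfTree n} {i j : Fin n}
    (h : twinMat a b l r i j ≠ 0) :
    i ∈ a :: (l.labels ++ b :: r.labels) := by
  have hl := @HalfTree.mem_labels_of_root n l i
  have hr := @HalfTree.mem_labels_of_root n r i
  simp only [List.mem_cons, List.mem_append]
  rcases twinMat_ne_zero h with h | h | h | h | h
  · have := (triMat_ne_zero h).1
    grind
  · have := (arrowMat_ne_zero h).1
    grind
  · have := (arrowMat_ne_zero h).1
    grind
  · simp [(HalfTree.mem_labels_of_mat_ne_zero h).1]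
  · simp [(HalfTree.mem_labels_of_mat_ne_zero h).1]

/-- Flipping one of exactly two spokes. -/
theorem clusterMutate_digon {R : Matrix (Fin n) (Fin n) ℤ} {g h w : Option (Fin n)} {x : Fin n}
    (hR : ∀ i j, R j i = -R i j) (hRx : ∀ j, R x j = 0) (hg : g ≠ some x) (hh : h ≠ some x)
    (hw : w ≠ some x) (hgh : OptDisjoint g h) :
    clusterMutate (R + triMat w g (some x) + triMat (some x) h w) x =
      R + triMat (some x) g h + arrowMat w g + arrowMat h w := by
  refine clusterMutate_of_row (P := optInd h) (Q := optInd g) ?_ ?_ (optInd_nonneg _)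
    (optInd_nonneg _) hgh.symm.mul_eq_zero ?_ ?_ ?_
  · intro i j
    simp only [Matrix.add_apply, hR i j, triMat_skew _ _ _ i j]; ring
  · intro j
    simp only [Matrix.add_apply, hRx, triMat_apply, arrowMat_apply, optInd_self,
      optInd_eq_zero hg, optInd_eq_zero hh, optInd_eq_zero hw]
    ring
  · intro i j
    simp only [Matrix.add_apply, hR i j, triMat_skew _ _ _ i j, arrowMat_skew _ _ i j]; ring
  · intro j
    simp only [Matrix.add_apply, hRx, triMat_apply, arrowMat_apply, optInd_self,
      optInd_eq_zero hg, optInd_eq_zero hh, optInd_eq_zero hw]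
    ring
  · intro i j hi hj
    simp only [Matrix.add_apply, triMat_apply, arrowMat_apply, optInd_some_of_ne hi,
      optInd_some_of_ne hj]
    ring

/-- Flipping one of two twin vertices. -/
theorem clusterMutate_twin {R : Matrix (Fin n) (Fin n) ℤ} {l r b : Option (Fin n)} {a : Fin n}
    (hR : ∀ i j, R j i = -R i j) (hRa : ∀ j, R a j = 0) (hl : l ≠ some a) (hr : r ≠ some a)
    (hb : b ≠ some a) (hlr : OptDisjoint l r) :
    clusterMutate (R + triMat (some a) l r + arrowMat b l + arrowMat r b) a =
      R + triMat b l (some a) + triMat (some a) r b := by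
  refine clusterMutate_of_row (P := optInd l) (Q := optInd r) ?_ ?_ (optInd_nonneg _)
    (optInd_nonneg _) hlr.mul_eq_zero ?_ ?_ ?_
  · intro i j
    simp only [Matrix.add_apply, hR i j, triMat_skew _ _ _ i j, arrowMat_skew _ _ i j]; ring
  · intro j
    simp only [Matrix.add_apply, hRa, triMat_apply, arrowMat_apply, optInd_self,
      optInd_eq_zero hl, optInd_eq_zero hr, optInd_eq_zero hb]
    ring
  · intro i j
    simp only [Matrix.add_apply, hR i j, triMat_skew _ _ _ i j]; ring
  · intro j
    simp only [Matrix.add_apply, hRa, triMat_apply, arrowMat_apply, optInd_self,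
      optInd_eq_zero hl, optInd_eq_zero hr, optInd_eq_zero hb]
    ring
  · intro i j hi hj
    simp only [Matrix.add_apply, triMat_apply, arrowMat_apply, optInd_some_of_ne hi,
      optInd_some_of_ne hj]
    ring

/-- Flipping the root of the first of the two trees attached to a pair of twins. -/
theorem clusterMutate_twin_left {R : Matrix (Fin n) (Fin n) ℤ} {a b r p q : Option (Fin n)}
    {k : Fin n} (hR : ∀ i j, R j i = -R i j) (hRk : ∀ j, R k j = 0)
    (ha : a ≠ some k) (hb : b ≠ some k) (hr : r ≠ some k) (hp : p ≠ some k) (hq : q ≠ some k)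
    (hra : OptDisjoint r a) (hrb : OptDisjoint r b) (hrq : OptDisjoint r q)
    (hpa : OptDisjoint p a) (hpb : OptDisjoint p b) (hpq : OptDisjoint p q) :
    clusterMutate (R + triMat a (some k) r + arrowMat b (some k) + arrowMat r b +
        triMat (some k) p q) k =
      R + triMat a p (some k) + arrowMat b p + arrowMat (some k) b + triMat (some k) q r := by
  refine clusterMutate_of_row (P := fun i => optInd r i + optInd p i)
    (Q := fun i => optInd a i + optInd b i + optInd q i) ?_ ?_ ?_ ?_ ?_ ?_ ?_ ?_
  · intro i j
    simp only [Matrix.add_apply, hR i j, triMat_skew _ _ _ i j, arrowMat_skew _ _ i j]; ring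
  · intro j
    simp only [Matrix.add_apply, hRk, triMat_apply, arrowMat_apply, optInd_self,
      optInd_eq_zero ha, optInd_eq_zero hb, optInd_eq_zero hr, optInd_eq_zero hp,
      optInd_eq_zero hq]
    ring
  · exact fun i => add_nonneg (optInd_nonneg _ _) (optInd_nonneg _ _)
  · exact fun i => add_nonneg (add_nonneg (optInd_nonneg _ _) (optInd_nonneg _ _))
      (optInd_nonneg _ _)
  · intro i
    linear_combination hra.mul_eq_zero i + hrb.mul_eq_zero i + hrq.mul_eq_zero i +
      hpa.mul_eq_zero i + hpb.mul_eq_zero i + hpq.mul_eq_zero i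
  · intro i j
    simp only [Matrix.add_apply, hR i j, triMat_skew _ _ _ i j, arrowMat_skew _ _ i j]; ring
  · intro j
    simp only [Matrix.add_apply, hRk, triMat_apply, arrowMat_apply, optInd_self,
      optInd_eq_zero ha, optInd_eq_zero hb, optInd_eq_zero hr, optInd_eq_zero hp,
      optInd_eq_zero hq]
    ring
  · intro i j hi hj
    simp only [Matrix.add_apply, triMat_apply, arrowMat_apply, optInd_some_of_ne hi,
      optInd_some_of_ne hj]
    ring

/-- Flipping the root of the second of the two trees attached to a pair of twins. -/
theorem clusterMutate_twin_right {R : Matrix (Fin n) (Fin n) ℤ} {a b l p q : Option (Fin n)}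
    {k : Fin n} (hR : ∀ i j, R j i = -R i j) (hRk : ∀ j, R k j = 0)
    (ha : a ≠ some k) (hb : b ≠ some k) (hl : l ≠ some k) (hp : p ≠ some k) (hq : q ≠ some k)
    (hla : OptDisjoint l a) (hlb : OptDisjoint l b) (hlp : OptDisjoint l p)
    (hqa : OptDisjoint q a) (hqb : OptDisjoint q b) (hqp : OptDisjoint q p) :
    clusterMutate (R + triMat a l (some k) + arrowMat b l + arrowMat (some k) b +
        triMat (some k) p q) k =
      R + triMat a (some k) q + arrowMat b (some k) + arrowMat q b + triMat (some k) l p := by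
  refine clusterMutate_of_row (P := fun i => optInd a i + optInd b i + optInd p i)
    (Q := fun i => optInd l i + optInd q i) ?_ ?_ ?_ ?_ ?_ ?_ ?_ ?_
  · intro i j
    simp only [Matrix.add_apply, hR i j, triMat_skew _ _ _ i j, arrowMat_skew _ _ i j]; ring
  · intro j
    simp only [Matrix.add_apply, hRk, triMat_apply, arrowMat_apply, optInd_self,
      optInd_eq_zero ha, optInd_eq_zero hb, optInd_eq_zero hl, optInd_eq_zero hp,
      optInd_eq_zero hq]
    ring
  · exact fun i => add_nonneg (add_nonneg (optInd_nonneg _ _) (optInd_nonneg _ _))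
      (optInd_nonneg _ _)
  · exact fun i => add_nonneg (optInd_nonneg _ _) (optInd_nonneg _ _)
  · intro i
    linear_combination hla.mul_eq_zero i + hlb.mul_eq_zero i + hlp.mul_eq_zero i +
      hqa.mul_eq_zero i + hqb.mul_eq_zero i + hqp.mul_eq_zero i
  · intro i j
    simp only [Matrix.add_apply, hR i j, triMat_skew _ _ _ i j, arrowMat_skew _ _ i j]; ring
  · intro j
    simp only [Matrix.add_apply, hRk, triMat_apply, arrowMat_apply, optInd_self,
      optInd_eq_zero ha, optInd_eq_zero hb, optInd_eq_zero hl, optInd_eq_zero hp,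
      optInd_eq_zero hq]
    ring
  · intro i j hi hj
    simp only [Matrix.add_apply, triMat_apply, arrowMat_apply, optInd_some_of_ne hi,
      optInd_some_of_ne hj]
    ring

theorem exists_mem_spoke {L : List (Fin n × HalfTree n)} {k : Fin n} (hk : k ∈ spokeLabels L) :
    ∃ L₁ x H L₂, L = L₁ ++ (x, H) :: L₂ ∧ (k = x ∨ k ∈ HalfTree.labels H) := by
  induction L with
  | nil => simp [spokeLabels] at hk
  | cons a L ih =>
    obtain ⟨x, H⟩ := a
    simp only [spokeLabels, List.mem_cons, List.mem_append] at hk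
    rcases hk with hk | hk | hk
    · exact ⟨[], x, H, L, rfl, Or.inl hk⟩
    · exact ⟨[], x, H, L, rfl, Or.inr hk⟩
    · obtain ⟨L₁, y, K, L₂, rfl, h⟩ := ih hk
      exact ⟨(x, H) :: L₁, y, K, L₂, rfl, h⟩

theorem exists_rotate {x : Fin n} {H : HalfTree n} {L : List (Fin n × HalfTree n)} {k : Fin n}
    (hL : L ≠ []) (hnd : (spokeLabels ((x, H) :: L)).Nodup)
    (hk : k ∈ spokeLabels ((x, H) :: L)) :
    ∃ y K M, M ≠ [] ∧ (spokeLabels ((y, K) :: M)).Nodup ∧ (k = y ∨ k ∈ HalfTree.labels K) ∧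
      spokeMat ((x, H) :: L) x = spokeMat ((y, K) :: M) y := by
  obtain ⟨L₁, y, K, L₂, h, hk'⟩ := exists_mem_spoke hk
  cases L₁ with
  | nil =>
    simp only [List.nil_append, List.cons.injEq, Prod.mk.injEq] at h
    obtain ⟨⟨rfl, rfl⟩, rfl⟩ := h
    exact ⟨x, H, L, hL, hnd, hk', rfl⟩
  | cons a L₁ =>
    simp only [List.cons_append, List.cons.injEq] at h
    obtain ⟨rfl, rfl⟩ := h
    refine ⟨y, K, L₂ ++ (x, H) :: L₁, by simp, ?_, hk', spokeMat_rotate x y H K L₁ L₂⟩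
    exact (spokeLabels_append_perm ((x, H) :: L₁) ((y, K) :: L₂)).nodup hnd

/-- Mutation inside a tree attached between two spokes. -/
theorem isPuncturedDisc_mutate_tree {x k : Fin n} {H : HalfTree n}
    {L : List (Fin n × HalfTree n)} (hL : L ≠ []) (hnd : (spokeLabels ((x, H) :: L)).Nodup)
    (hk : k ∈ H.labels) : IsPuncturedDisc (clusterMutate (spokeMat ((x, H) :: L) x) k) := by
  have hnd' := hnd
  simp only [spokeLabels, List.nodup_cons, List.mem_append, not_or, List.nodup_append] at hnd'
  obtain ⟨⟨hxH, hxL⟩, hH, hLnd, hHL⟩ := hnd'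
  have hkx : k ≠ x := fun h => hxH (h ▸ hk)
  have hkL : k ∉ spokeLabels L := fun h => hHL k hk k h rfl
  have hy := firstSpoke_mem_of_ne_nil hL x
  have hky : firstSpoke L x ≠ k := fun h => hkL (h ▸ hy)
  have hxy : x ≠ firstSpoke L x := fun h => hxL (h ▸ hy)
  by_cases hroot : H.root = some k
  · cases H with
    | nil => simp [HalfTree.labels] at hk
    | node k' l r =>
      obtain rfl : k' = k := by simpa [HalfTree.root] using hroot
      simp only [HalfTree.labels, List.nodup_cons, List.mem_append, not_or, List.nodup_append,
        List.mem_cons] at hH hxH hHL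
      refine Or.inl ⟨x, l, (k', r) :: L, by simp, ?_, ?_⟩
      · refine List.Perm.nodup ?_ hnd
        rw [List.perm_iff_count]
        intro a
        simp only [spokeLabels, HalfTree.labels, List.count_cons, List.count_append]
        omega
      · have := clusterMutate_flip (R := spokeMat L x + l.mat + r.mat)
          (a := some (firstSpoke L x)) (b := some x) (c := l.root) (d := r.root) (k := k')
          (by intro i j; simp only [Matrix.add_apply, spokeMat_skew _ _ i j,
                HalfTree.mat_skew _ i j]; ring)
          (by intro j; simp only [Matrix.add_apply, spokeMat_eq_zero_of_notMem hkx hkL,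
                HalfTree.mat_eq_zero_of_notMem hH.1.1,
                HalfTree.mat_eq_zero_of_notMem hH.1.2]; rfl)
          (by simpa using hky) (by simpa using hkx.symm) (HalfTree.root_ne_some hH.1.1)
          (HalfTree.root_ne_some hH.1.2) (HalfTree.optDisjoint_some_some hxy.symm)
          (HalfTree.optDisjoint_some_root (by grind))
          (HalfTree.optDisjoint_some_root (by grind)).symm
          (HalfTree.optDisjoint_root_root (by grind))
        simp only [spokeMat_cons, HalfTree.mat_node, HalfTree.root_node, firstSpoke_cons]
        convert this using 1
        · congr 1
          rw [← triMat_rotate (some (firstSpoke L x))]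
          abel
        · abel
  · obtain ⟨H', h1, h2, h3⟩ := H.exists_flip hH k hk hroot
    refine Or.inl ⟨x, H', L, hL, ?_, ?_⟩
    · exact (((h2.append_right _).cons x).nodup_iff).2 hnd
    · have := h3 (triMat (some x) H.root (some (firstSpoke L x)) + spokeMat L x)
        (by intro i j; simp only [Matrix.add_apply, spokeMat_skew _ _ i j,
              triMat_skew _ _ _ i j]; ring)
        (by
          intro j
          have : triMat (some x) H.root (some (firstSpoke L x)) k j = 0 := by
            by_contra hcon
            have := (triMat_ne_zero hcon).1
            simp [hkx.symm, hroot, hky] at this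
          simp [this, spokeMat_eq_zero_of_notMem hkx hkL])
      simp only [spokeMat_cons, h1]
      convert this using 1
      · congr 1
        abel
      · abel

/-- Mutation at a spoke. -/
theorem isPuncturedDisc_mutate_spoke {w x : Fin n} {G H : HalfTree n}
    {L : List (Fin n × HalfTree n)} (hnd : (spokeLabels ((w, G) :: (x, H) :: L)).Nodup) :
    IsPuncturedDisc (clusterMutate (spokeMat ((w, G) :: (x, H) :: L) w) x) := by
  have hnd' := hnd
  simp only [spokeLabels, List.nodup_cons, List.mem_append, not_or, List.nodup_append,
    List.mem_cons] at hnd'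
  obtain ⟨⟨hwG, hwx, hwH, hwL⟩, hG, ⟨⟨hxH, hxL⟩, hH, hL, hHL⟩, hGxHL⟩ := hnd'
  have hxG : x ∉ G.labels := fun h => hGxHL x h x (Or.inl rfl) rfl
  have hGH : ∀ y ∈ G.labels, y ∉ H.labels := by grind
  cases L with
  | nil =>
    refine Or.inr ⟨x, w, G, H, ?_, ?_⟩
    · refine List.Perm.nodup ?_ hnd
      rw [List.perm_iff_count]
      intro a
      simp only [spokeLabels, List.count_cons, List.count_append, List.count_nil]
      omega
    · have := clusterMutate_digon (R := G.mat + H.mat) (g := G.root) (h := H.root)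
        (w := some w) (x := x)
        (by intro i j; simp only [Matrix.add_apply, HalfTree.mat_skew _ i j]; ring)
        (by intro j; simp only [Matrix.add_apply, HalfTree.mat_eq_zero_of_notMem hxG,
              HalfTree.mat_eq_zero_of_notMem hxH]; rfl)
        (HalfTree.root_ne_some hxG) (HalfTree.root_ne_some hxH) (by simpa using hwx)
        (HalfTree.optDisjoint_root_root hGH)
      simp only [spokeMat_cons, spokeMat_nil, firstSpoke_cons, firstSpoke_nil, twinMat]
      convert this using 1
      · congr 1
        abel
      · abel
  | cons a L =>
    have hy := firstSpoke_mem_of_ne_nil (List.cons_ne_nil a L) w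
    set M := a :: L with hM
    have hxy : x ≠ firstSpoke M w := fun h => hxL (h ▸ hy)
    have hwy : w ≠ firstSpoke M w := fun h => hwL (h ▸ hy)
    refine Or.inl ⟨w, HalfTree.node x G H, M, List.cons_ne_nil a L, ?_, ?_⟩
    · refine List.Perm.nodup ?_ hnd
      rw [List.perm_iff_count]
      intro a
      simp only [spokeLabels, HalfTree.labels, List.count_cons, List.count_append]
      omega
    · have := clusterMutate_flip (R := spokeMat M w + G.mat + H.mat)
        (a := some w) (b := G.root) (c := H.root) (d := some (firstSpoke M w)) (k := x)
        (by intro i j; simp only [Matrix.add_apply, spokeMat_skew _ _ i j,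
              HalfTree.mat_skew _ i j]; ring)
        (by intro j; simp only [Matrix.add_apply,
              spokeMat_eq_zero_of_notMem (Ne.symm hwx) hxL,
              HalfTree.mat_eq_zero_of_notMem hxG, HalfTree.mat_eq_zero_of_notMem hxH]; rfl)
        (by simpa using hwx) (HalfTree.root_ne_some hxG) (HalfTree.root_ne_some hxH)
        (by simpa using hxy.symm) (HalfTree.optDisjoint_some_root hwG)
        (HalfTree.optDisjoint_some_some hwy)
        (HalfTree.optDisjoint_root_root (by grind))
        (HalfTree.optDisjoint_some_root (fun h => hHL _ h _ hy rfl)).symm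
      simp only [spokeMat_cons, HalfTree.mat_node, HalfTree.root_node, firstSpoke_cons]
      convert this using 1
      · congr 1
        abel
      · rw [triMat_rotate G.root, triMat_rotate H.root, triMat_rotate (some x) _ (some w),
          triMat_rotate _ (some w) (some x)]
        abel

/-- Mutation at one of two twins. -/
theorem isPuncturedDisc_mutate_twin {a b : Fin n} {l r : HalfTree n}
    (hnd : (a :: (l.labels ++ b :: r.labels)).Nodup) :
    IsPuncturedDisc (clusterMutate (twinMat a b l r) a) := by
  have hnd' := hnd
  simp only [List.nodup_cons, List.mem_append, not_or, List.nodup_append, List.mem_cons] at hnd'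
  obtain ⟨⟨hal, hab, har⟩, hl, ⟨hbr, hr⟩, hlbr⟩ := hnd'
  refine Or.inl ⟨b, l, [(a, r)], by simp, ?_, ?_⟩
  · refine List.Perm.nodup ?_ hnd
    rw [List.perm_iff_count]
    intro a
    simp only [spokeLabels, List.count_cons, List.count_append, List.count_nil]
    omega
  · have := clusterMutate_twin (R := l.mat + r.mat) (l := l.root) (r := r.root)
      (b := some b) (a := a)
      (by intro i j; simp only [Matrix.add_apply, HalfTree.mat_skew _ i j]; ring)
      (by intro j; simp only [Matrix.add_apply, HalfTree.mat_eq_zero_of_notMem hal,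
            HalfTree.mat_eq_zero_of_notMem har]; rfl)
      (HalfTree.root_ne_some hal) (HalfTree.root_ne_some har) (by simpa using Ne.symm hab)
      (HalfTree.optDisjoint_root_root (by grind))
    simp only [spokeMat_cons, spokeMat_nil, firstSpoke_cons, firstSpoke_nil, twinMat]
    convert this using 1
    · congr 1
      abel
    · abel

/-- Mutation in the first of the two trees attached to a pair of twins. -/
theorem isPuncturedDisc_mutate_twin_left {a b k : Fin n} {l r : HalfTree n}
    (hnd : (a :: (l.labels ++ b :: r.labels)).Nodup) (hk : k ∈ l.labels) :
    IsPuncturedDisc (clusterMutate (twinMat a b l r) k) := by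
  have hnd' := hnd
  simp only [List.nodup_cons, List.mem_append, not_or, List.nodup_append, List.mem_cons] at hnd'
  obtain ⟨⟨hal, hab, har⟩, hl, ⟨hbr, hr⟩, hlbr⟩ := hnd'
  have hak : a ≠ k := fun h => hal (h ▸ hk)
  have hbk : b ≠ k := fun h => hlbr k hk b (Or.inl rfl) h.symm
  have hkr : k ∉ r.labels := fun h => hlbr k hk k (Or.inr h) rfl
  have hbl : b ∉ l.labels := fun h => hlbr b h b (Or.inl rfl) rfl
  by_cases hroot : l.root = some k
  · cases l with
    | nil => simp [HalfTree.labels] at hk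
    | node k' p q =>
      obtain rfl : k' = k := by simpa [HalfTree.root] using hroot
      simp only [HalfTree.labels, List.nodup_cons, List.mem_append, not_or, List.nodup_append,
        List.mem_cons] at hl hal hbl hlbr
      refine Or.inr ⟨a, b, p, HalfTree.node k' q r, ?_, ?_⟩
      · refine List.Perm.nodup ?_ hnd
        rw [List.perm_iff_count]
        intro a
        simp only [HalfTree.labels, List.count_cons, List.count_append]
        omega
      · have := clusterMutate_twin_left (R := p.mat + q.mat + r.mat) (a := some a)
          (b := some b) (r := r.root) (p := p.root) (q := q.root) (k := k')
          (by intro i j; simp only [Matrix.add_apply, HalfTree.mat_skew _ i j]; ring)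
          (by intro j; simp only [Matrix.add_apply, HalfTree.mat_eq_zero_of_notMem hkr,
                HalfTree.mat_eq_zero_of_notMem hl.1.1,
                HalfTree.mat_eq_zero_of_notMem hl.1.2]; rfl)
          (by simpa using hak) (by simpa using hbk) (HalfTree.root_ne_some hkr)
          (HalfTree.root_ne_some hl.1.1) (HalfTree.root_ne_some hl.1.2)
          (HalfTree.optDisjoint_some_root har).symm (HalfTree.optDisjoint_some_root hbr).symm
          (HalfTree.optDisjoint_root_root (by grind))
          (HalfTree.optDisjoint_some_root (by grind)).symm
          (HalfTree.optDisjoint_some_root (by grind)).symm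
          (HalfTree.optDisjoint_root_root (by grind))
        simp only [twinMat, HalfTree.mat_node, HalfTree.root_node]
        convert this using 1
        · congr 1
          abel
        · abel
  · obtain ⟨l', h1, h2, h3⟩ := l.exists_flip hl k hk hroot
    refine Or.inr ⟨a, b, l', r, (((h2.append_right _).cons a).nodup_iff).2 hnd, ?_⟩
    have := h3 (twinMat a b l r - l.mat)
      (by intro i j; simp only [Matrix.sub_apply, twinMat_skew _ _ _ _ i j,
            HalfTree.mat_skew _ i j]; ring)
      (by
        intro j
        have e1 : triMat (some a) l.root r.root k j = 0 := by
          by_contra hcon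
          have := (triMat_ne_zero hcon).1
          simp [hak, hroot, HalfTree.root_ne_some hkr] at this
        have e2 : arrowMat (some b) l.root k j = 0 := by
          by_contra hcon
          have := (arrowMat_ne_zero hcon).1
          simp [hbk, hroot] at this
        have e3 : arrowMat r.root (some b) k j = 0 := by
          by_contra hcon
          have := (arrowMat_ne_zero hcon).1
          simp [hbk, HalfTree.root_ne_some hkr] at this
        simp [twinMat, e1, e2, e3, HalfTree.mat_eq_zero_of_notMem hkr])
    rw [sub_add_cancel] at this
    rw [this]
    simp only [twinMat, h1]
    abel

/-- Mutation in the second of the two trees attached to a pair of twins. -/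
theorem isPuncturedDisc_mutate_twin_right {a b k : Fin n} {l r : HalfTree n}
    (hnd : (a :: (l.labels ++ b :: r.labels)).Nodup) (hk : k ∈ r.labels) :
    IsPuncturedDisc (clusterMutate (twinMat a b l r) k) := by
  have hnd' := hnd
  simp only [List.nodup_cons, List.mem_append, not_or, List.nodup_append, List.mem_cons] at hnd'
  obtain ⟨⟨hal, hab, har⟩, hl, ⟨hbr, hr⟩, hlbr⟩ := hnd'
  have hak : a ≠ k := fun h => har (h ▸ hk)
  have hbk : b ≠ k := fun h => hbr (h ▸ hk)
  have hkl : k ∉ l.labels := fun h => hlbr k h k (Or.inr hk) rfl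
  have hbl : b ∉ l.labels := fun h => hlbr b h b (Or.inl rfl) rfl
  by_cases hroot : r.root = some k
  · cases r with
    | nil => simp [HalfTree.labels] at hk
    | node k' p q =>
      obtain rfl : k' = k := by simpa [HalfTree.root] using hroot
      simp only [HalfTree.labels, List.nodup_cons, List.mem_append, not_or, List.nodup_append,
        List.mem_cons] at hr har hbr hlbr
      refine Or.inr ⟨a, b, HalfTree.node k' l p, q, ?_, ?_⟩
      · refine List.Perm.nodup ?_ hnd
        rw [List.perm_iff_count]
        intro a
        simp only [HalfTree.labels, List.count_cons, List.count_append]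
        omega
      · have := clusterMutate_twin_right (R := p.mat + q.mat + l.mat) (a := some a)
          (b := some b) (l := l.root) (p := p.root) (q := q.root) (k := k')
          (by intro i j; simp only [Matrix.add_apply, HalfTree.mat_skew _ i j]; ring)
          (by intro j; simp only [Matrix.add_apply, HalfTree.mat_eq_zero_of_notMem hkl,
                HalfTree.mat_eq_zero_of_notMem hr.1.1,
                HalfTree.mat_eq_zero_of_notMem hr.1.2]; rfl)
          (by simpa using hak) (by simpa using hbk) (HalfTree.root_ne_some hkl)
          (HalfTree.root_ne_some hr.1.1) (HalfTree.root_ne_some hr.1.2)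
          (HalfTree.optDisjoint_some_root hal).symm (HalfTree.optDisjoint_some_root hbl).symm
          (HalfTree.optDisjoint_root_root (by grind))
          (HalfTree.optDisjoint_some_root (by grind)).symm
          (HalfTree.optDisjoint_some_root (by grind)).symm
          (HalfTree.optDisjoint_root_root (by grind))
        simp only [twinMat, HalfTree.mat_node, HalfTree.root_node]
        convert this using 1
        · congr 1
          abel
        · abel
  · obtain ⟨r', h1, h2, h3⟩ := r.exists_flip hr k hk hroot
    refine Or.inr ⟨a, b, l, r',
      ((((h2.cons b).append_left _).cons a).nodup_iff).2 hnd, ?_⟩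
    have := h3 (twinMat a b l r - r.mat)
      (by intro i j; simp only [Matrix.sub_apply, twinMat_skew _ _ _ _ i j,
            HalfTree.mat_skew _ i j]; ring)
      (by
        intro j
        have e1 : triMat (some a) l.root r.root k j = 0 := by
          by_contra hcon
          have := (triMat_ne_zero hcon).1
          simp [hak, hroot, HalfTree.root_ne_some hkl] at this
        have e2 : arrowMat (some b) l.root k j = 0 := by
          by_contra hcon
          have := (arrowMat_ne_zero hcon).1
          simp [hbk, HalfTree.root_ne_some hkl] at this
        have e3 : arrowMat r.root (some b) k j = 0 := by
          by_contra hcon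
          have := (arrowMat_ne_zero hcon).1
          simp [hbk, hroot] at this
        simp [twinMat, e1, e2, e3, HalfTree.mat_eq_zero_of_notMem hkl])
    rw [sub_add_cancel] at this
    rw [this]
    simp only [twinMat, h1]
    abel

theorem IsPuncturedDisc.mutate {B : Matrix (Fin n) (Fin n) ℤ} (hB : IsPuncturedDisc B)
    (k : Fin n) : IsPuncturedDisc (clusterMutate B k) := by
  have hB' := hB
  rcases hB with ⟨x, H, L, hL, hnd, rfl⟩ | ⟨a, b, l, r, hnd, rfl⟩
  · by_cases hk : k ∈ spokeLabels ((x, H) :: L)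
    · obtain ⟨y, K, M, hM, hnd', hk', hmat⟩ := exists_rotate hL hnd hk
      rw [hmat]
      rcases hk' with rfl | hk'
      · rcases List.eq_nil_or_concat M with h | ⟨M', ⟨w, G⟩, rfl⟩
        · exact (hM h).elim
        · rw [List.concat_eq_append] at hnd' ⊢
          have e := spokeMat_rotate k w K G M' []
          simp only [List.cons_append, List.nil_append] at e
          rw [e]
          refine isPuncturedDisc_mutate_spoke ?_
          exact (spokeLabels_append_perm ((k, K) :: M') [(w, G)]).nodup hnd'
      · exact isPuncturedDisc_mutate_tree hM hnd' hk'
    · have hrow : ∀ j, spokeMat ((x, H) :: L) x k j = 0 :=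
        spokeMat_eq_zero_of_notMem (fun h => hk (by simp [spokeLabels, h])) hk
      rw [clusterMutate_eq_self hrow fun i => by rw [spokeMat_skew, hrow, neg_zero]]
      exact hB'
  · by_cases hk : k ∈ a :: (l.labels ++ b :: r.labels)
    · simp only [List.mem_cons, List.mem_append] at hk
      rcases hk with rfl | hk | rfl | hk
      · exact isPuncturedDisc_mutate_twin hnd
      · exact isPuncturedDisc_mutate_twin_left hnd hk
      · rw [twinMat_comm]
        refine isPuncturedDisc_mutate_twin (List.Perm.nodup ?_ hnd)
        rw [List.perm_iff_count]
        intro c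
        simp only [List.count_cons, List.count_append]
        omega
      · exact isPuncturedDisc_mutate_twin_right hnd hk
    · have hrow : ∀ j, twinMat a b l r k j = 0 := by
        intro j
        by_contra hcon
        exact hk (mem_of_twinMat_ne_zero hcon)
      rw [clusterMutate_eq_self hrow fun i => by rw [twinMat_skew, hrow, neg_zero]]
      exact hB'

theorem IsPuncturedDisc.mutationEquiv {B B' : Matrix (Fin n) (Fin n) ℤ}
    (hB : IsPuncturedDisc B) (h : MutationEquiv B B') : IsPuncturedDisc B' := by
  induction h with
  | refl => exact hB
  | tail _ h ih =>
    obtain ⟨k, rfl⟩ := h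
    exact ih.mutate k

theorem noncrossing_spokeMat {p : Fin n → ℕ} {e : Fin n} : ∀ (L : List (Fin n × HalfTree n)),
    ((spokeLabels L).Pairwise fun x y => p x < p y) → (∀ x ∈ spokeLabels L, p e ≤ p x) →
      Noncrossing p (spokeMat L e)
  | [], _, _ => fun _ _ _ _ _ _ _ h => by simp [spokeMat] at h
  | (x, H) :: L, hp, he => by
    simp only [spokeLabels, List.pairwise_cons, List.pairwise_append, List.mem_append,
      List.mem_cons] at hp he
    obtain ⟨hx, hH, hL, hHL⟩ := hp
    have rH := fun x y => @HalfTree.root_le n H p hH x y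
    have mH := fun x => @HalfTree.mem_labels_of_root n H x
    have hf := firstSpoke_mem L e
    have hfL : ∀ y ∈ spokeLabels L, p (firstSpoke L e) ≤ p y := by
      cases L with
      | nil => simp [spokeLabels]
      | cons a L =>
        obtain ⟨z, K⟩ := a
        simp only [spokeLabels, List.pairwise_cons, List.mem_cons, firstSpoke] at hL ⊢
        rintro y (rfl | hy)
        · exact le_rfl
        · exact (hL.1 y hy).le
    refine Noncrossing.add (Noncrossing.add (noncrossing_triMat _ _ _ _)
      (H.noncrossing_mat hH) ?_ ?_) (noncrossing_spokeMat L hL (by grind)) ?_ ?_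
    · intro a b c d hab hbc hcd hac hbd
      obtain ⟨ha, hc⟩ := triMat_ne_zero hac
      obtain ⟨hb, hd⟩ := HalfTree.mem_labels_of_mat_ne_zero hbd
      grind
    · intro a b c d hab hbc hcd hac hbd
      obtain ⟨ha, hc⟩ := HalfTree.mem_labels_of_mat_ne_zero hac
      obtain ⟨hb, hd⟩ := triMat_ne_zero hbd
      grind
    · intro a b c d hab hbc hcd hac hbd
      obtain ⟨hb, hd⟩ := mem_of_spokeMat_ne_zero hbd
      have hac' : triMat (some x) H.root (some (firstSpoke L e)) a c ≠ 0 ∨ H.mat a c ≠ 0 := by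
        by_contra! hcon
        exact hac (by simp [hcon])
      rcases hac' with hac | hac
      · obtain ⟨ha, hc⟩ := triMat_ne_zero hac
        grind
      · obtain ⟨ha, hc⟩ := HalfTree.mem_labels_of_mat_ne_zero hac
        grind
    · intro a b c d hab hbc hcd hac hbd
      obtain ⟨ha, hc⟩ := mem_of_spokeMat_ne_zero hac
      have hbd' : triMat (some x) H.root (some (firstSpoke L e)) b d ≠ 0 ∨ H.mat b d ≠ 0 := by
        by_contra! hcon
        exact hbd (by simp [hcon])
      rcases hbd' with hbd | hbd
      · obtain ⟨hb, hd⟩ := triMat_ne_zero hbd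
        grind
      · obtain ⟨hb, hd⟩ := HalfTree.mem_labels_of_mat_ne_zero hbd
        grind

theorem noncrossing_twinMat {p : Fin n → ℕ} {a b : Fin n} {l r : HalfTree n}
    (hp : (a :: (l.labels ++ b :: r.labels)).Pairwise fun x y => p x < p y) :
    Noncrossing p (twinMat a b l r) := by
  simp only [List.pairwise_cons, List.pairwise_append, List.mem_append, List.mem_cons] at hp
  obtain ⟨ha, hl, ⟨hb, hr⟩, hlr⟩ := hp
  have rl := fun x y => @HalfTree.root_le n l p hl x y
  have rr := fun x y => @HalfTree.root_le n r p hr x y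
  have ml := fun x => @HalfTree.mem_labels_of_root n l x
  have mr := fun x => @HalfTree.mem_labels_of_root n r x
  have key : ∀ x y, p x < p y → twinMat a b l r x y ≠ 0 →
      ((x = a ∨ l.root = some x) ∧ (l.root = some y ∨ r.root = some y)) ∨
      (x = a ∧ l.root = some y) ∨
      (l.root = some x ∧ y = b) ∨ (x = b ∧ r.root = some y) ∨
      (x ∈ l.labels ∧ y ∈ l.labels ∧ l.mat x y ≠ 0) ∨
      (x ∈ r.labels ∧ y ∈ r.labels ∧ r.mat x y ≠ 0) := by
    intro x y hxy h
    rcases twinMat_ne_zero h with h | h | h | h | h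
    · obtain ⟨h1, h2⟩ := triMat_ne_zero h
      grind
    · obtain ⟨h1, h2⟩ := arrowMat_ne_zero h
      grind
    · obtain ⟨h1, h2⟩ := arrowMat_ne_zero h
      grind
    · obtain ⟨h1, h2⟩ := HalfTree.mem_labels_of_mat_ne_zero h
      tauto
    · obtain ⟨h1, h2⟩ := HalfTree.mem_labels_of_mat_ne_zero h
      tauto
  intro x y z w hxy hyz hzw hxz hyw
  have k1 := key x z (hxy.trans hyz) hxz
  have k2 := key y w (hyz.trans hzw) hyw
  have n1 := l.noncrossing_mat hl x y z w hxy hyz hzw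
  have n2 := r.noncrossing_mat hr x y z w hxy hyz hzw
  rcases k1 with k1 | k1 | k1 | k1 | k1 | k1 <;> rcases k2 with k2 | k2 | k2 | k2 | k2 | k2 <;>
    grind

theorem exists_height_of_nodup {l : List (Fin n)} (hl : l.Nodup) :
    ∃ p : Fin n → ℕ, Function.Injective p ∧ l.Pairwise fun x y => p x < p y := by
  refine ⟨fun i => if i ∈ l then l.idxOf i else l.length + i, ?_, ?_⟩
  · intro i j hij
    simp only at hij
    split_ifs at hij with hi hj hj
    · exact (List.idxOf_inj hi).1 hij
    · have := List.idxOf_lt_length_of_mem hi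
      omega
    · have := List.idxOf_lt_length_of_mem hj
      omega
    · exact Fin.ext (by omega)
  · rw [List.pairwise_iff_getElem]
    intro i j hi hj hij
    simp only [List.getElem_mem, if_true, hl.idxOf_getElem]
    exact hij

theorem IsPuncturedDisc.exists_noncrossing {B : Matrix (Fin n) (Fin n) ℤ}
    (hB : IsPuncturedDisc B) : ∃ p : Fin n → ℕ, Function.Injective p ∧ Noncrossing p B := by
  rcases hB with ⟨x, H, L, hL, hnd, rfl⟩ | ⟨a, b, l, r, hnd, rfl⟩
  · obtain ⟨p, hp, hpw⟩ := exists_height_of_nodup hnd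
    refine ⟨p, hp, noncrossing_spokeMat _ hpw ?_⟩
    simp only [spokeLabels, List.pairwise_cons, List.mem_cons] at hpw ⊢
    rintro y (rfl | hy)
    · exact le_rfl
    · exact (hpw.1 y hy).le
  · obtain ⟨p, hp, hpw⟩ := exists_height_of_nodup hnd
    exact ⟨p, hp, noncrossing_twinMat hpw⟩

end TypeD

/-! ### Orientations of Dynkin diagrams of type D -/

section TypeDInitial

variable {n : ℕ}

theorem HalfTree.root_nil : (HalfTree.nil : HalfTree n).root = none := rfl

theorem optInd_none (i : Fin n) : optInd none i = 0 := if_neg (by simp)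

theorem HalfTree.mat_nil : (HalfTree.nil : HalfTree n).mat = 0 := rfl

/-- The arrow of a quiver between two adjacent vertices. -/
def edgeMat (B : Matrix (Fin n) (Fin n) ℤ) (x y : Fin n) : Matrix (Fin n) (Fin n) ℤ :=
  if 0 < B x y then arrowMat (some x) (some y) else arrowMat (some y) (some x)

theorem edgeMat_apply {B : Matrix (Fin n) (Fin n) ℤ} (hB : ∀ i j, B j i = -B i j) {x y : Fin n}
    (hxy : x ≠ y) (h1 : |B x y| ≤ 1) (h0 : B x y ≠ 0) (i j : Fin n) :
    edgeMat B x y i j = if (i = x ∧ j = y) ∨ (i = y ∧ j = x) then B i j else 0 := by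
  have hyx := hB x y
  rw [abs_le] at h1
  have hs : B x y = 1 ∨ B x y = -1 := by omega
  unfold edgeMat
  split_ifs with h2 h3 h3 <;> simp only [arrowMat_apply, optInd, Option.some.injEq]
  · rcases h3 with ⟨rfl, rfl⟩ | ⟨rfl, rfl⟩
    · simp [hxy, hxy.symm]; omega
    · simp [hxy, hxy.symm]; omega
  · push Not at h3
    grind
  · rcases h3 with ⟨rfl, rfl⟩ | ⟨rfl, rfl⟩
    · simp [hxy, hxy.symm]; omega
    · simp [hxy, hxy.symm]; omega
  · push Not at h3
    grind

/-- The tree of an oriented path on the first `m` vertices, rooted at the last one. -/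
def pathTree (B : Matrix (Fin n) (Fin n) ℤ) : ℕ → HalfTree n
  | 0 => HalfTree.nil
  | m + 1 => if h : m < n then
      if 0 < B ⟨m, h⟩ ⟨m - 1, by omega⟩ then HalfTree.node ⟨m, h⟩ (pathTree B m) HalfTree.nil
      else HalfTree.node ⟨m, h⟩ HalfTree.nil (pathTree B m)
    else HalfTree.nil

theorem pathTree_root (B : Matrix (Fin n) (Fin n) ℤ) {m : ℕ} (h : m < n) :
    (pathTree B (m + 1)).root = some ⟨m, h⟩ := by
  rw [pathTree, dif_pos h]
  split_ifs <;> rfl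

theorem pathTree_labels (B : Matrix (Fin n) (Fin n) ℤ) {m : ℕ} (h : m < n) :
    (pathTree B (m + 1)).labels = ⟨m, h⟩ :: (pathTree B m).labels := by
  rw [pathTree, dif_pos h]
  split_ifs <;> simp [HalfTree.labels]

theorem lt_of_mem_pathTree_labels (B : Matrix (Fin n) (Fin n) ℤ) {m : ℕ} (hm : m ≤ n) :
    ∀ x ∈ (pathTree B m).labels, (x : ℕ) < m := by
  induction m with
  | zero => simp [pathTree, HalfTree.labels]
  | succ m ih =>
    rw [pathTree_labels B hm]
    intro x hx
    rcases List.mem_cons.1 hx with rfl | hx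
    · simp
    · have := ih (by omega) x hx
      omega

theorem pathTree_labels_nodup (B : Matrix (Fin n) (Fin n) ℤ) {m : ℕ} (hm : m ≤ n) :
    (pathTree B m).labels.Nodup := by
  induction m with
  | zero => simp [pathTree, HalfTree.labels]
  | succ m ih =>
    rw [pathTree_labels B hm, List.nodup_cons]
    exact ⟨fun h => (lt_of_mem_pathTree_labels B (by omega) _ h).ne rfl, ih (by omega)⟩

theorem pathTree_mat {B : Matrix (Fin n) (Fin n) ℤ} (hB : ∀ i j, B j i = -B i j)
    (h1 : ∀ i j, |B i j| ≤ 1) {N : ℕ} (hN : N ≤ n)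
    (hadj : ∀ i j : Fin n, (i : ℕ) < N → (j : ℕ) < N →
      (B i j ≠ 0 ↔ (i : ℕ) + 1 = j ∨ (j : ℕ) + 1 = i)) {m : ℕ} (hm : m ≤ N) (i j : Fin n) :
    (pathTree B m).mat i j = if (i : ℕ) < m ∧ (j : ℕ) < m then B i j else 0 := by
  induction m with
  | zero => simp [pathTree, HalfTree.mat]
  | succ m ih =>
    have hmn : m < n := by omega
    have hdiag : ∀ i, B i i = 0 := fun i => by have := hB i i; omega
    rcases Nat.eq_zero_or_pos m with rfl | hpos
    · have : (pathTree B 1).mat = 0 := by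
        rw [pathTree, dif_pos hmn]
        split_ifs <;> ext i j <;>
          simp [pathTree, HalfTree.mat, HalfTree.root, triMat_apply, arrowMat_apply, optInd]
      rw [this]
      split_ifs with h
      · have : i = j := Fin.ext (by omega)
        rw [this, hdiag]; rfl
      · rfl
    · obtain ⟨p, rfl⟩ : ∃ p, m = p + 1 := ⟨m - 1, by omega⟩
      have hp : p < n := by omega
      have hstep : (pathTree B (p + 1 + 1)).mat =
          edgeMat B ⟨p + 1, hmn⟩ ⟨p, hp⟩ + (pathTree B (p + 1)).mat := by
        rw [pathTree, dif_pos hmn]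
        simp only [edgeMat, Nat.add_sub_cancel]
        split_ifs <;> ext i j <;>
          simp [HalfTree.mat_node, HalfTree.mat_nil, HalfTree.root_nil, pathTree_root B hp,
            triMat_apply, arrowMat_apply, optInd]
      have hne : B ⟨p + 1, hmn⟩ ⟨p, hp⟩ ≠ 0 := by
        rw [hadj _ _ (by simp; omega) (by simp; omega)]
        right; rfl
      rw [hstep, Matrix.add_apply, ih (by omega),
        edgeMat_apply hB (by simp [Fin.ext_iff]) (h1 _ _) hne]
      have hz := hadj i j
      simp only [Fin.ext_iff]
      by_cases hij : B i j = 0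
      · simp [hij]
      · split_ifs <;> omega

theorem IsOrientationOf.isPuncturedDisc {B : Matrix (Fin n) (Fin n) ℤ} (hn : 4 ≤ n)
    (h : IsOrientationOf B (adjD n)) : IsPuncturedDisc B := by
  obtain ⟨hB, h1, hadj⟩ := h
  obtain ⟨m, rfl⟩ : ∃ m, n = m + 3 := ⟨n - 3, by omega⟩
  set c : Fin (m + 3) := ⟨m, by omega⟩ with hc
  set a : Fin (m + 3) := ⟨m + 1, by omega⟩ with ha
  set b : Fin (m + 3) := ⟨m + 2, by omega⟩ with hb
  have hac : B a c ≠ 0 := by rw [hadj]; simp [adjD, a, c]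
  have hbc : B b c ≠ 0 := by rw [hadj]; simp [adjD, b, c]
  have hca' : a ≠ c := by simp [a, c]
  have hcb' : b ≠ c := by simp [b, c]
  have hdec : B = edgeMat B a c + edgeMat B b c + (pathTree B (m + 1)).mat := by
    ext i j
    rw [Matrix.add_apply, Matrix.add_apply, edgeMat_apply hB hca' (h1 _ _) hac,
      edgeMat_apply hB hcb' (h1 _ _) hbc,
      pathTree_mat hB h1 (N := m + 1) (by omega) ?_ le_rfl]
    · have hz := hadj i j
      by_cases hij : B i j = 0
      · simp [hij]
      · have hz := hz.1 hij
        simp only [adjD, a, b, c, Fin.ext_iff] at hz ⊢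
        split_ifs <;> omega
    · intro i j hi hj
      rw [hadj]
      simp only [adjD]
      omega
  have hroot : (pathTree B (m + 1)).root = some c := pathTree_root B (by omega)
  have hnd := pathTree_labels_nodup B (m := m + 1) (by omega)
  have hlt := lt_of_mem_pathTree_labels B (m := m + 1) (by omega)
  have hal : a ∉ (pathTree B (m + 1)).labels := fun h => by
    have := hlt _ h
    simp [a] at this
  have hbl : b ∉ (pathTree B (m + 1)).labels := fun h => by
    have := hlt _ h
    simp [b] at this
  have hab : a ≠ b := by simp [a, b]
  have hpL : (a :: ((pathTree B (m + 1)).labels ++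
        b :: (HalfTree.nil : HalfTree (m + 3)).labels)).Nodup := by
    simp only [HalfTree.labels, List.nodup_cons, List.nodup_append, List.mem_append]
    grind
  have hpR : (a :: ((HalfTree.nil : HalfTree (m + 3)).labels ++
        b :: (pathTree B (m + 1)).labels)).Nodup := by
    simp only [HalfTree.labels, List.nodup_cons, List.nodup_append, List.mem_append]
    grind
  generalize hP : pathTree B (m + 1) = P at *
  by_cases h2 : 0 < B a c <;> by_cases h3 : 0 < B b c
  · refine Or.inr ⟨a, b, P, HalfTree.nil, hpL, ?_⟩
    rw [hdec]
    ext i j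
    simp [edgeMat, h2, h3, twinMat, hroot, HalfTree.root_nil, HalfTree.mat_nil,
      triMat_apply,
      arrowMat_apply, optInd_none]
  · refine Or.inl ⟨a, P, [(b, HalfTree.nil)], by simp, by simpa [spokeLabels] using hpL, ?_⟩
    rw [hdec]
    ext i j
    simp [edgeMat, h2, h3, spokeMat, firstSpoke, hroot, HalfTree.root_nil, HalfTree.mat_nil,
      triMat_apply,
      arrowMat_apply, optInd_none]
    ring
  · refine Or.inl ⟨b, P, [(a, HalfTree.nil)], by simp, ?_, ?_⟩
    · simp only [spokeLabels, HalfTree.labels, List.nodup_cons, List.nodup_append, List.mem_append]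
      grind
    rw [hdec]
    ext i j
    simp [edgeMat, h2, h3, spokeMat, firstSpoke, hroot, HalfTree.root_nil, HalfTree.mat_nil,
      triMat_apply,
      arrowMat_apply, optInd_none]
    ring
  · refine Or.inr ⟨a, b, HalfTree.nil, P, hpR, ?_⟩
    rw [hdec]
    ext i j
    simp [edgeMat, h2, h3, twinMat, hroot, HalfTree.root_nil, HalfTree.mat_nil,
      triMat_apply,
      arrowMat_apply, optInd_none]

/-- Every quiver mutation equivalent to an orientation of a Dynkin diagram of type D has a
noncrossing order. -/
theorem exists_noncrossing_of_adjD {B₀ B : Matrix (Fin n) (Fin n) ℤ} (hn : 4 ≤ n)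
    (h₀ : IsOrientationOf B₀ (adjD n)) (h : MutationEquiv B₀ B) :
    ∃ p : Fin n → ℕ, Function.Injective p ∧ Noncrossing p B :=
  ((h₀.isPuncturedDisc hn).mutationEquiv h).exists_noncrossing

/-- Every quiver mutation equivalent to an orientation of a Dynkin diagram of type A has a
noncrossing order. -/
theorem exists_noncrossing_of_adjA {B₀ B : Matrix (Fin n) (Fin n) ℤ}
    (h₀ : IsOrientationOf B₀ (adjA n)) (h : MutationEquiv B₀ B) :
    ∃ p : Fin n → ℕ, Function.Injective p ∧ Noncrossing p B := by
  have hf : Function.Injective (Fin.castLE (Nat.le_add_right n 4)) := Fin.castLE_injective _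
  obtain ⟨C, hC, rfl⟩ := h₀.exists_extend (adj' := adjD (n + 4)) hf
    (by intro i j; simp only [adjD]; omega) (by intro i; simp only [adjD]; omega)
    (by intro i j; simp only [adjA, adjD, Fin.val_castLE]; omega)
  obtain ⟨C', hC', rfl⟩ := h.exists_submatrix hf
  obtain ⟨p, hp, hpC⟩ := exists_noncrossing_of_adjD (by omega) hC hC'
  exact ⟨_, hp.comp hf, hpC.submatrix⟩

end TypeDInitial

/-! ### Type E: a finite table of quivers -/

section TypeE

/-- `f x`, with `x` evaluated to a numeral before it is substituted into `f`. -/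
def natForce {α : Type} (x : ℕ) (f : ℕ → α) : α :=
  Nat.rec (f 0) (fun n _ => f (n + 1)) x

theorem natForce_eq {α : Type} (x : ℕ) (f : ℕ → α) : natForce x f = f x := by
  cases x <;> rfl

/-- The Boolean test `f m` for all `m` in `[a, a + n)`. -/
def allFrom (a n : ℕ) (f : ℕ → Bool) : Bool :=
  Nat.rec true (fun m b => natForce (a + m) f && b) n

theorem allFrom_eq_true {a n : ℕ} {f : ℕ → Bool} (h : allFrom a n f = true) {m : ℕ}
    (h1 : a ≤ m) (h2 : m < a + n) : f m = true := by
  induction n with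
  | zero => omega
  | succ n ih =>
    have h' : (natForce (a + n) f && allFrom a n f) = true := h
    rw [natForce_eq, Bool.and_eq_true] at h'
    rcases Nat.lt_or_ge m (a + n) with h3 | h3
    · exact ih h'.2 h3
    · obtain rfl : m = a + n := by omega
      exact h'.1

/-- The number with the given list of digits in base `b`. -/
def packDigits (b : ℕ) (l : List ℕ) : ℕ := l.foldr (fun x acc => x + b * acc) 0

/-- Row `t` of a packed table. -/
def tableRow (T t : ℕ) : ℕ := T / 2 ^ (390 * t) % 2 ^ 390

/-- The entry at `(i, j)`, increased by one, of the exchange matrix encoded by a row. -/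
def rowDigit (r i j : ℕ) : ℕ := r / 3 ^ (8 * i + j) % 3

/-- The certificate for mutation at `k` in a row. -/
def rowCert (r k : ℕ) : ℕ := r / 3 ^ 64 / 2 ^ (36 * k) % 2 ^ 36

/-- The relabelling of a certificate. -/
def certPerm (c i : ℕ) : ℕ := c / 8 ^ i % 8

/-- The row a certificate refers to. -/
def certTarget (c : ℕ) : ℕ := c / 8 ^ 8 / 2

/-- The entry at `(i, j)`, increased by one, of the exchange matrix described by a certificate `c`
whose target row is `r`. -/
def certDigit (r c i j : ℕ) : ℕ :=
  natForce (rowDigit r (certPerm c i) (certPerm c j)) fun d =>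
    cond (Nat.beq (c / 8 ^ 8 % 2) 0) d (2 - d)

/-- The relabelling of a certificate is injective. -/
def certInj (c : ℕ) : Bool :=
  allFrom 0 8 fun i => allFrom 0 i fun j => !Nat.beq (certPerm c i) (certPerm c j)

/-- The entries above the diagonal of the matrix of the certificate `c` with target row `r'` are
those of the mutation at `k` of the matrix of the row `r`. -/
def checkMutation (r r' c k : ℕ) : Bool :=
  allFrom 0 8 fun j => allFrom 0 j fun i =>
    natForce (rowDigit r i j) fun e => natForce (certDigit r' c i j) fun s =>
      cond (Nat.beq i k || Nat.beq j k) (Nat.beq (s + e) 2)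
        (natForce (rowDigit r i k) fun a => natForce (rowDigit r k j) fun b =>
          Nat.beq (s + (2 - a) * (2 - b) / 4) (e + a * b / 4))

/-- The matrix of the row `r` is skew-symmetric. -/
def checkSkew (r : ℕ) : Bool :=
  allFrom 0 8 fun i => allFrom 0 8 fun j => Nat.beq (rowDigit r i j + rowDigit r j i) 2

/-- The natural order is noncrossing for the row `r`. -/
def checkNoncrossing (r : ℕ) : Bool :=
  allFrom 0 8 fun d => allFrom 0 d fun c => allFrom 0 c fun b => allFrom 0 b fun a =>
    Nat.beq (rowDigit r a c) 1 || Nat.beq (rowDigit r b d) 1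

/-- The row `t` of the table `T` with `N` rows is the matrix of a noncrossing quiver, with valid
certificates. -/
def checkRow (T N t : ℕ) : Bool :=
  natForce (tableRow T t) fun r => checkSkew r && (checkNoncrossing r && allFrom 0 8 fun k =>
    natForce (rowCert r k) fun c => natForce (tableRow T (certTarget c)) fun r' =>
      Nat.blt (certTarget c) N && (certInj c && checkMutation r r' c k))

/-- The neighbour of `j` which precedes it in the diagram `E₈`. -/
def parentE8 (j : ℕ) : ℕ := if j = 7 then 2 else j - 1

/-- The entry at `(i, j)`, increased by one, of the orientation of `E₈` with arrows
`parentE8 (m + 1) → m + 1` for those `m` which are binary digits of `o`. -/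
def orientDigit (o i j : ℕ) : ℕ :=
  if 1 ≤ j ∧ i = parentE8 j then 2 * (o.testBit (j - 1)).toNat
  else if 1 ≤ i ∧ j = parentE8 i then 2 - 2 * (o.testBit (i - 1)).toNat
  else 1

/-- The matrix of the certificate `c` with target row `r` is the orientation `o` of `E₈`. -/
def checkOrient (T N o c : ℕ) : Bool :=
  natForce (tableRow T (certTarget c)) fun r =>
    Nat.blt (certTarget c) N && (certInj c &&
      allFrom 0 8 fun i => allFrom 0 8 fun j => Nat.beq (orientDigit o i j) (certDigit r c i j))

/-- The exchange matrix encoded by a row. -/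
def rowMat (r : ℕ) : Matrix (Fin 8) (Fin 8) ℤ := Matrix.of fun i j => (rowDigit r i j : ℤ) - 1

/-- One row for each quiver of mutation type `E₈`, up to isomorphism and reversal of all arrows:
its exchange matrix and a certificate for each mutation. -/
def e8Rows : List ℕ := [
  6721560571131895414416730096710112871091895916709932253939452025698781434499730376503299622010098384158966979735519,
  12558257471710262060598335151788850429018486094552559531056695223041031942679422186085447796465943601878661012362615,
  17561140529348862043039710913284911193995740638892457893454617655646151657568374356648103045764288405219629168880823,
  22564023586987462025481086674780971958471283402016462212491295593931830430157816587835432487403782589019300635903635,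
  27566906644626062007922462436276956558860261726351069404380903358769375856882594359936309525741726636737046228767341,
  30902162016385128662877262827053741565435787615174655960037418320215894817089116228737775667324406898137809506798675,
  33403603544735552135531844908157071014308762913585549336865014505405243855136246575039920160985246064527479621672131,
  348840692220541013503447413496048694892179688773401930328543359813082817067420456066709867779700887494175862202547,
  35905045073975194291889432563594022332682992385659002766266782001396820178162669975227277956480302704835997430878309,
  40907928131662328627766130812990319254559169181858225674109527132656100447416824379135712700566904907045363893879871,
  45076997346361161946467277280903703224923292747220034849816898339619404506763372594457996975151431915177683718455767,
  49246066561059995265168423880832640632780830522308692913483370483181363246245776693300041358853211998075083014766571,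
  52581321932818885663169543231128576163909554459898182668234352203913527172058629122407474744089109351249571269055739,
  55082763460866145683814760736928301154312444508602505971452548412551222115465482923804540211550428822892103199103275,
  1182654535463647386211133309357498661400391769190893601073977129940309575885161072442393236342269438151429559999771,
  58418018833336760624516924892801223554724430525896157382201585299705811009794437517451840775350956400624727171990465,
  62587088048096261885012092743175227031800691744590816863920790197286682393894438518812672254640963756324295583277567,
  65922343419855328539973009941079976033242922484145976161902342474323825493168703129087419042108750415060954791999979,
  70091412634554161858660094072648948310343446026495505445123401305145215418151655665296664112483831945870489538166593,
  72592854162358573855189143527483575171939246518298151396298494907097976741704589148309606346643262215084969085236971,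
  2016468378646085817125328438286136294162858624174126568387011865874649386335744610162356356453158702871254196468443,
  75928109535071860563061563788123538254778189804780849686905375775979249388893734632236657494797063940249870214685057,
  80097178749831361823556907929628030165003855312951844362082906230985486725849769748450390117556987360423712480649235,
  83432434121590428478517825106316173475701184374360744023218330019638992690652632151311918821809136687471495792941525,
  87601503336289261797201377936619559481184752395076684389833563714181220737829543302073649289507026601868945248362791,
  90102944863851002026563523156734228399126605340517248540971772531148163533727282042771577378352900773663888694457599,
  2850282221828524248039523291396032698152876251498194983589623631295184220593452347959604634171297156718214982072559,
  93438200236806960501606378974576328541044968448699168983086447732096618974292386171686314473546282906494284746792853,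
  97607269451566461762082893453248636630508451277747621113776123203298412636782918009865890072341338459727582683667041,
  101776338666265295080785994658686232683349036013800243274642308234228882181869101183012917647005561048887561126235045,
  105111594038024361735744086379927040990025654579402381577913189515824172843266164212621369288271958032359118454871565,
  107613035565343430197921561635152002106701776567064118273754216068057813797916494187756282956248256549514660446529497,
  3684096064998765414102324575048311731866673772999270676959737798808690281556737988258509003418410086611246652003821,
  110114477095614427364749420945936141096209572061231755419481075029630495728966965684758538661352120815676580665416163,
  112615918622957763003662237800866502256157108247535815105852414655176746856639895672154382150817818055162435899095379,
  115951173994631808841628020820401337968831031002268367346613258282388033918692499117268603276374586477042991116066705,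
  4517909906826842179088711373449817455538034435422180386324667295870716461668258994037145950615079484123993129498323,
  119254789080534641989546615177492288061684556149521901801810502435231551892291622196883835078514202838066072543934677,
  7019351436891365217497557005726918087374456002918540200308813137697004334955706829239630660249653468880529424806699,
  30380097771938786170994143528304001914419100664395982558606419191007523637621530489316893533495445714716068385182675,
  35063786643424608913876902357839941541197698294172217510414583947437228602714053171472091669948961467439948470143217,
  124289312425566193471635105137307948529703681131778128438244222817734746482360923370276337849791200806804604469606673,
  6185537594036533672269804753095877245442239244820888769383250848092852880599577115420080864861387786979898097927225,
  126790753954239890402549824592526679890599335928679286129511665335647228396866173513553731240162693314543249196218809,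
  130959823169156952054751096978775294031744410566372711984371279987934901527691022089970209259509118001079352908538211,
  134295078540916018709712014153105619286970381085252494484947741741549627164429020322281082968901128390536180605954135,
  137630333912675157941041013961178333875689702692812823674102459180600132197283113920776843674699889041136317384991763,
  140124614212399722599140964787900696277625605863298564541381359372639003605223166253250460554258494815874334185132355,
  7853165280122337472816475181581637340596606161058976375005313092727472105236019161658145328412435839143389194106995,
  143467030813192784069060515297090140136859998322217638137867775280676922320361567856450701000954802095520403398221593,
  147636100027952285329555682850428422298262811680288867796918940747949990218599313146764745784121546044044578346239067,
  150137541556771761577706568405131399546267003637700113784032410430908203876266437125012166648556240376644664201129627,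
  152631821856496305499667356420589768539988095409671521216905895413943538232722339157912859311587972234044533104530307,
  8686979123231974373578480351981352835892417096514762016393677348502146677025120269845709475509068142221556434023995,
  155974238457289284025164131267779093539837912250909356889642989385793771381180213208064637124217390761094771510697185,
  160143307672048857862023496981977216072359583834704093214246878685785039880594471101358899097587500290199008041566231,
  117297972019280176248522422216571015351406086690019077033175833303911939306541691087689148024649335620289681315541785,
  164307992897414191003687191669004956750254011135468666503498831927931353011097849233262774350119407392155158000097375,
  9520792966317286544246716312628325139681554533972386757247704945094088507579977592998839007915986511697811084566759,
  166813818415518456818509655388230451866090948236340878032973640868775047542968264250984753442347922140261210294999197,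
  170141912558231322493785688017892801646156239666245120609992161583108903833565524829808615059305030631540643394874695,
  172646131326811857641087896860164514787167405105214608274542674231409074985268852981988934843695970707426790081251143,
  174314471499806954120535498859585585283995001548617809904573210886094522025218215647984853812968431402343065982253388,
  175985456191445921624274843151634888317649171391799609366456070800103309384764209297741269741769576549080819851806157,
  12856048338222013812885383827731310671972766877765202469192682962674562732472581771090389089781894577321842954160735,
  180151168400324652824932112274661867475511265878176480169174375420541702462051194855366465250749184921517116515532597,
  56742946560380286126280359022301463840794367686145931981160611422370180188397192738260126243769981289732311688821033,
  182656281431325416499773961296084846758811550700445117888274569336963598726945306818354900177446243755641212398543259,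
  12022234495379316040797173538330257531661774210190557213467715749336363316601129710317608925025553681052141571175537,
  177653398373662549340614835846859292275505331916263379322818445227114341220121378562543142882714557425712461055270653,
  186825350645854379581452978753282345644269098760447603442232900931275280833798045327422239371162984963496458685733473,
  190160606017880548477196601312710771653606291475029920450598994223443208903735632117795536938882143210576181034222243,
  192662047546699861428450316865133470265495503826270752712729881851134672534631038379217341203109308322554250227012115,
  195997302915818117216581196340088405758058101188166486713673610225670343671916736116493166194914201418570017987335509,
  13689862181428679482239818513865550375930503096786934084772183668403043933511162235516006068647989143645634067749299,
  199332558290145180248186580746728576797868666797337753010532612749702693162009458445308375836873001539579466700226649,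
  202667813661977061393331832419481107491505723682881043819393267533832972163600274064900549686722382049175130512436759,
  127624567795764360655747208779060244060788146405484853904124182354271993889061551015883015213022199285208533640938755,
  14523676024465378534130859695689150924447922937748688733134035950881728422913953496400499433417825969806992828560432,
  206836882876639493946956354355800268869276885270649681285661272509789330573909255670846888274335794442219195383121565,
  211005952088576180515244541395014415862237094572685972187929408086525857236927973441786761834860129827950079377863001,
  212673579777254261358211933929484223443558868873004522107304720524991020549157866525036860338197089534406818488383626,
  215175021303591082947688352612436378403680330699532157297031546261348506181092210597582443469989607406635172815408857,
  15357489865457014367533149996638448708920829618429788749789853281380392343351159076296927057904757257457135171237725,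
  217641456321434418789615410376973484015145066734866643857059778926217863931579712069462592584897319122998959327955423,
  17858931396394451744829678569682453583047144904730745655358194520452472899042672148615722537072816032735598982196127,
  16144190478057093338025369760200039616806715965726071542937217781575615848960694639806016256116824906185720681627525,
  74253037262479367106945653474065431182188281240511978124632098594534630708663923599000485629150319838049222283942505,
  224346973576444215740663702673880755553244890810821557664193731549569412903555592346461590379845607968205412102685403,
  17025117553551767302376024395437813625998319697535217854588831780012871135705386432329508450762546001503091566253489,
  219344090520626778647798834729524330990846831520053933149188820383924410947633280465061221364027753394214998242279485,
  228516042792818608888636977635947389498385152334015240574206148447124009942126605542896069194870458362083742877744033,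
  231851298164868893328230504987316668867878568025501218072728708624858939647712843765010236977276308617249099894816351,
  184062626251209492711821416270781528660189985454222139614932422985245639556533552726961439836643477716460063865230993,
  235186553533489694025756088209387352544215587617616529261131136905721283018397905651014441014262142915711555235075073,
  18692745239552575575759291993005918632101106285265102509310608110465077743735633443798529239955081085452690534027744,
  236854181222100809418210592097659031939062012560676424283686461042808581659615299638845599843441429955131878786726933,
  177332558970159309758374480295293651532900889804155310797921635332536527913869498700727952916468909383413078504518293,
  241023250433995260437785852452246814521814833793952669949573633958562752808779895042887971592004002993761808216263175,
  19526559082565054874205430945220300515280294431043935670314534384938383040014948906292969240501991571633745333687141,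
  141486005529595484060996651713302295381704495285991334659971437096425404008659470260066236318383740348011378468293403,
  244358505805754325796746244210354407905498031700546533126240813540907280252962773807769394385410382256057546202088148,
  246026133492471754185872373194606533339067547818714269810403626819136841645556509843490429504602960925626432135234886,
  248527575020757072608753165725435170105734681092812145266336637318236258338537545081275028650657271245041818457879989,
  20360372923277535230875507216440564001389904171327480901078855270189032374824744161722163065278717508392980452022735,
  250999620877002625811019506612393655490279752070872495811844718132960238850495378691502083942725519217661458505343185,
  22861814454433412719837910976515664867643517003574288282114289784865008938175961847241490436441292734564439841505459,
  21137098712473551357375100614515603011453444082024973857913504534356714641736687045930972910412062482070047408328199,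
  91763127964432812363841198368352000257079659073142178950010045512755305050836928206157873936211749865179604037916197,
  256865713450367161237309664965071711390108896345695635323197720975251066967523302698593956786382148664674960720182935,
  22028000611578582840179433134579822842522311443951487372022063702748393838003597137581688232652798073339728368767341,
  251862830395301957374406200192958229800534632500335696014895661240654561364884493910680595774744592425230790466059257,
  259367154980940631433698920259009032743721827281669164906551655136119698415452340451107102748037681793533376603158365,
  262702410350356370132797889198487539624859495898151108141661237427857674386540853865850535422238154326158351707167113,
  264370038036831255059401648562442389493486848712520324020460975268568830733105970038321209615742361251026727008203378,
  266871479565043665679552432765459963260730419522027451610566851083310432534791145696804193776249440279849981903543353,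
  23695628295315757362568449392544419441288945986320143924502072330461184359746015249471586849211064259557041990304957,
  269337914583166074053734671340581223770394411208190210708750556149161739204674330185571279726712118552540591474300735,
  271040548780337254780964431500289855587973007712919656927963998041485479523734001500146888904644858840662538541408581,
  271874362623277021444712969148021917264433407551626964833275146937804064425159253037849211014450495978082041681626295,
  274375804152072054259223679342025519460581291606130494401478106477374081231865031557077368521474109621973053284922037,
  24529442137879299842708833138521865488466288824025829843570030458287171005644337963622810295325989072726076447497423,
  276847850008718589661647888600747515577140518303863586185050892786702864532271542595706383058164646105137248015038091,
  280212501052043531534318594096442528977959021837096420175912151248513055908940134558052031155217758678826203032451133,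
  282710307433868216133172280611506322769409156966116686949481443647346419843806432674115704414039235758402438235570673,
  25363255982066628846363166179797905664581739700301925113384586281929688776794864909591352816062619756507365534629441,
  285180377599095038011359605050186914599831508152103718829850022837452829416518425009140098666695330852313364732006595,
  27864697509978189916195972967000187022807492240683747534308366261233389360570195833556707867901439954857625399637434,
  26048159954287134946095310132201189464378033383367108964120177541765369954821454071814938080011727022484454512975479,
  108404398310401624621287922226713346428998917576527710413965670509383574996433457329425436599617868494783490956842611,
  27001575666503551468777462437442217623836920330862557762749262266043524195096689666680606064017829925310222394601573,
  286883011795233462142148776600886259770331493591554127295680582012800098698394358320054614360252766549310666830337259,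
  294359772024741529781960095123832563460979354016291181998619370239472346162791490733065056640233185121735880859734663,
  36202835941906535943855016386517639446328853874522857173635204837592884862242704440940571408088553795387115740532703,
  28651398122371997884595619031474055796090364682817055259328811524263745121463355243589573606159340292318343021563109,
  120946612467530975868939690934968168486479420817018586811149830939252584782903041496246700914079142515807379450223777,
  31152839651288366582684833725851077031734890587386841203616266588752993345881648927816116641426125926717592049401314,
  29383415325827879955052210738800160245354496157700522245098618309156214567149125112729181880442618964210098657957423,
  54390860031831733134421569317926960568693416694214350048453350721328707100281814871720514975862696211867104327876469,
  117614505014114587770862971998703345289800798746688089917595806762516533579590640011030184379048413039686056969952923,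
  121780426310604225511421948041245597512955205634400194470756134370692630215956244509602098307942947127497641534993123,
  122614240149471413791519442327504964453783342493755316042799694261963285636221178956315294473119462738148688120880865,
  34535208256128743719784358037555056485780902062759760063581696860538486439239159853612757344318062862284795755875705,
  313557662713830175154854209255127064634473277000660117172567866111295723378990093475327344696282377251468303919068293,
  99741501276851388234207897137733694652333084166584147840865290571880659044537387837442958423787190629729842750402507,
  32033766727559590201970283781981110939277596817629814492349817055842110105727047995871276041837165121708336536098793,
  123500168380584818312992887842221495753061384096951907847118101368996426792552000963228403225591914179272993172050951,
  108498962749029087406155430210174195383105362403874016274557664261525991617695795617380348515159630912992984855079809,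
  33701394413487671389712264368221361286788084903586124070886178627524375129231255487439991259159719683580499405815173,
  321903193201495861486794482406759599796320673128315616411260069128177430615927412889561986817895551560443633517629851,
  322737007042014110565383477745768261746719615042841148232179477293469754332778896973551472342854951830925999212414098,
  35369022098287815406976233008979070146522900104965392970574932077506491701984970064475568760809786379073419108274156,
  204335441348681665769165625723701215360998359752948543951932421376045967606047376084714620074966558993877359577222965,
  205168848154654900653518894287795761186076481359816653272368218145347416956182892233946989821740979396627143423222213,
  326071869818406576196216384812662905794605441317628820491245006151234928690915356705705969406794355586524191443710907,
  326902121220067266054065583581016485778028869773764541632931067165549024921821717992488056702721037426118311530745633,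
  328569356311477739350059428638169381609009929851644252909787079002546770061830233881625346722143322365904714855074703,
  329407226948200121883216499142568079639751799947618506260138536373342214755391709457841829298974453879469018159965701,
  332742380561924709506137689460476682549168015467447813120068360467552911578449028216822163071269366251914462278707163,
  333576586999229470749038456623065234447818335114028156529967194073298633046403150883235684333988252854429588092700493,
  334410400842181371001116172684771002795177010837317169301033102126078211143071089808702005068529836618677378938601855,
  335243923848232559957154694050719390207113219538379857399828664898048625074259745854942081692154260887656728939806817,
  336907887335259530900435492319928582320667219215670160352260128679164116897887349821637898294757802673553021747838424,
  337745656215251648936283467532922208836940544173037948982789568230805473177433476739596530261304450272857932685948350,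
  339413283899733625809390020030470277871019017717472921057361201383349278944059431247164386389591379689055106793024431,
  340215166617265716701538264695881781578684272444511926219350891248050540237881562671935004074099229606936215588980757,
  342744191641344570338414512435987455985699947175730672450161045806580590854366165137823474440070929169591120012214175,
  344416166957312304350102224377607440279619400090159558679955234640093368993668501055893743959830341472366855193387879,
  141791958541401310654454624899260481453711797863511133951427358974567369262501556779911768405938027841071797422892511,
  346917419232396760767093872685731766266513695562731791632999620483193223933970826523785880202778142745686017352745123,
  40371789656407546308883597141848092898813159370458305598732239717460126717963216779844155054833101522030936440464549,
  342182620700739034193969157550865941901067217119281107096102642271372132660069576963356785974245781492658896682259486,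
  348585046920364137794484171768784547451858790736799656805123834067914068544280597469217155867282561486724739263854953,
  351920098949539342772162610078979812613484790164853457848258138078391488538770770531857726676378582835764588175717043,
  355255354321298409427122644418564461408721502078595783575389751108195586161851628167811336780564860877249772938513225,
  356089560758336231726137169930538388164115648615975082279224392344500298628699510795392059441611050423523363505871248,
  356923374601385200685079175199092159633780389702454074597961762154329902697257196674251358892973884970281850296717762,
  341713484240563424791441054033237791054324830652850804403222593100248903043215239958206432394991288814777425869211629,
  358591002287167665305716379521252739483959650225681501024045940648012597219722954267008533257483051844467400127853232,
  42873346683233647393078862301219656430633493993896810616519073593363558130564734693547272398426434957369114199960619,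
  360229257957658855124034302894994134520479678305690217105930272800143941566720040262976316702324950524769962812800685,
  361926257658987399902444632696790834232918926657423676115144287149018899264563470927932459823163376995427692000015400,
  43707160526452569533513935434842120223645671704835206876572313986924063543651504051140267625400334235281276154781795,
  154299166185582662784586282547902848901850046027586136419157924879947542217114327362800001854310333469528489512891775,
  328320234084322175397966709980580083879771653309719169088304724004372111845878260247723339973696524980674648422197499,
  44540858871300434096809079558639008685118303834896036407149273723861851847728500985329599926377478975823402917573701,
  361360339088390068225007731359763771308682884185705288888215592139985877249807670074814655303918837802618022524978611,
  366928951464189735994061748572255277107104863685579076008303599857948883700633965409645586697939302718258059790639553,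
  368592813366764393120462084552200542816551083635152137990041931999758335325064613561598186631911902375653248648481327,
  370260441052607525682868945464662891836611765157321492161076024231514421629896470834616502075349377926605634687084207,
  371098209932551109365282644661612003287366151626894011374010297762947211696925059823838517478216901308982135906002115,
  372765837616948151119884312497024489628015096126857776020754322040076459053892456575343255654828628579262146949215035,
  373567720334565177130535335633357857558141627959887302569390560342127988779634647438776314974687076301834406255136673,
  374433465304298042431885040125976386956644646884833047967926289924978380541145216926954002457017569286481946910273313,
  47042415897835412004911305388554943216239012629983569008683218290825012197137745422892837037784038683407252074016555,
  377768720674562483925607938570791066951131884371970477251626440962350215128842871528220748840976993654202066371544499,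
  47876229740945048905672428931209644995144686069715491220194556140440993528594534584393878077353186835970596220924115,
  381103976050480448015852008314473069704666005707474866118824034798115839340058749156509721478116970115156108537678605,
  48701676034692231296173257253733480923142041852319067758927644821485553042529501500614240872230568572900804635360659,
  377288300589380392849826272406043438968550018802442727133127591199186652025219117121074651702416823460836083062480175,
  383580102006716130191992792736208393486380106655032486394735833197070419324699913769581317778659072517028532556982645,
  385268697630932929715122301521170620527248160355178574754466208269632764413367634866187867711042501290229951074189759,
  386936325316836730219319273827420986100786659846698305841422294344443125541171469547635878697490148462330769736462144,
  388608300632634593993988917798156941015714207965489681236767667231216726960197485028892954194919152694702075832707827,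
  178479767630860246154242932416544105115219978546765420062965364657909825553445396828920207220299142324230143598733059,
  392777369847309160135972844279188466295841807249924031637608345237894119203078972842537930005890463893852078355397995,
  51211485112510061091346196390792107638260415692398448067815139527036597926730149532511403918472054000687014941468811,
  396112625223250644902874051646314609853294164941356708958226646495672143698967505229373112754120777196949887424097125,
  363862304194325877915526820846929704494073038616299362086169022918565356058305894914992291260290443171524115753081757,
  399447880595001911396886281141936725863484381384111394587867553564143353591801421876010159097017883040418707677189349,
  392262750370613019418094622158465944051109976303266042108929734152206329501753470274250853477057496106833272757415432,
  401115508278303088193495076104883191012655500419119905620978555748892170775797194782611493113355149270565986961719659,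
  83059491122408305334183870413577820443372115596312789083917507867104533301791807153828985452123863927502618383108583,
  402782845125868233281872797015448863069919230936578857552284029719067710859614764822059020130941939554429233264115091,
  53712811144062625935010417872922692325787587902790015148510748442847458289351388791302633995496518231520556128921033,
  140803956552331178236237982531008221274467920823421673213678608854544673844462230747346756010247452676199699846877033,
  406952205181374876252039928783061034194526575238925302101477546329297326064081600064079100657897715881687210166462437,
  55380443004709505013976870178181690935556092017414095178839845677342230636706690493393167782260995521302780682617479,
  274213622789732029165765076016078506100373562352538728380257358347062373488579478255053183882274478347159476853573495,
  409453557647551230301899718446037594530816070932136685508117395926384233137776312374575880053942017225352500035351847,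
  410287371488257551481173670070340976755903663068267478613093953970100974661609175178541153289721377356694562780494694,
  57048070688854400591699528786876186696761778606013460692717211831744439488529879994346279777237842283065534916383982,
  386374754376388930723535937140506079873283945809021822306584682396928284483771586340337898883879675461896136489490360,
  384707126690509397396055125419442315779652845349004955724633728349340057780317132351834962242437816444396161298914525,
  247693672119881619798483690912819151639659570300734931936769145596412752408544942146767260780672951673719322120762049,
  243316212838131444209758813274749643296574872461299746952287807871165308268162661256218219288337765012842251867647174,
  411121260476045003435483631523338488841671595471263882593194199882710957907251997696607817179630929087078011926089834,
  59537511259542751232366086223408106388279659626107510103118487035781937177371858376755544115172429386623038441555861,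
  414434282626786413270803213017211919485146901344582323339242222061408358234561170279456481514960076892288701701349829,
  238456536962668856271152471893938571126743768127297788856384057260747684030843809889916033365591163051746223599484705,
  60383437385331977378156403285878245826024306606776603629242182504481508645413213147853757373295025121116253734229626,
  386114176537633176204718118665947248418913958418212521391601752276558484346141403290119055546113333551480608373608981,
  62872766631289684298932802551560802335338980643568567963774507648389522934935712433829716197295794441384301935087790,
  368395018764507864191942574643671294101656141631611719262974545636271183887724199834277925621410280006717845469280237,
  133657591334611253574681069833589352483035278616653191689657696047007996554760694329353107046919485698563869412944293,
  197623126591329861869329458008530444409801034680840053073957845120881999349408500998462756104514998505559642271453927,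
  420278409153732474755076663945711294560575089008643858357045261502951888420337249497577152517677821043819884450626659,
  62028817928198201716730126598733094906301780418750415901195941617649069144367639618168578249591862552715306780975657,
  84832010834319838939204630274289833019703918321408081968466974060170753223544507127442576841560527981383670180995807,
  424447478370901359992100218116522428145561921731008513880314997956475309018490577955725043173735948847435143835907369,
  233453644164258323597635584233182294008696927745708480257472428661055214383346439881291937673403641186068652782766968,
  408619818947492642388152716632189335112638538258909415693555382663260016444671997942363838001861060247913938603206648,
  63718692757260914270137154100585039863939399111428918707361506701786311023586786123550404504319172564749977764228502,
  341922040079448129357163543212563060849161517540192711471524417159628655576248286283388398279733110629698866065430945,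
  66220134284326821301338149242426772642577915143024598142746408554807601038329269085381960279109288903005694075957071,
  149505041764334744735172663624294514920588170590660093620136938109224478859848639989998837452836708425428320883665961,
  221805517601686121563068305561737785495432284537171807542015364781293706420397260227754022806354488127165985157746909,
  84141406959307585546078026045574793720885325934627591581971016583036681233696589062097908050999595115443547987304056,
  329563566618641934784433711500409092161829641875990030830833190758697140579048804042243918108732569584109579022414709,
  76213788118301683742053777684513549961319520867033854069002572114326914415749864823734161544753075796561761206163527,
  75379974275398317843420908186221671137799607426433723762807585628694852440277074880145637760274002335637904585416483,
  336710081600726889148853185844149000326139628869071901725188465879965040332318312642439693189798768046474254276316937,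
  146998612821538317899298043141215272194472531737185045341668964674974550576689540520883392417744142801026629008863537,
  220136100350570092318369765581866012716744347945771751687521301730978080266120954504440115075527981418774555103910515,
  67887761971970491857623027807431825205429112774659150426429471020719858649951417538335721180954749954227926417675116,
  229558295559605984553243826070461461623488460066086498743667159052384333578403594556949951331308826429587441374618643,
  151167682036225017629628396490888095179705384911517347051654894369733155228521596292074739940122780932357565446078650,
  152000783393800092288986488638059013774152776240403141948013462692914197866612603293020949009868741786113774373661088,
  363601330107990107550311798398054782393881897849126927249022969607782302738499639382232482297566207925014691351790323,
  221369067003134196356111274388557859285500042758755292766244647133146705286876848946780248360123670048868265746425729,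
  222202880846010863001406991938477272082513460086732281519559335769321139135173450991769854762153481732102884116959154,
  415472773613998104567006620268606477656341641771007981408507091631785210919636542000753290985874685494164059905403789,
  150658670292593260230195894566362613038636025704352668254724560469240700312224501488270891163485136719034026208848679,
  439448697914372733765080298420442795460307983802170087682460078328145584875696729633594900811834700681223584666007891,
  71200770205748310176655799700810371663886541200998594702225106437931168031173030970097098565078723112878694625646957,
  216366183945726134552484459620660074048499115519600603262300340362297945813212101106132344720383351889940595824933265,
  217199997788665901216145826563233465526911870495003997577453467598796751206857507528334092329562147790326297220922139,
  363555730913491403381579913240696753628604981205551720312176600357781657684536239417382311724876401984257682357917497,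
  72868891901152993854197379260397487609255186217524310793635546144831131962634065456099210476775911228153122420290187,
  449469319113419566163505804765368996204890193874341221374127250531627943313347420741659871296829935186093904817058023,
  450303132953585941179710826469900105188376179742603242109000169683711120385350289294716164303406084632246302327322406,
  74536519587068927946753932678309439038910163677451995354272135116198205920541131946499401448861612202258629483613396,
  231642819037338718568153196700023478238483623813393388570853794990391139689164801248630367205850497980108868911893633,
  78995315325318453975413316087385300550357219575944288004390313629354409081128034911707772168376513929140805629302941,
  274578061520778453380911608483826204974035368846604881700973543395844939296008045746130700714218524063062575704256129,
  209163332182439852013737933453057595562360450348950956595442438812449817101897317331881852857366351379488728938849402,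
  425707305612997147395234844564703987501048130327488055763713521471695836741604575991734935963755171304038777217318107,
  77059001757440911932997764467834121612529295989877077288258956414525714379988606531746383514296143845274030618706475,
  456979392823012946819539074657650834937378080704181210057293781177449872895143851397961041799547954176613741511305593,
  200934914032794724223650146950443269798557702465449551819269004196867963591275183904412236356179915236851856654396306,
  77893528086776648800326244149139229727645317746455230532842443719968068351948739185825739591741882422177368931985929,
  136992134221855839958990253321742125782353613730774440500889861981357839613172354329139783356819273195649920888257643,
  236016005308000797410352317443138842579669330498183459952874976293998751261206800484170536854184974063784098190912509,
  297681653298617964398498620803050178018070617924544579776246689029872608063683550268833643991280064716420103142016629,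
  460313718795392454581027486240242957122645450691415184957879957503692429214545382217125618328427428589937716846165213,
  191762952019685358231434761326011691171875750605169109853092269398931188312019203455883522700253341623816234664540137,
  412366284126337022014511528719559477988847140784627420750361472283149626273691190330137557302395532485572793356342377,
  81228783458632784162148448889823823359102270746684919476048009717842007431270214021033815340447242721689411049455909,
  162012249408140816174904363684674807936041022864882209733639478013960339715453797653514066978884687684055730910074800,
  241856657242233907561972474804655522003311648089045332360241743457427729013317494664204213489803997081713286086491659,
  205481004790369959315385132328811095750063874628865703579115712822735752690955540451584003209474142569087555683331549,
  92901464773058846971478514036245917285466888232842060624515886737403656691981092682890636446905711883822779939605501,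
  159505107980999001701161000420130026589450233680896224169094276214365231796235723600055520566309231047785274023508800,
  252692282166650527624849534793164677180887632648581731808338785930103670616091953990988531892926123804385551870899081,
  240442049736868000251033354415840494774386220121737438888953323734978508269062186692339617884593320679823283053849161,
  241275863581100191432599896160070086000140839701539749306816798496082791422985635477878325268069611980105386786004823,
  162840363352745934767763395884494277017645013481725415515107180118931034005463185452552507816210471898871068987756494,
  163674177195685701431536832225534431327681807441012985476976275674502991297187770888608140849120933028832902486579429,
  379458682652409741304711070159960372395963496190059612600736094917563136837299930142454823158571330529665337535049863,
  253842207680475936127766789931442811223915571958563045853941447962557684080973145375673394843261717980358359891538455,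
  254676021523415702791513022565832503964833746603082164278990702243392822026911900628251711256697364799695831019163538,
  427441133054762361773695905319522937640866631901871951679777431872246017941261281251239724615029254729428807508167091,
  379268902835474339989388590938929904449647581990581587547971719275800478834484196221776975039726891195370888921202951,
  301850722513389599247411369193652271731857389262906298395169264405269377353211286066836532512376812754462970849048929,
  303916637450292884345391067813020946452664020159518908771105437743383253013531554905759225526011584580268790225813871,
  304750451293232651009110617156044143120087150123095969622417156009912732800643874840232324759607622218895824498558852,
  305584265138038188788623046564843619425190876481995900264353573569911167068488860815035315158540626852868531382006688,
  311420962034323173721248390905982725957657099431710189188324074451810933382438654994439149949246521764915982728138409,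
  437578164708576032308562724842998429647579279103302961246652809526546381650163392997097774850069498208278732472023195,
  318925286620696138576415369351809411292396609483656727752333772991939398797917856477101911363501891420154534625562389,
  189985613795067890514887684640662426050388343368745957757878693970975697658468557937287358846842843585681108252975173,
  473653819232292647689785913357594170098573092191616726677955057875685533659864723240032035031906356144660560391976501,
  127076432536863914180252131121300886653465355190036104903098714282238027247070378492624505358835041446406789485872293,
  231329233918796568347927959798022954672857407601820930837676793267786176560047352393859426833349040583324592690643993,
  130322335963386064807508350569843516540393828140653924600053459660412444490412058698263876752405049478510191000507329,
  296013160057652049537817695032756749034159643538253611280444756008001605254444146495761024449964713857374093749943555,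
  234664489293007569477618994440886401220491989602780645019675028930204188382005003060079172189711762352564958378938548,
  235498303135971048098096451181443280961586266585787816333440006921093417742710203556589730721473403446181931609902845,
  138660474392710929914758453844177086228716139419517845958618061293162496301552556698615164462143472404345132510420186,
  139493575750639402740751910933690955178196972775934059308821315968311407175298286911975215281363513806513887815467133,
  345257425563982588307759749155895107926053019273708078863311483519193536845322696744941034310059930863205706787970835,
  297246126710264687928990167147437422335296579423753815714730970945471484752066733961798833129182819446428622374847393,
  298079940552104569255988533523026920116650935938475450524449000926854077886833281502699371124933286524485503656156624,
  108744640279377112115158953567827093694773317541024167374735539162356385139144819927572596286824754946686623261116013,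
  243836441565405670720552889251482827593609771740975583651625572447315913150527889078457864008637612636073698390290119,
  244670255408454084459536983881224886755071848237183272703783424660714740786991228723192438851348268479493396922766985,
  246337883093216203252935210524660743521244215462217766509861959400089359685881547527531195135959400634444437804849221,
  247171696937140470198796763005880368716704550799968061431911780223441787473564837856750960111127018733728560888589518,
  248005510780080236862553845323678844558935249765370026000849420748103707601182156471031471249516944211442311364445478,
  248839324625999660229967610558565624424084128055491370904518539609928715263753501054541795994220960641442940007345817,
  249673138466031908164623546243751608290432976097020582670626967064277632500267804667273949627970906417123136377246999,
  250506952308971674828348337615098067758390561356186970999812727787190089691914110399213010492026497099704099378000530,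
  294866858878635314494710277402979767490929797493011735620067083919581421030068548706977908876085626815367903365692993,
  167843958895360091378490007217890148180862142342745687182128583154200658264315371273006784602093244522617103702430469,
  168677772738275590865505559658900694119824827684273001771962864676623072464538865859331357247112347514169785153956687,
  169510874096131262161356613749032262377179230143405105152584263873911654087290868007189889221821407468844913264478217,
  389449559239280610774926397518375411970894930678839243924581186943925151998915417898171567006478197348571551663367839,
  171178501782022929077195770613112988306910883312783030284175513145318986877263641918623663228998407028054879313052803,
  172012315624962695740958966221974051980871334463461102672328654632377664513220648568567552089404403430266999289571006,
  394452442128549205267107229634807221743969930626619727094127583340138501048333585102462135265035385613485982557447871,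
  398133938198701160430519617693722605879516547689002179828009023056882219899418237796657974278298200463046616831865773,
  497837914060047662608146383884722810012320231730378698011394827752044316014385571660715251675386284152878271221822937,
  479676439520323736909928180376612898202527739769408927448501535655025786688652635145686432087566570319316216911639067,
  300581382082096556114108314334169451501720988315186551563820606890059224974634424460281410201542407219992649237017537,
  301415195924999922012743824319429727157365328484550178265907937699899781068572988248129487518478809765465638750147729,
  302249009766646437817176472270712603616442395192978552477199430952944636234733905185567514723281659643190921441828596,
  275521367597007601647508586237223799807073785939051487797411009609049467314121571199673941599478807965145090123481855,
  276355181439947368311242656773707313389977085788940148262514700320241948803760452159302993268122130016379184966212207,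
  488139535468693416711894388490600421935477296126095534211230296375299743932340396889063594403417999689842088524583372,
  308085706668505921734335761435700618730467006797200763097332392322575617530760474797441683114998953905909727610665273,
  308919520511603059410735745663367813338637723127340868940355543302828101513566255453602407932846182541217465167323367,
  108647741990981772644028686535733265745310048241009142425871593923813506051963750703972294475547016553993747171284360,
  108699041084885427543734991629017085370947525483219822438166888721576162098621861101139442759138722598422025267784992,
  249621408681971950985579846216941165933311612909456288078520682482354710521357357059365277423598228640764094784621717,
  313042990526677409733748758741529811664662140076637123279776870993028547797986922924715793780923945662284193530726929,
  111223834664260006908970065070563824536191887786358971307298421368259469123964893188614366487560677541436857321686421,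
  268062642208258606648270037462303245618756046632803253238731711317753397558374187716301672179863114725559498686436785,
  268896456051210506900368965525501928675411962247238793166991862498465197245586123619552225397331559734685240970836889,
  345211826369665887964410281293961781521530360121435534127004949431950916862300939249909739828988024806723230556091225,
  112891956357279222325792444278868150780852513211168351015635128569675875311839690366612499680162984081005905050583595,
  286406546752763603013533306216396603643267388351780676625914369564546427658694840462568229416121094563295703724589017,
  287240360595715503265605198411861884007585594466814262988460281062539526767437972784474009633286364218385981611176872,
  288074174438667403517702712802305735190898346477556723256599245104778616628051157255218343273427115974486504371223741,
  389403960044854708136350234266745215113453464183613977955634421527225606317138301418193678304457138826641404196403941,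
  253887806875205842030972874296937735939225121867526982484753854296889591496286902268573348648593816262299593055324967,
  254721620718145608694686099366002237025988321012088437961589510854922312997794216495825808049315150235604226143167127,
  255555434564186373868801777966432816295573460585504271317042813253795179456228678057511646743996030389325384592621356,
  398088339004287391380301797328097909495752478243423108368538891525591399039581182302848258744212517435067501053658770,
  397020072448190308154448603595004834675715978648333991963390422643196440161028442025025947752655030649705978895991187,
  291409429810426470172693137933418966235976832249249829750048222800690231677251453612150705638175224007156861318155081,
  292243243653438542456568106882165110086724387012674487805456653365193103448322871706866169282557793024889279949730551,
  117064164973339127577203923813887524860148203240451538593896201549125835381494526362675746171346017638542869397364147,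
  181071015799641009421297129747678446397699055097639830106787280900330151465228144928838528574785954702832580457972953,
  256389248401500312704723478856176456041435610078555034798430494075849905921741021028481536902308623786313627846777203,
  309500212062212506611176212364258697563719276238924253838669576049442670857108278741019929709795279727247747702129503,
  158912970381372964965824796254784500922704403181964738246418211756277247568850200449464021292473391858621630328887313,
  244618538149390870843406789204283611560823956054884333226816429628658783748778291623866925510602663506701468313264965,
  120418034078471716719111350837711873332693417892842053095552133524313209208250899787643456870790069178089379623723856,
  136431009484462189054863402152057471425374327578804812226299607225180838043560905416697636113044060733356684318024934,
  121230094786628354609763828579915445142875121712229373343390349146558005805227153234180025016996609268543805346454644,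
  122067048032067214043521303644179529027158777172017583548554904162959638320912971562704701786095407400344617117600286,
  184406271171013545340135839707976149589749673632856925514255164444365902160028592520126174235871614112948572994260681,
  258056876087428380385642615023886550712596171134742697881459537980632938540480244911478900621836212256405464789152700,
  317004536648634005819762887443553037573709034162572786881670215751346688649206645301297051366012014718766420983537064,
  458082350874449152076093770220790656590605921172937068621164412765527948984500754341349698677603005759404669659924975,
  123734675714718440999236632023330107906747354264452063302250107590139667263921106457678611113374653227025450273052501,
  333836633777753188825427671876820916079919214686579331083431125076122055844826198566691094667660217784847246168659099,
  464752824918516598862975248614804058539562374640003336040978755482232986934606914613600255574025618868674090485752423,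
  250455260614553270242575068573376646955329205012647390318974196630167750265192646752382222849913008052802454607077755,
  225061466800801046583232513176818118253958347757248790011589573984913028828527039743487205125149660357104753977062722,
  128756172507236119085730081573885263718064593212203763836079153597161597423112722646966268814981661233903527079133695,
  468659090294059528799093272549236966547321792010145221567918156854977556133176446255523489492217648202721721566420795,
  328593247428832603819906966578005208043637205383104631454759449352747084450820416370920492097232315911000688164990141,
  181616636979731807462898650266533786289514665067501921310732546581082824513886121801508481799456376387095329974090866,
  516114868420451535443859640627213711603539751564564752909685697861181330033317665363410788884803442050250427377580611,
  451978152699461811331999343311177903841832633798742725743493757314211118024080912311849265123398291638297798173742497,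
  200047030639499333215098261301503884580189414863766977904879207603581726039288964315155846374170456959113919914209517,
  424402726619166708004646708287194515487023599063926239930959210991515253440484188081679591075101288154724818791403938,
  132091427878872984653425434646566808121550275896025025403761174680545748925743610787944133781821026028648940699510281,
  547864884616517060773576825953957736711388684883475803025043806272070951524418762439162299515052408747451960480406619,
  334722150445366363566670253550628484308477632105869729005447183158620623834675615836595355048218507741565745634321993,
  344773515754972397463286251472784900266307425451039140772099573618656469022642090598489405099434101481775527178938865,
  548697774626323687635478374596883930056433931160772399501563696528805744798170955607471771233924714747996201920116645,
  142931007836919419008175680974648451238871192110450262910661949978513390590068239009120834265389130695416796136559281,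
  342768082758194929980574688086519646997342044424220055348046457683594581225261639865805465536784801760366667835353565,
  333888336602462997668033665108358925631583832595448421826595840356804354411073242283329100832382744375271810808351049,
  164610167754804022405772874947829309063909863060921807506212580457258931038886854619519165588364088481063126736817287,
  338057405817174628130696437826703376729740045790032438837368037594469582078565803003290415261294906454262317442592225,
  544077740687618001617149493941114347881106446035333575333032616828331793847390788066212946837071920380016272039328673,
  179119494029460928135128287969481729813405504933507135777263931168662345445423769602216694838631132193028247034759249,
  402604463368658443979581287233302122345056133770747258302870052443385038562101444932668250913318271977148103194806282,
  554537255376994151677053946018892801876204139667939699677902354485658113055601534085917208260849485008309023057849763,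
  172948306184189555454815939905893038014785988841264009483778577676289182722376324726189067553786359642433703915821711,
  334767749639926399232844483553646362733840688193898315775860178873092959543966837493672675833386341708971011875272201,
  557872510752115481682237382768656618415541691381494170707250406012182527769642934543830185857973590063864749381959871,
  140429566311694924755141183297657402085957500496436687800295483361531585837066582941702582983398501366371152639772551,
  472722113319183773785560130171821860384977730731920475277638622559257489058724222274252156879490986927399585175140821,
  142097193997574458082622524719568808916383171028729515187177966931718763997816139373874619488523149592713612225552848,
  487838880221653140139407606954180229100236656666768439339747542627546025073534927549186700651230426559489522044647279,
  220058486333659482201321320505123300624501937309285541124177829044189240930028742390631639881457827060401496442478162,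
  454419835710722939262280457680148314088240020378516442299481947614716114429307033151813686699459787927654374390593701,
  144598635522750214653393724400928803745325167375214460349847722919624602314176111913054673919493715568889233284652186,
  550268959566833619340331808890002113000749811553939804479278771166427489056036610814173939413210743266721176067935219,
  229230536016118692908223563861489498148474388362370758990239850901986799853011320652795976402168387304169813157888044,
  455253649553638438749303290419900563045594210696023172783542875637293566007024017880030065428875272551391425616423889,
  145432449365837314946797437251330925145577078352253979808693374084754378164329996311999509180986607899303831977736357,
  290051915422454042280569968740316116423516464868587933015519495953163317628796882688597655672579611535343638682322105,
  357235124204897800136310857661590076488545232872920646894060806086979747345011248645924693261897816737230848248063853,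
  388965649430464557344190306596421978107335351615117148093174456490464709294148220480360362124212728049083623970286357,
  155438215480554639277825907676952744058844196473747598402730610070513502393421819914944181139176292881018337840399691,
  362238007262512132942030057137749623925037655644574144194434774154524363048058284582216470717729751414821981339571485,
  363071821105451899605762705508855699431097083484845946072897368158957488376207047228686278405863733314142007442100203,
  450790058640829797424570232905939703687596759489625992537131005459573559429381268752241410389949209521474611499248379,
  175449747708774488232392002010705386237021314419691860825467409819152846938090851581127007826738129844618026825710451,
  393134718645139123486162138198999853934413761174399050407516221876272637443806309320576978645392124192879385002465477,
  393968532488078890149883123935812348131533569668364921483979849329246398997027011141450227689632122371675660977020739,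
  563706423799477785412267386276008607123113691328678685373354828434124546079307250106980524608543421464628951536851871,
  399455325355091025071950175063412277725391401413466339108516012726466279683034241167086212282017113402689801331376561,
  406959649941463989927131531103675502188257548139809824336486614373425396504478317616459276931853048390539297786970653,
  190875001831131656621174243537195565553173554512792103494453560196029704048610397090161318249008034952647977321859613,
  564539349990400351337869292356260986906754841329708418916116175692593484690937699054379336677110618189795735534096975,
  186289327669266404968911041958973538190496197736738286646435233230602773028683932213865359462008546663669757658555371,
  385292588747334337516018194697394366445456992568577102576794076536449296749795630227144032947527799788724009681525109,
  185455513826350905481901561617551983861915242788636952245154373139407867995337545392219476404201721866452060342932281,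
  386960216433841145784280298019001872782179139048247460342813672475428927256203130916967739949427606998938664545931835,
  356401310361994434237669514542138555618485058620740162614644558868961094050643617750635813514593072076315137913293421,
  470038240046479460039573299014393415665712895133215006033389493198054350684442231251741060947531961608796574822305621,
  371409959534923031328957727383899904958359567452284264798240939647876459705273496817607308043505377821547272138551045,
  541077117837184041834112980524737524695446604795772175887884776038697268016860686978243296238085828502399383204983525,
  358902751890850134993951377327566510611007957927692825667151557642928296787565957880696971438070035022639516229187613,
  359736565733789901657667063814324820870159444147181813337781263935360325737272802871051711606266868000168552151974248,
  550668103882734503070228033846708561505997045385470793074119977830279379660185795394653311389982373483646751807963777,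
  166336422926149570225370237477827886877225589367883617025604158570460451291257878700405194219424722862022330841861007,
  374745214906694231572267920347446670171680083221716891565372271115176885388151759692068393467925614247695780952284341,
  375579028749633998235984776417851645623006374342471766736083287202287217548447197557963221719295377731422510445139843,
  509451749736187326420440005310408300816329187863579389169826153610874484113658222618743724106485093525671242324532789,
  552035813854054306371095613981719498800983309002358076866602249990797706576797677281761893977718650486009152001040937,
  551202000009571643048853485837585582018641321023091661085559068954825385339729222322470252614904168400627154755528113,
  165295071729553255923966213944894155375979996161880959405456237281061889475404540747079741410430386600432478497043532,
  165443981599298909515425232045065567238540335392646848875076014760394454908329393341550664185697878684614410330817291,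
  519057626896351326656117952817789500765692565201179261432752035246285757071340231535548391400470657326395179974292143,
  410168144106266782373708171940170775329459830550309498814802416981759241774373139293247409504869318721879556568387067,
  555098385167416828361684941625446640886859074038629876631150787438800454561891502713280270112615131419688745491087723,
  411001957949182281860775953601637775091741957216587475053657922757753071545448544101763111012554546997920983753120368,
  305035151790271282171119126812194169401260146247714209830500676027307211717197632535935646941452680766267851040940285,
  527571395208607478124486275067480190080550591672727155722115749567571002489265691428348112345957656319058020431957576,
  357280723399457835802478062309477960904134293757249330423076922220610138521899849369141758557435155842345957204129581,
  577050229139378132550361716168571277568384087762371204943123964104116618307870005118327235591186201495539174703821739,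
  170446864657356654412846498981725363584181880410098415676815517431826818028537384500662641408996415217712196891540083,
  554060790332255455726408185254541477152765393924901820411630352290626646757200018291782511048298822095066061543871385,
  175501861052336846288979034811617039307951311960849901539819828600851195025822285140673050869770159827504928139088823,
  362283606457096435784908024772640467437498008956525615264732720876947004036319365446090332370803710576196366874649821,
  363117420300036202448628833942503833379971322949051514152674753204251339483950666046700964119820879365271582479720363,
  556204883068729332939838535299233114124778045503315363929261461392391422124424884549035570717663987097971498137566515,
  557038696911814242237123972361495719674726180438887420353378031783639631746268263704625039896053638002335501445755713,
  555371069225070420978875628099895637262087674850712837132753646698478225286464475931284180206853408009838349821178809,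
  558170301618698234304314879466070052655776680004690881048395818038082849121744830092355237062650433818345560842511731,
  283900729407035874275579665605290456958789484317349929949552401296801662217100362132688881073682031571781635968395948,
  558944558923712014662050219527451822149905730415015792893863420206245893541663825260623017310893804210236469623974089,
  559837929304565634043436945924340741045658584867870997863451549490174196406515037599816537671694818734746114477909649,
  390121740352124815747973920594651778459005484682070898110863560733718633290226335601884744982703325922548998156025667,
  578258433402357524668818795711854939833151377401729654574154171594661163115950675184371369036436554111834808215226719,
  177117286336866600867346824077568698239760226789470601071634540259152738209705338146722596963837536995616898476140461,
  592058878311328435172766088560847080287419992468529086531529819173704901909391504216375549460016698685006917626706719,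
  178785003086863523345479460214518130564804376537833165803031755671769772653387686984752722400995327121387696782333116,
  549415256266522701122747295451390738733392250448603333103908156143217892720337412015982016708912392383422175851380900,
  421558836959431399698235125109990919197580045583966162218065841333082865004608784987717820695938774515272371815791638,
  560612186610041358739633896441703836515312107820462016562791845945243750142710583646153448072684887942276540970980297,
  561505556990651438373013203715832203539760464264141857143761903833080800270068342462406462306559212123422207495225233,
  181286444614819852842642287242265634620885171717364632467110938063113142199085382704748563658165310801179002439786113,
  230018754842658634925066202700120977890961291350056663906884873788625542694154165219999838573789681399408149628964913,
  339667630779172486947972520650642443562720892895803427596613323616840677442523601670988552605972706393923549340402007,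
  460214207278391542951593114361083792073876316632113081870190719732676758757821236579912951330605780788996094141796131,
  259202239345319929977166815054521495319970385055035809340588502794668084429849112058433676810810169987065563656606115,
  187956955356385094546522831743438054741898792430924070893550611218597003280516042229787476421697493330172044337848153,
  535240220548790333589689895082128339610701923839777899115223828629158924911085906943117293296194921624029596922874729,
  189624583042393587418578949540072207011991033550953167362723410493225169234597614098721571449748153021918757037712661,
  439782694652209485094228525536635742698012546531397629551922515403498967354161379865761625490930613483788712266097205,
  521802259722851951680578337880141782530365390802901912424912128754039317002318117866465825024572220949219943901014045,
  193793652256290832075195775240656490727786733716670563752294080866096859002984531529971698743855936925812217464397173,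
  196295093787482149134621949140638701227518756536233250141071233695373716906556152981234701000737107125356713817879206,
  368178819717876415836449920865790053702592128418856239537414284180232497068971617428177786890892134825405096485527999,
  528472770466210615180462319627719652195160025285441487645924393128960639601430109285224575198429996858512018889338261,
  414311356777049087358874159411946387904545616691767964544045502889239995799333059657544272511895712848698629182787617,
  223810950603772942540056708089577438647587862338930611401398084468720088685856708355485728397764971917315511819987713,
  222799049522754900709109321828093845784618882530771962128941645100115562033084414200070276537620619077250431296191042,
  515437402448587044089217453850692508698555697930355501360759871228345885980768879171764192495154336170462320219913936,
  197865823180388603959971072548520267869299766798861642839695414508293593501655422800815041134731741275392025500817680,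
  331849390056698089015471887668074691001781068667908827765259559067157599307071327162035773600062978005623866478054127,
  226312392132701186817323065184445133310779833827008522713016054706885385757767615648814220787018645837537306340326913,
  227146205974020249854574584659641073061144742477051225657690945914558858901172311765532840505656544795491853586224239,
  461142660382892295289209716833084996590412261097342574800097919966671685153693438172488312423766225088886788069608077,
  487045678162193262204990188867975578033498201075306673252436838130067284608588423291203828719896849089667414018153177,
  207968487585599516865054450879449518362527322552225544139419348230474277864117717977048207224826627579019750880697085,
  434932223914709480705632429806269230036589550873434211772784728136440935517059995069446918372335182463953575751931475,
  208802301426779912994057819248081103667421080324958950240438695927579743577438019013894066105958754660405653250174975,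
  211303742958669686252037243447835993789534336160420180857346931504214001696822043377262879951633001856791674648018049,
  336493804625105237690104012462365578950808775333911287087322372704140691560937448285036604187752824024506675184837347,
  499885607018059929444907072030069257895700096199338372050358942977307687555758647568867889822143775482316834500162117,
  217818370120784528027722378224307072301757630173542517342820813509078349338139878497696683239013925218198465218057203,
  216306626017915024956026560859030497042728424578535636053417143680155518937078966578651913966030776670231516135909754,
  215405894020926896992688403588454640913470299841431579458985475946599321241760639225599981045633028522677238232001085,
  495954654019720080463449563553273950222459981899379962931081003438878540703623843820333100912811228364452611663668836,
  543876364340862361662786110542411147568149740138275322238869842199559796215800089152597740706987568956160810229214912,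
  340488387974694097036283729696644976645313917823265233505610509283858572448104962113222232058044076429381666951372816,
  217939158128003837805606005912914586375054187404649700250338017751498477797156599988634730690297968927491908012042989,
  218789453808990345498787793411675256387435483047117623825803612041151702523937782342910319625365078794519678231944420,
  220475695230640992171198328953631459059389831120696196270936008968351300801273884258819240225796838600319375175168291,
  495172139265848931873257511903856903011899990128436896411873424788852645487733423635235850605820259606340052964065528,
  389257741984532830339138456611239802377873616424725688152601216908417062380596961749283903909169029121685541641016852,
  442882862401325597205495260071071499285818682138546134964564858621924908167624986708172547242735487945604695068446252,
  483395333035544997753922376224532417361661064033334436190996736177407728938791182393062094955972349377684473942908844,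
  599540930706222295757982639494436142785536084941347397039073455073687898164605466253262819731041408879771482759079944,
  221309509076269697901259615089403863251054302359209013824833985719479435065104549290538751979382354926289629948210415,
  222143322916956562907368665747168796320443449126693669581966094217892575458022569238441495477987511802462696745877385,
  445588565344247305380670516260764364720670559790003861065902419977646131926575105032934537706116680258044264480520653,
  510779757492433642980120048552748877891629052924115963166384846118336394397015492647643211715063459190666794349959799,
  536550699631695739105876219355610035115492851830102414060851158751191300809211088590209922029888104984225268290131146,
  223765351408740102474359852020672107283757746694379716483622265030895181987852005611421527618868951788311033852848179,
  264624370479349226702667376522599283490105468522311291124876969814525617486293884126297662679917110410781015439562115,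
  474798490331479587711223656295125965656745085957716212172261346614542101317386764664347569438022420173646189993781879,
  523269211223463108261833450662560335507098552673084595221360831368774937255018992180901964930063014502572659183772713,
  544888838061366328557142278918977653804840038307712853515287578409750009934356035743291912487152397678026669512421569,
  226266792937862742174543406083628967416114434205580866619807550594796957563795868722686569164617742042515031083630593,
  351026919189674212817410876631713748607865816487120895277961631316152740285170402867710684585343745765104749197794885,
  354362174561396878707336243334453937115542068903119367115989759733284165803369234403694679097719172385854041897715333,
  474483681869105175907825933449009312850057427730051279223163581004178134861214835261041438552988644059981165249871184,
  475317495710784439041049810246890440588423402794070632165561146408655347954057524831506459659433070135965627200713782,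
  511136419045268077152007859170977348415407308694716786071671164945155061337939699446458493879729072877187442414477317,
  465227046198564650393512358485900027627702366034774260514219926673354442687198570947452326765105985924671742647487423,
  340396040839366775283315359170345170194486689503474037464661675839515161236475572071339868006707536980476425569774943,
  411032266670792896664001028454538502793709324488298820477470648417500832445754260816712757391253361181080314988915247,
  541993207475061834216881682937465625124871716514446899454234890264772305088917240368270125666429211382349070393083643,
  370959767656433471900860482097128586980477110832845431243857426694556388411779365683095264121288344910683420209963099,
  486819661506641468393870311536396055561025754171199521343809618822114055922316693254527960248205229227630805700486175,
  486990889512059398518908971148319202839182647712649580636090492717771958327051307210348354804595399213475014212235270,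
  488658517198425651917460634869130569844221124471166664432873333898457655159655617511493336813427797266548021786066253,
  458556535455179952373355810478506694203860662950695547715061989598268375832238118813106258258403683501569681198201161,
  373748594558313719037371876121923446842996006858694954681760098202624110158954923723295934850227246181027589108556963,
  374206666241554442159902157925633805061578746165184031267421044201814980156026411397785089020083874450299055018022295,
  463644101915253357319672597486035637293984708794063519092178262637341441710795075871408047545102130887093692676762846,
  485942564574439836518644889025970372332645877621016269281428086692740907511232849615829276093990407917866481559217406,
  464477915755469417791935035411483194105737972429281444200310161846181323540713070252648276577791260786346684597840714,
  473664757378819097768233577101244953828980673770759205890587168064021589647480487541177603601594097609562341344727210,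
  256503593964187120246293001552869225367045591561806356812597942534828060542337548264816205617345583489163756526709156,
  383806693538290677058198133094371102418876521606789043188581033724804048100368564975248025447326106456285624209634248,
  347656448921176735566492493462825887223711184193118153741995560207457449640716326423106458458676267930101373503536506,
  340822475018729502624260063272107802396268439329889485284063560961638741704462519787015394995125836206410744807432974,
  379436348366066153032084391275767502123157442718320098851085298506332707882711339458697059546987347544185725071144521,
  478712309014977280793221938639514608553247952749792387956179114303408569940775953520159087337054199867496617815880601,
  477349916779410231135426742792168125921346490828447515140217362755440076334689891038660826793858735383874565000673263,
  263000201222571100240379757163204648207941712951464165122829367731832882712758463036327457496091386744178295046545298,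
  475682289093567098573029787501296460824505426866083836209185767798692257788487633440896139897436094365519517992772150,
  449357583983816349187127214544245796958239527220364000791330734118355188309992188126115999551686552652541918552775243,
  404722505413017155588968607144459476183315770102065321684055870742417924261445226324867909506999950412472602584150519,
  269514828382431579951177787564902017001927852485407768754106901553520876269351336224150656034813701215244688209289189,
  278382489530689922738109510158259708813779217651023117204747239573352998696584894246818633163697040054156149673056918,
  518067423777946826201063034032433234497573419178959488198912396546838064764357727644648115951409188473546428251649118,
  384848582429696507865340422729367404862833723526829044447187753735580550623794049419345701096735094639036434567141783,
  268003084280350760122787614007295525424074490435381743754996790631994050311073857768835773655972915934025087417034187,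
  310388319153242102150661942731687325976374917541062020858324407147792671172034885843005980484384726980558810975929165,
  443424381915779054832834360652880699951496129879428939172971237101438701041948892713949960205446849491741931581460550,
  500780722084252542315083873138035125686249722987057645765484761698702078689234545358244610135040362099209007093409896,
  269670711964647780863511486860367900650399071504799577054067574978987101689144904543555785964737590673703519036248304,
  611234736854974523564720353179731793631492919674950757680848067971961758106277456640194018586345339697528798214185979,
  274670338728992087077912981970762706761363645836651781668743324974879219268474345011190763526531960458969834657724908,
  502833352530320417010295785404730803162663947698677714817211512915617953423868167906495241416775858662783578911784013,
  287180802667027943602469663756365401143540883860808296953907928962316209668375171548370451921538796665806185177705084,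
  440924365359789521330578105710569031722142988663394517049080052525977262475881485230064219144355535335270028526316450,
  286346988824807209703572887101430040236513266084960685409408837237131266850953753298210042642919282482555578520001147,
  400246277763231591384883483395544372568916985971092146118670499516644858549595202370683427577958928654371241625041553,
  616239479760008041667666892184200531120288954533005455294766688029044545974038699583903988140010595688197369419718694,
  542149280316528120984062559707559884923697551981899780337807098843778007230271235753663207323687630722410058208389738,
  283011733451716673217442509475257060003863185921454526917830214226461307642859539721731200675776961958883719646208713,
  291349871882445809686012371049554893477614414333774318947459781719398533283155100389644240612908560575036634694810323,
  545484535688270722318839957141832013504853790427054211180119690108602841432136495866068920578009322747626116554117226,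
  318628425162540809043928351576006787377052104271104158862617825509816985639427140948534309888895667442278943081887833,
  603129577466450138502006033711944461653835150784225078717355616459683182321518361682996993591053205109984931191121713,
  622882336911892747206872902001272030531161498010779802172868707025055475119478501433936083622757302756527034225698740,
  285478079408577119644003810801398343698226639373280341370482372201216261995962792230694430215004907231248943976471079,
  624564753929935921874627836372547830373216087040901996457293228118240273730862978543851245402800066411543635712380370,
  453526653198946033066114567882827712053516766151185173146101775128765319139129832488781615849383796492850608041018706,
  391379880833067824166952726998880204626750774521554582184201170352837638514837265659179025484378770089163853639328594,
  526544933513810525714740405908696863460241927468134569798329218977358997792409014109047177760251635685688120427758869,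
  305524707207451458068374394725888909986036238424113289411499738404675566936621943111960990573889793641701768213480713,
  435920057329236219740658584001040647852122030279942051333045962562743256540523273507499114158057405775837833451806286,
  626232381615880787136645872003258087568509007985840664962861888872830251231147391484958350270077643725397695634222634,
  613055248585086056412115443254359654761661107994750290462136948791903014348183572444025690056016890657783765302908878,
  472942731353064294711799156619579710357128580907332793275137619089376731593864921080716594174361967130709938234880558,
  572464253006436435696001705066061282160369292063242750360572042216182358510040439023151671593713445048659755637442401,
  380210604082456908850259766150905711208647183111873295750213578555330990132372446370445803689260859514040209090301211,
  292971900372134936393836338573296615158459814292738564662635901793202805527515926950689554887808590287431574665661898,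
  522985990316686048849195240725171925605046695458662920723236408310583852861155002375466285684363059848128198201094918,
  296203845067103557278595855394197043412816659447473770235714659664055584515394099015996605828328883680492522450472905,
  522095177483707904031836456620940769266576684589616916040088989221968349792582051131838356437379903645913595213513391,
  423449809448161836221966487589703163541668076659764434637815812642280276208671302473324389819204678046122451517753742,
  629565622501347287468237157064210331916938830860527534038229181928089556897131029196600806307377627124017802423893422,
  297186568783120910228804272293716480570432851822793062727498216566767240208515311674400705088069972279034619254483264,
  329329345926582525386778472218835875905181139502396638686353595335749861672547303775798674047447647511602366518898730,
  298020382623338198665247284989901025111340096768088938951077718243307057785576416703548996262027405242262387434770228,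
  516286045110898580924059761213142716659897633897586366765290854933105214291508171706247072970785761648122606210039517,
  310527590266827152541771099489687929640849625588934277553114926873594777900097838669501794747955064960140209993274479,
  299591112018874268265321257091522439804548551667577044023924663520794822359008209169474489870172806270908905003891585,
  539052141156613223778190895816816332432986065469057320712586353890516872512219861430341868388626703903297228662918507,
  632893509477690827285153912368643524107195486432447926985825871167251103113327667451425098205536463250910039867688730,
  300521824154011475180587245797311562322701229021698574755290216489789789917950674871718573607151643519708829598408176,
  425176982539361427350386763525517606674949792034513770252149321682441008143888288896137268759964600661165406426349210,
  301355637997076418055377077494326223140884048410962278086443987130131489836680917872772046642421610582890050972937713,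
  635417198147715959874549617458047396472617528779363884882080111666482763848779535532915629951461450992967208493456538,
  302189451837162386939031272452103158639115662941609444658331164870722929348034932006967966914876583444803464791233056,
  524624183540235579619662597504071867964801227484072565374678426509511657800370564303505832018505090744003378218287105,
  503198145915520616587750565372271703563866646229439741240962270866288131179370854505320836265036494857921892379518502,
  564550466258173942316601450214728194026355190536191207180568425966157404423233041461212611407172177397621464415717874,
  308026148739840908428970901024882707257133088223032566628218055025440607551932939439201266690114747950914335810616904,
  534049258103860126476830681658231593364915100195143612809823960724705025393725758294111059148874272318678255921920143,
  630235652236047663306771829665963857004581368615953309943399657841866298524517420981292262680086693413879224416945053,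
  527066067141815287594311309984077631161551316390444776176494563606765410269772358339799564163250877078162818894281451,
  419191667130253101417196668703669813316183938214660775807530487685915605462925934473832199905038585363508567313422230,
  532776290198396313737540194974275928549804184072434116846066722739755222363146518381768453639032041972078986235815794,
  642072830150146161606337426398104323468567294370783155848870043276563057104824536738798737144479719276035522014810390,
  529046375046283391521461114778610252908185364753711955453759654205421082827081119307460358304698971803921135699902166,
  310481991072267522077792466014874004553915658375241627149309877730678613579671190675766533049659612241199000474997889,
  483828723361035924283233143734846166620239741607986512380142637608274079011318213262518668151132953896827063188242114,
  448166432280479147983681612529675077366849530403335574536102160087714668138641528641450353751037923765277176978522072,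
  538218327313855377995377355697830010995984553388618759467425729815012692489008278241668377876204728934863254811477356,
  537384513470939878508354910327175000132649705480750768749205254640000995173926265294365570754422423821717334024920942,
  519874422769459666869792612439235912126975459951056799999685370408317166179317867018521157648618558982648371136484996,
  358787289442739672948833451233876017461487080534001183107944252334621647748371699567983903928614774515426333027581276,
  313829351771571255028315962613688582332784976898512060682465231859524226079865075061019203510774985165533552481983527,
  315530473326359214016913748587835705261739792778386146163733428689446772246675035594780584846250490367392092794291180,
  316267388877536132068188923604996589699776658798561286854073385746002866263086764549866223735453047328992820655138489,
  547390279586132226299178998415719587638342640678048474783950647586519714133277594966957433518138406109685191864729621,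
  317152501817703876853708876974990031369504061595550935869006864767312458347643851259674549255743143590923285063534315,
  452335501496084641837107323277201547441129817145195676160446980948923313111516394618801930071540509023198924961285170,
  546556465743240911044430056164150314103770172584374833341558324490882562718550454619205272703907298337456960250522054,
  545722651900325411557402149829951911387115322307626273214361540138185034500467158274266384539795875967297267925900933,
  543221210371542595275702958234960158757449981295619070244446413272130406223736740031397637600983951291179554946431420,
  554554587647608893110519489017717324234105340032731023762450030129302648876640207135149327660983098792223869897702953,
  561170949519504222806620553770519869156587227329838038469054209210445085563532822586988809603634415960328351361292551,
  352680177800323164906394764584236726368299108681572462167560512209254886564250350480411508008909777425578570237246204,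
  611832192541793569569880263846429081557919417672589495637123948487714625502659745461565162461332745425173265223213222,
  459306860597428656155810354571906313957920133760760880560903252656496165082199645748343370139815238170368422836512249,
  435609238495656391491234710291350741027044179704361201325209129742020149065656378520617163866697306909024860985008131,
  401413299146289025325562931987424117824175511908011571550169624491362468721563342167036281113377615695220640808588892,
  391467090960496133025815987242420472791350193361022680058257703541944772260671438766290907573435923560553087715306121,
  392956120872598751630176817508266170146991193396359564365524030769004018388899765129452084694383009057038540930163637,
  516777414451903137783468369813478243519518765715287091940405813047568425727358997756156530381571293070353376520484625,
  599643350429993673175631152708838301654557133015074704467200921491704111646372759070686434565241894384398412625138145,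
  443113563084008781671141155918545819083038623033873578592430735269555447357997513828436573649207518667465006870390859,
  647924405788172383323087321841451043202146481614186577343838283335455922229846038333177164182487189884537783512585265,
  346232675645722137502739145380500457923866704700451035892825627011712309512543111943654079900439851704172937754914655,
  346381585512490645409619881828416016058508890534490445968178402425687958367339530204833457984796726860516230033509082,
  347900303332264942609714929523635545885407718695456033763747887641949134888549877386462176356050827300859862827705349,
  348049213198455113855611404920939433937570375839140124527395181348118515776803439416801340777464661759859277439755985,
  512209036546009462737666142934094854740412624865269900323671054653659797486930683065420237370907638666174563820822722,
  478116729500542565423530890026374749274269274473362666545546820920239636590866146679511736290810065599507533758824730,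
  587972006767888364919470377695205901172431721855751872596930359022713939433424097181249511552280046368347131035393243,
  503912845288814258195864950657955135187709306139868135857168627539565584852360959611657387857096974634730584316591941,
  573893662690958930663541827036338579152425542810909112928030339022285921777547819928891249391918309882555267099238284,
  633153990944459890713301472947037721266823986626286253249553642850760076655607256311920640214105375403709232887261388,
  629223152428631128630461745244817403651479003710551036844874964883512442471956176378256572850522821054628758692214205,
  613082913306185568844397973034827346787641442164450000148801038487054664272454387055731892271045480574184467644708527,
  580742833307357769223839406877410498987097970234040925874187508438043113533545108296652614081626936000434966240942079,
  581576647147172851951027961516568993481104035159516806602093214068088507259173834896159092539919472092286205065781855,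
  594433671527238369472026573897979917520485105934986247901358867094516779124010252951471420191147528665474070374515260,
  640896546229601880603692913919035900164813008789326244556049002272456846221642303589557940579334671953415803051815767,
  624713736506051459843027821050047412960321754686037060749988583854907210374219850182602461049527406722043795155172067,
  626066573279720612632860943236634713728458627154059297126952689531175185852018650739417553646275357440816824410577604,
  632992329530241673712115930850308629443255830515805901776641662750631211100175194594167617618243312384323745583136036,
  609949034283880448096485824664538212381547036650553593625181320090657860737062589462079041118841393846296587244391845,
  394742788405969836062740834335593486276843220499759121547352715537180140234245532479533305286900610824609626257190153,
  629356229456604833879992747418847647227911699559753816333808276374003709530132640251140140644056220852867823738642596,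
  614149245253292699054555979396925420757832098459655215219673210284046214518286372164515160615153664668223913510767477,
  390573719189181347706827407574715156242425655742846143737004073006588141473986302808815639993239725115048057331757789,
  635441657722654502151949659759369035891571241578777595515792053657268159099362729993599310693325063645557050600374532,
  624592507715684673944694324084793219351985492303768804470351180436101513010642157801277939779288158135565868547702464,
  569069439506622448125099131140640044762892018774795575554818943805789231827846832708009120837223579978185079065261297,
  569903253349818214032669904495841618682864368028676642766181270237434849378136557028322322930000348658793643378465290,
  565615069667558650829211659022603682012567485148742444601884898810376698495740694140473981451269619019267319009671778,
  525942647145911468170889994133252386680797775085028222618958244913163486577429370689053820886454596066531308963570493,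
  585879531300531476168295537442077889717545637437303460810062259610225737638821580371712809517512876651337757970688808,
  654559819572259089205754032712433124527804897868772993163727024314525405746986429449092491229632068920004070044103420,
  651255274042711317374718642600009507320002586623496890641485847613359444983056120048642286717300405394749341878331393,
  606533631359910499286555029907078478160429074375811216709712612664534206848929301696828593527841693539087338586313372,
  655207398117311928766963001408737211884108854311145162681753110919300507290535036016370879414308112094003213757456888,
  614504849357431117276154352068554567986968176078437749925066949479416909705213178603015127614160368885584499789799933,
  596103513561606258308121275087771106641644435430284326463715003426270458751000710099784797862694519350645608685893441,
  528681580271954525768365387434803272733772317423479039174286577428656106257947718252311616210421491716921894731858548,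
  587590491650435175907805847196812758656169571191781139881241918768974080230369801058075112810728364914771146151596489,
  406768314872797588336735123233778000397513559208437730736492388807133523980409610161049084260722618084195910604189166,
  570843967984013730869339063435996120817996069390070562946797358879786236570103144570615876885554169017700786127591291,
  596347180103860262332470990386001569299413722319124472312867165448393119609395901685845715913197228220297435624209463,
  403914740676991468945064552130238600779665474366020752025775147702927669498103522504223073535163634636487545109523798,
  476469579562971523956624038210040254178601331234407719825617007070977859983281117978536503430534491867020266515855766,
  641729647584838496441476895871348797593533220398899399940051319886676359557147118961840426042629799417658691601189745,
  563173566663945294805508862597209463434362118335683318647382686868902417288769432617598546512672368866557639873798500,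
  640079747195502696253979120111972119085519991745983637830476206137172699550489205503107258971448911901074027528606388,
  481819834356511958601305986044379420250284751476088053182522719956283337411062702878855642434466783439886306855726736,
  622212296371594666703899344252649063916384808815892607452758291324933162933630887253786466208805354155263955889467120,
  648401612178442821091442831152353206831785283097254447660121203790924122805671710368660517142021054037146359631618215,
  638041535579524348427511045881336592651034845251744089264181985180781809712469778643692419052959922802379875208997772,
  630609900886536252471331453733953523300987072510816797129938405978737379340208550175648445614598274753687632295172342,
  648036807114603159791093449717926857781065515074360894813420880658456468903629485540576054865704342941634488460179203,
  588061677900661473397473175864550756623835605002309936653550588205857959552443949451698967083150673028309452879913369,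
  583303821830414803673577463395174564082459007589154222241374719966995322000676182542203493931794655905021595751768501,
  471872706860277759089187194539685629352513708983547713631305372942846293028094904085425223109403197231031977395271692,
  606369831962880328752690002846326184679677477477648440554459256998385875775256083610049125533674375834405772682278054,
  467284592739719148898280155459913406909485963566709088478031219607606189119952188787367209754244606956577876869826971,
  494383542635902519563348360857743291611668913097520666850236443403477577180513469140786523491137636229356577866553679,
  479769553242751883191629563510648139579519537518304109142127484301896157795298381165432499691396503471265417915013025,
  493134948722326039783614482776718462709312356714139976376012056255333089804484466460168368839552880198406157003665691,
  483104808613399529221122045315207945829550126987502131556743376478711104143923097264043304868476459448156069530426207,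
  498135704928946941363448141939763085704452985792324766995383020679373407898610890170643058076767227642345503886427535,
  507920264226961862256135627463426514332808726787695689059158540918851031478772080141369793179925966383118822080446899,
  657811055849542987278624713301639088733769528474768108865248131869313774793075593084445614064374817041939479880264842,
  491450315443944718565658326069357499193114475449409896236225023590451651890446332883157270204964487818220858761814967,
  588625910382064850588776791655651486224854700132724478248510620016024416385726982075343113694467394387709290402797293,
  627386422196099945280704475149413815661097323675183642650203427112401103193324763097200889697131996037028280104238549,
  617566773439604686931114401629618666981883571791690871994413655465994812363258128857284051441094178381993725629246121,
  567456982826788280573780530200674796696268876218063492208492844804576974906217630226732480341795021793678631451841553,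
  657930171906989991060175842746770139028221876910380852255105574461963959248343724422307024147102109008999918982257581,
  495619384658652409987004569492936765901592200598689904091240601994126559688037479760575425916619673927145299105344511,
  655621365507801651505339737680850521531421367113712448803421335901689094762949510699008620621741537253962377407657356,
  621361595394882067957325065259761627423798649192811429402687790218345816026086249524964842661650429103772179470597970,
  643828958827122060261814148136153462413442701788186397674957096451459756012932870678007127232684198457154962123359276,
  659776488514111350605851797822487450839295610497738627918513212355385413102489097047526581324058499201624546741901732,
  498969518771747419384816902658813290889052158781462223418983465645585455795190127233906621309404031852914026905764224,
  623743804346452624552993792084222921706420623711127315074006824554524276236510541798237244363511002479740127950606787,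
  611730076539032153023277687645313052230335772406105725616663982280077312862047176028873367983835603373952018446759543,
  612861682836901505087613302337751689500726297388699660454680887520273207811165431035894213220326641526327166471952135,
  640854004502148089426029451869103954836536518048314868661863718521518692840816224526011147540858582894483524044520258,
  617864565894085716286397383490919191724585711507131239643591462686124617979232547446847924340034341801953325307803311,
  651195715914584695504448726252006057844745189685320198460700064729800813592040673520696839986599661633782742717178223,
  582708253446613744246156611066462882563493173232682346565621421987008304764738671671811311581988685625488799068901784,
  636029679731687171348573429867114211123223086356159660235971971400172828399742472238122727670787930969278635899748508,
  534116260995241783219665410882555457794604829235196179263752635216493494087403832834100411993017660342998197390954449,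
  528986817115547536795917070317207342848060024242948158589032634362861905545956513802349953994194175375029633863020782,
  529820630959315746060200579408787713014660368367134192538267575886898385930657045573748050434007135418735700191287616,
  520648678686979260709735333090290693040520519900035779974402936309910269378770331748259888333333838353236040834883749,
  655019268217938075729343603167782623550529077765651259757104633056227024284665926089881696011873861551148874949840721,
  653122863511849335398636414950813446456274826563476252088132035846076596529837676299479514439668178790939708561306997,
  523983934058724415938156076751934408115525854190067172153661817688268249160048223824835393281251567083597946790295472,
  652922901729109981408142509544082055385364219674974272642599885661538757487883778345128216210436102138232679883670697,
  640973106446832629822963299178894253957542569500057092374736776297719126215363801149137965781468968866930259001138979,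
  601426405424794185710066525512969464040784867435264487434420404814328121483804377895073856316546119865469257181386216,
  638944365030571576306285296123094259232558071525361454668822213609584979551729902218840567697208450840819946372870505,
  638688508269436147093366066451159352543759147804496765261683810371676658138791835601252669622631550912839627284097129,
  532322072488051058883587127137681681319023367841181350470908495491369480099745700107407885157797799382187952610604900,
  655147941775130513764065622598615057059156340011039764753435553357851897482515334034824983620042182125891390394130418,
  533155886331015156565047763765194297910294859101304591121114838318252631701601474784811727321952157536421696955236426,
  652100919769349575764105510856632191970562362980044591724699890910866873800797479282173826455088069126583797577461849,
  657350676585032437459527808561656755788109023538831131312994199641407382955108647010738578497734235482294649659375982,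
  621182804690253983761994561225857877537576095007974793587357380196254635152939090749410791890232418104033756849902859,
  561408658702312433578250476534117097339919035685883086170770097817522392824646076127180542950819013552682813781530702,
  608338721307293181661383661754491316885057037863159549363195988295873541341163170783646943333731724821924678619676948,
  621666714327242907307294494503802521948583194867185159279538145533703030836711546572972280414881603051016917468208269,
  588723622943965491627458214284961733020691849319641555933802014770228213274241013802240243013445305303826131175714763,
  587889809100500267418935515016915613492132814207285268725392196261138436408364421834529587826834874630752208772869205,
  590094198319548401897874201695374761307655678302949324649614964405154264284449038329966905433180429104734938959902684,
  579849461534683224792297875018766889274987509598200489927664951906439616563863836047441734011762987309925652022689994,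
  627848928312189868664915149341533017834002396486907555631257020711219128178170635782391543673273058080976085223146351,
  625301887588710413707278687845111477787804311374007657355548192525788578069474006084340684439852809811029434361144063,
  575676937035653066077006384281427874676780902909080865315595009895686348465118679107867733723243362419273362246407759,
  634523826175933563907050073169466829744337823396281385357655013194740838640730520828496796477888245187392964010554601,
  645856886343151121143899181506636675336929815070548701068968720039440186632029155157929570339961839731694672286689082,
  633749570462161667460129566612995672104589444297792187465595925624697035143407136396142441233074330493706530817794469,
  657828072225998480823494143454303394343109593730953340494769298896498527485491382576237707468412886249608507141247306,
  638339316727253077590481152265901964687557342678777973333191025329586039006677304651658882517992747929647377498833193,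
  656160444540485352069157130004933091076675881497807148868314940582066896780362280718579102737050604097713406402169952,
  660336958344731425727900584322360263904201216314321840046791468951665032533981085797103891331536222630484408168490843,
  617967596166409820386969882067098192107616751824890819567687501317229398987392002441811280664420277602241835898032158,
  658101517824319063007017283310005749939828613495976553422438051848402577303453739678346575533047916623694297703431259,
  647501797579462394623208425005847087106495928554465530695714533681841082470423128641833180286039472881624040531602132,
  643874363722667449240159525504255870944331926251198678328665574981778642944575036678716222588187498884464751048938571]

/-- A certificate for each orientation of `E₈`. -/
def e8Orientations : List ℕ := [
  18831569, 86240026, 591691107, 793017692, 8246858229, 9689698798, 9893122366,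
  7323595253, 5123903404, 7575769589, 16604308030, 16452796990, 13044844533, 14272045630,
  5847486965, 2321878956, 1464106339, 2405994412, 7609324021, 9287045614, 13011300853,
  18315297342, 14238491198, 7458099701, 5056507820, 9186095605, 9404486126, 7726764533,
  5478617582, 5344399861, 1516801964, 306478435, 287566618, 558136675, 2439548844,
  3144191909, 12977803765, 18281800254, 14104216126, 7491596789, 5023010732, 9152598517,
  17140949566, 16553689662, 12910397429, 13097869886, 5176627701, 1483247532, 1396768099,
  3043299244, 8112411125, 9622360558, 10950086967, 9909899582, 9706476014, 5143073269,
  4001926894, 3431501557, 3295186853, 2590543788, 1885900709, 1718128556, 340032867,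
  35908378, 52685594, 356810083, 1734905772, 1902677925, 2607321004, 3311964069,
  3448278773, 4018704110, 5159850485, 9723253230, 9926676798, 10966864183, 9605583342,
  8095633909, 3026522028, 1379990883, 1500024748, 5193404917, 13114647102, 12893620213,
  16570466878, 17124172350, 9135821301, 5006233516, 7508374005, 14120993342, 18265023038,
  12961026549, 3127414693, 2422771628, 541359459, 270789402, 323255651, 1533579180,
  5361177077, 5495394798, 7743541749, 9421263342, 9169318389, 5039730604, 7474876917,
  14255268414, 18298520126, 12994523637, 9270268398, 7592546805, 2389217196, 1447329123,
  2338656172, 5864264181, 14288822846, 13028067317, 16469574206, 16587530814, 7558992373,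
  5107126188, 7340372469, 9876345150, 9672921582, 8230081013, 776240476, 574913891,
  69462810, 2054353]

/-- The packed table of all rows. -/
def e8Table : ℕ := packDigits (2 ^ 390) e8Rows

/-- All rows `t` with `a ≤ t < a + n` are valid. -/
def checkRows (a n : ℕ) : Bool := natForce e8Table fun T => allFrom a n fun t => checkRow T 794 t

/-- The certificates for all orientations of `E₈` are valid. -/
def checkOrientations : Bool :=
  natForce e8Table fun T => natForce (packDigits (2 ^ 36) e8Orientations) fun I =>
    allFrom 0 128 fun o => natForce (I / 2 ^ (36 * o) % 2 ^ 36) fun c => checkOrient T 794 o c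

theorem checkOrientations_eq_true : checkOrientations = true := by decide +kernel

theorem checkRows_zero : checkRows 0 100 = true := by decide +kernel

theorem checkRows_one_hundred : checkRows 100 100 = true := by decide +kernel

theorem checkRows_two_hundred : checkRows 200 100 = true := by decide +kernel

theorem checkRows_three_hundred : checkRows 300 100 = true := by decide +kernel

theorem checkRows_four_hundred : checkRows 400 100 = true := by decide +kernel

theorem checkRows_five_hundred : checkRows 500 100 = true := by decide +kernel

theorem checkRows_six_hundred : checkRows 600 100 = true := by decide +kernel

theorem checkRows_seven_hundred : checkRows 700 94 = true := by decide +kernel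

theorem checkRow_e8Table {t : ℕ} (ht : t < 794) : checkRow e8Table 794 t = true := by
  have key : ∀ a n, checkRows a n = true → a ≤ t → t < a + n → checkRow e8Table 794 t = true := by
    intro a n h h1 h2
    rw [checkRows, natForce_eq] at h
    exact allFrom_eq_true h h1 h2
  by_cases h1 : t < 100
  · exact key _ _ checkRows_zero (by omega) (by omega)
  by_cases h2 : t < 200
  · exact key _ _ checkRows_one_hundred (by omega) (by omega)
  by_cases h3 : t < 300
  · exact key _ _ checkRows_two_hundred (by omega) (by omega)
  by_cases h4 : t < 400
  · exact key _ _ checkRows_three_hundred (by omega) (by omega)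
  by_cases h5 : t < 500
  · exact key _ _ checkRows_four_hundred (by omega) (by omega)
  by_cases h6 : t < 600
  · exact key _ _ checkRows_five_hundred (by omega) (by omega)
  by_cases h7 : t < 700
  · exact key _ _ checkRows_six_hundred (by omega) (by omega)
  · exact key _ _ checkRows_seven_hundred (by omega) (by omega)

/-- There is a valid table of quivers of mutation type `E₈`. -/
theorem exists_e8_table : ∃ T N : ℕ, (∀ t < N, checkRow T N t = true) ∧
    ∀ o < 128, ∃ c, checkOrient T N o c = true := by
  refine ⟨e8Table, 794, fun t ht => checkRow_e8Table ht, fun o ho => ?_⟩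
  have h := checkOrientations_eq_true
  rw [checkOrientations, natForce_eq, natForce_eq] at h
  have h' := allFrom_eq_true h (Nat.zero_le o) (by omega)
  rw [natForce_eq] at h'
  exact ⟨_, h'⟩

theorem rowDigit_lt (r i j : ℕ) : rowDigit r i j < 3 := Nat.mod_lt _ (by norm_num)

theorem rowMat_apply (r : ℕ) (i j : Fin 8) : rowMat r i j = (rowDigit r i j : ℤ) - 1 := rfl

theorem rowMat_skew {r : ℕ} (h : checkSkew r = true) (i j : Fin 8) :
    rowMat r j i = -rowMat r i j := by
  have h' := allFrom_eq_true (allFrom_eq_true h (Nat.zero_le i) (by omega)) (Nat.zero_le j)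
    (by omega)
  have h'' := Nat.eq_of_beq_eq_true h'
  rw [rowMat_apply, rowMat_apply]
  omega

theorem noncrossing_rowMat {r : ℕ} (h : checkNoncrossing r = true) :
    Noncrossing (fun i : Fin 8 => (i : ℕ)) (rowMat r) := by
  intro a b c d hab hbc hcd hac hbd
  simp only at hab hbc hcd
  have h1 := allFrom_eq_true (allFrom_eq_true (allFrom_eq_true (allFrom_eq_true h
    (Nat.zero_le d) (by omega)) (Nat.zero_le c) (by omega)) (Nat.zero_le b) (by omega))
    (Nat.zero_le a) (by omega)
  rw [Bool.or_eq_true] at h1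
  rw [rowMat_apply] at hac hbd
  rcases h1 with h1 | h1
  · have := Nat.eq_of_beq_eq_true h1
    omega
  · have := Nat.eq_of_beq_eq_true h1
    omega

/-- The exchange matrix described by a certificate `c` whose target row is `r`. -/
def certMat (r c : ℕ) : Matrix (Fin 8) (Fin 8) ℤ := Matrix.of fun i j => (certDigit r c i j : ℤ) - 1

theorem exists_certMat_eq {r c : ℕ} (hc : certInj c = true) :
    ∃ σ : Fin 8 → Fin 8, Function.Injective σ ∧
      (certMat r c = (rowMat r).submatrix σ σ ∨ certMat r c = (-rowMat r).submatrix σ σ) := by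
  refine ⟨fun i => ⟨certPerm c i, Nat.mod_lt _ (by norm_num)⟩, ?_, ?_⟩
  · have key : ∀ i j : Fin 8, (j : ℕ) < i → certPerm c i ≠ certPerm c j := by
      intro i j hij h
      have h1 := allFrom_eq_true (allFrom_eq_true hc (Nat.zero_le i) (by omega)) (Nat.zero_le j)
        (by omega)
      simp [h] at h1
    intro i j hij
    have hij' : certPerm c i = certPerm c j := congrArg Fin.val hij
    rcases lt_trichotomy (i : ℕ) j with h | h | h
    · exact (key j i h hij'.symm).elim
    · exact Fin.ext h
    · exact (key i j h hij').elim
  · by_cases hs : c / 8 ^ 8 % 2 = 0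
    · left
      ext i j
      simp only [certMat, rowMat, certDigit, natForce_eq, hs, Matrix.of_apply,
        Matrix.submatrix_apply]
      rfl
    · right
      have hs' : Nat.beq (c / 8 ^ 8 % 2) 0 = false := by
        rw [Bool.eq_false_iff]
        exact fun h => hs (Nat.eq_of_beq_eq_true h)
      ext i j
      have := rowDigit_lt r (certPerm c i) (certPerm c j)
      simp only [certMat, rowMat, certDigit, natForce_eq, hs', cond_false, Matrix.of_apply,
        Matrix.submatrix_apply, Matrix.neg_apply]
      omega

theorem certMat_skew {r c : ℕ} (hr : checkSkew r = true) (hc : certInj c = true) (i j : Fin 8) :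
    certMat r c j i = -certMat r c i j := by
  obtain ⟨σ, -, h | h⟩ := exists_certMat_eq (r := r) hc
  · rw [h]
    exact rowMat_skew hr _ _
  · rw [h, Matrix.submatrix_apply, Matrix.submatrix_apply, Matrix.neg_apply, Matrix.neg_apply,
      rowMat_skew hr]

theorem clusterMutate_rowMat {r r' c : ℕ} {k : Fin 8} (hr : checkSkew r = true)
    (hr' : checkSkew r' = true) (hc : certInj c = true) (h : checkMutation r r' c k = true) :
    clusterMutate (rowMat r) k = certMat r' c := by
  have hs := clusterMutate_skew (rowMat_skew hr) k
  have hs' := certMat_skew hr' hc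
  have key : ∀ i j : Fin 8, i < j → clusterMutate (rowMat r) k i j = certMat r' c i j := by
    intro i j hij
    have h1 := allFrom_eq_true (allFrom_eq_true h (Nat.zero_le j) (by omega)) (Nat.zero_le i)
      (by omega)
    simp only [natForce_eq] at h1
    rw [clusterMutate_apply]
    have hcd : certMat r' c i j = (certDigit r' c i j : ℤ) - 1 := rfl
    rw [hcd]
    simp only [rowMat_apply]
    by_cases hk : i = k ∨ j = k
    · rw [if_pos hk]
      have hk' : (Nat.beq i k || Nat.beq j k) = true := by
        rw [Bool.or_eq_true, Nat.beq_eq, Nat.beq_eq]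
        simpa [Fin.ext_iff] using hk
      rw [hk', cond_true, Nat.beq_eq] at h1
      omega
    · rw [if_neg hk]
      have hk' : (Nat.beq i k || Nat.beq j k) = false := by
        rw [Bool.eq_false_iff, Ne, Bool.or_eq_true, Nat.beq_eq, Nat.beq_eq]
        simpa [Fin.ext_iff] using hk
      rw [hk', cond_false, Nat.beq_eq] at h1
      have ha := rowDigit_lt r i k
      have hb := rowDigit_lt r k j
      generalize rowDigit r i k = a at *
      generalize rowDigit r k j = b at *
      interval_cases a <;> interval_cases b <;> norm_num at h1 ⊢ <;> omega
  ext i j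
  rcases lt_trichotomy i j with hij | rfl | hij
  · exact key i j hij
  · have h1 := hs i i
    have h2 := hs' i i
    omega
  · rw [hs j i, hs' j i, key j i hij]

/-- The quivers isomorphic to a quiver of the table `T` with `N` rows or to its opposite. -/
def IsTableQuiver (T N : ℕ) (B : Matrix (Fin 8) (Fin 8) ℤ) : Prop :=
  ∃ t < N, ∃ σ : Fin 8 → Fin 8, Function.Injective σ ∧
    (B = (rowMat (tableRow T t)).submatrix σ σ ∨ B = (-rowMat (tableRow T t)).submatrix σ σ)

theorem IsTableQuiver.neg {T N : ℕ} {B : Matrix (Fin 8) (Fin 8) ℤ} (h : IsTableQuiver T N B) :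
    IsTableQuiver T N (-B) := by
  obtain ⟨t, ht, σ, hσ, rfl | rfl⟩ := h
  · exact ⟨t, ht, σ, hσ, Or.inr rfl⟩
  · exact ⟨t, ht, σ, hσ, Or.inl (by ext; simp)⟩

theorem IsTableQuiver.submatrix {T N : ℕ} {B : Matrix (Fin 8) (Fin 8) ℤ}
    (h : IsTableQuiver T N B) {τ : Fin 8 → Fin 8} (hτ : Function.Injective τ) :
    IsTableQuiver T N (B.submatrix τ τ) := by
  obtain ⟨t, ht, σ, hσ, rfl | rfl⟩ := h
  · exact ⟨t, ht, σ ∘ τ, hσ.comp hτ, Or.inl rfl⟩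
  · exact ⟨t, ht, σ ∘ τ, hσ.comp hτ, Or.inr rfl⟩

theorem isTableQuiver_certMat {T N c : ℕ} (hc : certInj c = true) (ht : certTarget c < N) :
    IsTableQuiver T N (certMat (tableRow T (certTarget c)) c) := by
  obtain ⟨σ, hσ, h⟩ := exists_certMat_eq (r := tableRow T (certTarget c)) hc
  exact ⟨_, ht, σ, hσ, h⟩

theorem isTableQuiver_clusterMutate_rowMat {T N t : ℕ} (hT : ∀ t < N, checkRow T N t = true)
    (ht : t < N) (k : Fin 8) :
    IsTableQuiver T N (clusterMutate (rowMat (tableRow T t)) k) := by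
  have hskew : ∀ t < N, checkSkew (tableRow T t) = true := by
    intro t ht
    have := hT t ht
    rw [checkRow, natForce_eq, Bool.and_eq_true] at this
    exact this.1
  have h := hT t ht
  rw [checkRow, natForce_eq, Bool.and_eq_true, Bool.and_eq_true] at h
  have hk := allFrom_eq_true h.2.2 (Nat.zero_le k) (by omega)
  rw [natForce_eq, natForce_eq, Bool.and_eq_true, Bool.and_eq_true] at hk
  obtain ⟨h1, h2, h3⟩ := hk
  have h1 : certTarget (rowCert (tableRow T t) k) < N := by simpa using h1
  rw [clusterMutate_rowMat h.1 (hskew _ h1) h2 h3]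
  exact isTableQuiver_certMat h2 h1

theorem IsTableQuiver.mutate {T N : ℕ} (hT : ∀ t < N, checkRow T N t = true)
    {B : Matrix (Fin 8) (Fin 8) ℤ} (h : IsTableQuiver T N B) (k : Fin 8) :
    IsTableQuiver T N (clusterMutate B k) := by
  obtain ⟨t, ht, σ, hσ, rfl | rfl⟩ := h
  · rw [clusterMutate_submatrix hσ]
    exact (isTableQuiver_clusterMutate_rowMat hT ht _).submatrix hσ
  · rw [clusterMutate_submatrix hσ]
    have : clusterMutate (-rowMat (tableRow T t)) (σ k) =
        -clusterMutate (rowMat (tableRow T t)) (σ k) := by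
      ext i j
      exact clusterMutate_neg _ _ _
    rw [this]
    exact (isTableQuiver_clusterMutate_rowMat hT ht _).neg.submatrix hσ

theorem IsTableQuiver.mutationEquiv {T N : ℕ} (hT : ∀ t < N, checkRow T N t = true)
    {B B' : Matrix (Fin 8) (Fin 8) ℤ} (hB : IsTableQuiver T N B) (h : MutationEquiv B B') :
    IsTableQuiver T N B' := by
  induction h with
  | refl => exact hB
  | tail _ h ih =>
    obtain ⟨k, rfl⟩ := h
    exact ih.mutate hT k

theorem IsTableQuiver.exists_noncrossing {T N : ℕ} (hT : ∀ t < N, checkRow T N t = true)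
    {B : Matrix (Fin 8) (Fin 8) ℤ} (h : IsTableQuiver T N B) :
    ∃ p : Fin 8 → ℕ, Function.Injective p ∧ Noncrossing p B := by
  obtain ⟨t, ht, σ, hσ, hB⟩ := h
  have h := hT t ht
  rw [checkRow, natForce_eq, Bool.and_eq_true, Bool.and_eq_true] at h
  have hn := noncrossing_rowMat h.2.1
  refine ⟨fun i => (σ i : ℕ), fun i j hij => hσ (Fin.ext hij), ?_⟩
  rcases hB with rfl | rfl
  · exact hn.submatrix
  · intro a b c d hab hbc hcd hac hbd
    refine hn (σ a) (σ b) (σ c) (σ d) hab hbc hcd ?_ ?_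
    · simpa using hac
    · simpa using hbd

theorem exists_orientDigit {B : Matrix (Fin 8) (Fin 8) ℤ} (h : IsOrientationOf B (adjE 8)) :
    ∃ o < 128, ∀ i j : Fin 8, B i j = (orientDigit o i j : ℤ) - 1 := by
  obtain ⟨hB, h1, hadj⟩ := h
  set b : Fin 7 → Bool := fun m =>
    decide (0 < B ⟨parentE8 (m + 1), by unfold parentE8; split_ifs <;> omega⟩ ⟨m + 1, by omega⟩)
    with hb
  have hbit : ∀ m : Fin 7, (Nat.ofBits b).testBit m = b m := by
    intro m
    rw [Nat.testBit_ofBits_lt _ _ m.2]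
  have hval : ∀ i j : Fin 8, adjE 8 i j → B i j = 1 ∨ B i j = -1 := by
    intro i j hij
    have h2 := (hadj i j).2 hij
    have h3 := abs_le.1 (h1 i j)
    omega
  have hedge : ∀ i j : Fin 8, 1 ≤ (j : ℕ) → (i : ℕ) = parentE8 j →
      B i j = ((2 * ((Nat.ofBits b).testBit (j - 1)).toNat : ℕ) : ℤ) - 1 := by
    intro i j hj hij
    have hm := hbit ⟨j - 1, by omega⟩
    simp only at hm
    have hj' : (⟨(j : ℕ) - 1 + 1, by omega⟩ : Fin 8) = j := Fin.ext (Nat.sub_add_cancel hj)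
    have hbm : b ⟨j - 1, by omega⟩ = decide (0 < B i j) := by
      simp only [hb, Nat.sub_add_cancel hj, ← hij]
    rw [hm, hbm]
    have hadj' : adjE 8 i j := by
      unfold parentE8 at hij
      unfold adjE
      split_ifs at hij <;> omega
    rcases hval i j hadj' with h | h <;> rw [h] <;> simp
  refine ⟨Nat.ofBits b, Nat.ofBits_lt_two_pow b, fun i j => ?_⟩
  unfold orientDigit
  split_ifs with h2 h3
  · exact hedge i j h2.1 h2.2
  · have h4 := hedge j i h3.1 h3.2
    rw [hB j i, h4]
    cases (Nat.ofBits b).testBit (i - 1) <;> simp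
  · have : ¬ adjE 8 i j := by
      unfold parentE8 at h2 h3
      unfold adjE
      split_ifs at h2 h3 <;> omega
    have h4 : B i j = 0 := by
      by_contra h4
      exact this ((hadj i j).1 h4)
    rw [h4]
    simp

/-- Every quiver mutation equivalent to an orientation of the Dynkin diagram `E₈` has a
noncrossing order. -/
theorem exists_noncrossing_of_adjE_eight {B₀ B : Matrix (Fin 8) (Fin 8) ℤ}
    (h₀ : IsOrientationOf B₀ (adjE 8)) (h : MutationEquiv B₀ B) :
    ∃ p : Fin 8 → ℕ, Function.Injective p ∧ Noncrossing p B := by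
  obtain ⟨T, N, hT, ho⟩ := exists_e8_table
  obtain ⟨o, ho1, hB₀⟩ := exists_orientDigit h₀
  obtain ⟨c, hc⟩ := ho o ho1
  rw [checkOrient, natForce_eq, Bool.and_eq_true, Bool.and_eq_true] at hc
  obtain ⟨hc1, hc2, hc3⟩ := hc
  have hc1 : certTarget c < N := by simpa using hc1
  have : B₀ = certMat (tableRow T (certTarget c)) c := by
    ext i j
    have := Nat.eq_of_beq_eq_true (allFrom_eq_true (allFrom_eq_true hc3 (Nat.zero_le i) (by omega))
      (Nat.zero_le j) (by omega))
    rw [hB₀, this]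
    rfl
  exact ((this ▸ isTableQuiver_certMat hc2 hc1).mutationEquiv hT h).exists_noncrossing hT

/-- Every quiver mutation equivalent to an orientation of a Dynkin diagram of type E has a
noncrossing order. -/
theorem exists_noncrossing_of_adjE {n : ℕ} {B₀ B : Matrix (Fin n) (Fin n) ℤ}
    (hn : n = 6 ∨ n = 7 ∨ n = 8) (h₀ : IsOrientationOf B₀ (adjE n)) (h : MutationEquiv B₀ B) :
    ∃ p : Fin n → ℕ, Function.Injective p ∧ Noncrossing p B := by
  have hf : Function.Injective
      (fun i : Fin n => (⟨if (i : ℕ) = n - 1 then 7 else i, by split_ifs <;> omega⟩ : Fin 8)) := by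
    intro i j hij
    simp only [Fin.mk.injEq] at hij
    split_ifs at hij <;> omega
  obtain ⟨C, hC, rfl⟩ := h₀.exists_extend (adj' := adjE 8) hf
    (by intro i j; simp only [adjE]; omega) (by intro i; simp only [adjE]; omega)
    (by
      intro i j
      simp only [adjE]
      split_ifs <;> omega)
  obtain ⟨C', hC', rfl⟩ := h.exists_submatrix hf
  obtain ⟨p, hp, hpC⟩ := exists_noncrossing_of_adjE_eight hC hC'
  exact ⟨_, hp.comp hf, hpC.submatrix⟩

end TypeE

theorem IsDynkinADEOrientation.skew {n : ℕ} {B : Matrix (Fin n) (Fin n) ℤ}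
    (h : IsDynkinADEOrientation B) : ∀ i j, B j i = -B i j := by
  rcases h with h | h | h
  · exact h.1
  · exact h.2.1
  · exact h.2.1

theorem IsFiniteTypeClusterMatrix.skew {n : ℕ} {B : Matrix (Fin n) (Fin n) ℤ}
    (h : IsFiniteTypeClusterMatrix B) : ∀ i j, B j i = -B i j := by
  obtain ⟨B₀, h₀, h⟩ := h
  exact h.skew h₀.skew

theorem IsFiniteTypeClusterMatrix.exists_noncrossing {n : ℕ} {B : Matrix (Fin n) (Fin n) ℤ}
    (h : IsFiniteTypeClusterMatrix B) :
    ∃ p : Fin n → ℕ, Function.Injective p ∧ Noncrossing p B := by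
  obtain ⟨B₀, h₀ | ⟨hn, h₀⟩ | ⟨hn, h₀⟩, h⟩ := h
  · exact exists_noncrossing_of_adjA h₀ h
  · exact exists_noncrossing_of_adjD hn h₀ h
  · exact exists_noncrossing_of_adjE hn h₀ h

/-- (Theorem: every cluster quiver of simply laced finite type admits a
nice plane embedding, i.e. an embedding in the plane such that every vertex lies in
the closure of the unique unbounded connected component of the complement). -/
theorem exists_nice_plane_embedding {n : ℕ} (B : Matrix (Fin n) (Fin n) ℤ)
    (hB : IsFiniteTypeClusterMatrix B) :
    ∃ E : PlaneEmb (fun i j : Fin n => 0 < B i j), E.Nice := by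
  obtain ⟨q, hq, hqB⟩ := hB.exists_noncrossing
  exact exists_nice_of_noncrossing hB.skew hq hqB

end
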